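/- Let u be a positive singular solution of (-Δ)³u = c_n·u^{(n+6)/(n-6)} on ℝⁿ\{0}. Then: (a) u is radially symmetric with respect to the origin, i.e. u(x) = u(y) whenever |x| = |y| > 0; (b) u is strictly decreasing in the radial variable, i.e. u(x) > u(y) whenever 0 < |x| < |y| and x, y lie on the same ray from the origin; (c) there exists a bounded positive function v : ℝ → ℝ of class C^6 solving the ODE (O6), which is either the constant a*_n or periodic, such that u(x) = |x|^{(6-n)/2}·v(-log|x|) for every x ≠ 0. -/

import Mathlib

noncomputable section

open Real

/-- The Euclidean Laplacian: the sum of the second partial derivatives. -/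
def laplacian {n : ℕ} (u : EuclideanSpace ℝ (Fin n) → ℝ) (x : EuclideanSpace ℝ (Fin n)) : ℝ :=
  ∑ i : Fin n, iteratedFDeriv ℝ 2 u x ![EuclideanSpace.single i 1, EuclideanSpace.single i 1]

def cN (n : ℕ) : ℝ := (n : ℝ) * ((n : ℝ) - 6) * ((n : ℝ) ^ 4 - 20 * (n : ℝ) ^ 2 + 64) / 64
def K0 (n : ℕ) : ℝ := ((n : ℝ) - 6) ^ 2 * ((n : ℝ) - 2) ^ 2 * ((n : ℝ) + 2) ^ 2 / 64
def K2 (n : ℕ) : ℝ := (3 * (n : ℝ) ^ 4 - 24 * (n : ℝ) ^ 3 + 72 * (n : ℝ) ^ 2 - 96 * (n : ℝ) + 304) / 16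
def K4 (n : ℕ) : ℝ := (3 * (n : ℝ) ^ 2 - 12 * (n : ℝ) + 44) / 4
def aStar (n : ℕ) : ℝ := (K0 n / cN n) ^ (((n : ℝ) - 6) / 12)

section

open Filter Topology MeasureTheory
open scoped ContDiff Pointwise

/-- A Lyapunov functional argument for sixth-order linear differential inequalities:
`P` is the operator `-D⁶ + p₅ D⁵ + ⋯ + p₀`, compared with `N = D⁶ + n₅ D⁵ + ⋯ + n₁ D`. -/
theorem eq_zero_of_lyapunov (g : ℕ → ℝ → ℝ)
    (hg : ∀ i < 6, ∀ t, HasDerivAt (g i) (g (i + 1) t) t)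
    (p0 p1 p2 p3 p4 p5 n1 n2 n3 n4 n5 k : ℝ)
    (hP : ∀ t, 0 ≤ t → (p0 * g 0 t + p1 * g 1 t + p2 * g 2 t + p3 * g 3 t + p4 * g 4 t
      + p5 * g 5 t - g 6 t) ^ 2 ≤ k * g 0 t * (p0 * g 0 t + p1 * g 1 t + p2 * g 2 t + p3 * g 3 t
      + p4 * g 4 t + p5 * g 5 t - g 6 t))
    (r0 : 0 < p0 ^ 2 - k * p0)
    (r1 : 0 ≤ p1 ^ 2 - 2 * p0 * p2 + k * p2 - n1 ^ 2)
    (r2 : 0 ≤ p2 ^ 2 - 2 * p1 * p3 + 2 * p0 * p4 - k * p4 - (n2 ^ 2 - 2 * n1 * n3))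
    (r3 : 0 ≤ p3 ^ 2 - 2 * p2 * p4 + 2 * p1 * p5 + 2 * p0 - k
      - (n3 ^ 2 - 2 * n2 * n4 + 2 * n1 * n5))
    (r4 : 0 ≤ p4 ^ 2 - 2 * p3 * p5 - 2 * p2 - (n4 ^ 2 - 2 * n3 * n5 + 2 * n2))
    (r5 : 0 ≤ p5 ^ 2 + 2 * p4 - (n5 ^ 2 - 2 * n4))
    (hlim : ∀ i < 6, Tendsto (g i) atTop (𝓝 0))
    (h0 : g 0 0 = 0) (h1 : g 1 0 = 0) (h2 : g 2 0 = 0)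
    (hB : ((-p5 - n5) * g 5 0 ^ 2 + 2 * (-p4 - n4) * g 5 0 * g 4 0
      + (-p3 - n3) * (2 * g 5 0 * g 3 0 - g 4 0 ^ 2) + (p5 * p4 - n5 * n4) * g 4 0 ^ 2
      + 2 * (p5 * p3 - n5 * n3 + p2 + n2) * g 4 0 * g 3 0
      + (p4 * p3 - n4 * n3 - (p5 * p2 - n5 * n2) - p1 - n1) * g 3 0 ^ 2) ≤ 0) :
    ∀ t, 0 ≤ t → g 0 t = 0 := by
  -- primitives of products
  let E01 : ℝ → ℝ := fun t => g 0 t ^ 2 / 2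
  let E02 : ℝ → ℝ := fun t => g 0 t * g 1 t
  let E03 : ℝ → ℝ := fun t => g 0 t * g 2 t - g 1 t ^ 2 / 2
  let E04 : ℝ → ℝ := fun t => g 0 t * g 3 t - g 1 t * g 2 t
  let E05 : ℝ → ℝ := fun t => g 0 t * g 4 t - g 1 t * g 3 t + g 2 t ^ 2 / 2
  let E06 : ℝ → ℝ := fun t => g 0 t * g 5 t - g 1 t * g 4 t + g 2 t * g 3 t
  let E12 : ℝ → ℝ := fun t => g 1 t ^ 2 / 2
  let E13 : ℝ → ℝ := fun t => g 1 t * g 2 t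
  let E14 : ℝ → ℝ := fun t => g 1 t * g 3 t - g 2 t ^ 2 / 2
  let E15 : ℝ → ℝ := fun t => g 1 t * g 4 t - g 2 t * g 3 t
  let E16 : ℝ → ℝ := fun t => g 1 t * g 5 t - g 2 t * g 4 t + g 3 t ^ 2 / 2
  let E23 : ℝ → ℝ := fun t => g 2 t ^ 2 / 2
  let E24 : ℝ → ℝ := fun t => g 2 t * g 3 t
  let E25 : ℝ → ℝ := fun t => g 2 t * g 4 t - g 3 t ^ 2 / 2
  let E26 : ℝ → ℝ := fun t => g 2 t * g 5 t - g 3 t * g 4 t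
  let E34 : ℝ → ℝ := fun t => g 3 t ^ 2 / 2
  let E35 : ℝ → ℝ := fun t => g 3 t * g 4 t
  let E36 : ℝ → ℝ := fun t => g 3 t * g 5 t - g 4 t ^ 2 / 2
  let E45 : ℝ → ℝ := fun t => g 4 t ^ 2 / 2
  let E46 : ℝ → ℝ := fun t => g 4 t * g 5 t
  let E56 : ℝ → ℝ := fun t => g 5 t ^ 2 / 2
  let Q : ℝ → ℝ := fun t =>
    2 * (p0 * p1 * E01 t + (p0 * p2) * E02 t + (p0 * p3) * E03 t + (p0 * p4) * E04 t
      + (p0 * p5) * E05 t + (-p0) * E06 t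
      + (p1 * p2 - n1 * n2) * E12 t + (p1 * p3 - n1 * n3) * E13 t + (p1 * p4 - n1 * n4) * E14 t
      + (p1 * p5 - n1 * n5) * E15 t + (-p1 - n1) * E16 t
      + (p2 * p3 - n2 * n3) * E23 t + (p2 * p4 - n2 * n4) * E24 t + (p2 * p5 - n2 * n5) * E25 t
      + (-p2 - n2) * E26 t
      + (p3 * p4 - n3 * n4) * E34 t + (p3 * p5 - n3 * n5) * E35 t + (-p3 - n3) * E36 t
      + (p4 * p5 - n4 * n5) * E45 t + (-p4 - n4) * E46 t + (-p5 - n5) * E56 t)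
    - k * (p1 * E01 t + p2 * E02 t + p3 * E03 t + p4 * E04 t + p5 * E05 t - E06 t)
  let Pg : ℝ → ℝ := fun t => p0 * g 0 t + p1 * g 1 t + p2 * g 2 t + p3 * g 3 t + p4 * g 4 t
      + p5 * g 5 t - g 6 t
  let Ng : ℝ → ℝ := fun t => n1 * g 1 t + n2 * g 2 t + n3 * g 3 t + n4 * g 4 t
      + n5 * g 5 t + g 6 t
  let R : ℝ → ℝ := fun t => (p0 ^ 2 - k * p0) * g 0 t ^ 2
    + (p1 ^ 2 - 2 * p0 * p2 + k * p2 - n1 ^ 2) * g 1 t ^ 2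
    + (p2 ^ 2 - 2 * p1 * p3 + 2 * p0 * p4 - k * p4 - (n2 ^ 2 - 2 * n1 * n3)) * g 2 t ^ 2
    + (p3 ^ 2 - 2 * p2 * p4 + 2 * p1 * p5 + 2 * p0 - k
      - (n3 ^ 2 - 2 * n2 * n4 + 2 * n1 * n5)) * g 3 t ^ 2
    + (p4 ^ 2 - 2 * p3 * p5 - 2 * p2 - (n4 ^ 2 - 2 * n3 * n5 + 2 * n2)) * g 4 t ^ 2
    + (p5 ^ 2 + 2 * p4 - (n5 ^ 2 - 2 * n4)) * g 5 t ^ 2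
  have hQ : ∀ t, HasDerivAt Q (Pg t ^ 2 - k * g 0 t * Pg t - Ng t ^ 2 - R t) t := by
    intro t
    have d0 : HasDerivAt (g 0) (g 1 t) t := hg 0 (by norm_num) t
    have d1 : HasDerivAt (g 1) (g 2 t) t := hg 1 (by norm_num) t
    have d2 : HasDerivAt (g 2) (g 3 t) t := hg 2 (by norm_num) t
    have d3 : HasDerivAt (g 3) (g 4 t) t := hg 3 (by norm_num) t
    have d4 : HasDerivAt (g 4) (g 5 t) t := hg 4 (by norm_num) t
    have d5 : HasDerivAt (g 5) (g 6 t) t := hg 5 (by norm_num) t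
    have D01 : HasDerivAt E01 (g 0 t * g 1 t) t :=
      ((d0.pow 2).div_const 2).congr_deriv (by push_cast; ring)
    have D02 : HasDerivAt E02 (g 0 t * g 2 t + g 1 t ^ 2) t :=
      (d0.mul d1).congr_deriv (by ring)
    have D03 : HasDerivAt E03 (g 0 t * g 3 t) t :=
      ((d0.mul d2).sub ((d1.pow 2).div_const 2)).congr_deriv (by push_cast; ring)
    have D04 : HasDerivAt E04 (g 0 t * g 4 t - g 2 t ^ 2) t :=
      ((d0.mul d3).sub (d1.mul d2)).congr_deriv (by ring)
    have D05 : HasDerivAt E05 (g 0 t * g 5 t) t :=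
      (((d0.mul d4).sub (d1.mul d3)).add ((d2.pow 2).div_const 2)).congr_deriv
        (by push_cast; ring)
    have D06 : HasDerivAt E06 (g 0 t * g 6 t + g 3 t ^ 2) t :=
      (((d0.mul d5).sub (d1.mul d4)).add (d2.mul d3)).congr_deriv (by ring)
    have D12 : HasDerivAt E12 (g 1 t * g 2 t) t :=
      ((d1.pow 2).div_const 2).congr_deriv (by push_cast; ring)
    have D13 : HasDerivAt E13 (g 1 t * g 3 t + g 2 t ^ 2) t :=
      (d1.mul d2).congr_deriv (by ring)
    have D14 : HasDerivAt E14 (g 1 t * g 4 t) t :=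
      ((d1.mul d3).sub ((d2.pow 2).div_const 2)).congr_deriv (by push_cast; ring)
    have D15 : HasDerivAt E15 (g 1 t * g 5 t - g 3 t ^ 2) t :=
      ((d1.mul d4).sub (d2.mul d3)).congr_deriv (by ring)
    have D16 : HasDerivAt E16 (g 1 t * g 6 t) t :=
      (((d1.mul d5).sub (d2.mul d4)).add ((d3.pow 2).div_const 2)).congr_deriv
        (by push_cast; ring)
    have D23 : HasDerivAt E23 (g 2 t * g 3 t) t :=
      ((d2.pow 2).div_const 2).congr_deriv (by push_cast; ring)
    have D24 : HasDerivAt E24 (g 2 t * g 4 t + g 3 t ^ 2) t :=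
      (d2.mul d3).congr_deriv (by ring)
    have D25 : HasDerivAt E25 (g 2 t * g 5 t) t :=
      ((d2.mul d4).sub ((d3.pow 2).div_const 2)).congr_deriv (by push_cast; ring)
    have D26 : HasDerivAt E26 (g 2 t * g 6 t - g 4 t ^ 2) t :=
      ((d2.mul d5).sub (d3.mul d4)).congr_deriv (by ring)
    have D34 : HasDerivAt E34 (g 3 t * g 4 t) t :=
      ((d3.pow 2).div_const 2).congr_deriv (by push_cast; ring)
    have D35 : HasDerivAt E35 (g 3 t * g 5 t + g 4 t ^ 2) t :=
      (d3.mul d4).congr_deriv (by ring)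
    have D36 : HasDerivAt E36 (g 3 t * g 6 t) t :=
      ((d3.mul d5).sub ((d4.pow 2).div_const 2)).congr_deriv (by push_cast; ring)
    have D45 : HasDerivAt E45 (g 4 t * g 5 t) t :=
      ((d4.pow 2).div_const 2).congr_deriv (by push_cast; ring)
    have D46 : HasDerivAt E46 (g 4 t * g 6 t + g 5 t ^ 2) t :=
      (d4.mul d5).congr_deriv (by ring)
    have D56 : HasDerivAt E56 (g 5 t * g 6 t) t :=
      ((d5.pow 2).div_const 2).congr_deriv (by push_cast; ring)
    have key := (((((((((((((((((((((D01.const_mul (p0 * p1)).add (D02.const_mul (p0 * p2))).add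
      (D03.const_mul (p0 * p3))).add (D04.const_mul (p0 * p4))).add (D05.const_mul (p0 * p5))).add
      (D06.const_mul (-p0))).add (D12.const_mul (p1 * p2 - n1 * n2))).add
      (D13.const_mul (p1 * p3 - n1 * n3))).add (D14.const_mul (p1 * p4 - n1 * n4))).add
      (D15.const_mul (p1 * p5 - n1 * n5))).add (D16.const_mul (-p1 - n1))).add
      (D23.const_mul (p2 * p3 - n2 * n3))).add (D24.const_mul (p2 * p4 - n2 * n4))).add
      (D25.const_mul (p2 * p5 - n2 * n5))).add (D26.const_mul (-p2 - n2))).add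
      (D34.const_mul (p3 * p4 - n3 * n4))).add (D35.const_mul (p3 * p5 - n3 * n5))).add
      (D36.const_mul (-p3 - n3))).add (D45.const_mul (p4 * p5 - n4 * n5))).add
      (D46.const_mul (-p4 - n4))).add (D56.const_mul (-p5 - n5))).const_mul 2 |>.sub
      (((((((D01.const_mul p1).add (D02.const_mul p2)).add (D03.const_mul p3)).add
        (D04.const_mul p4)).add (D05.const_mul p5)).sub D06).const_mul k)
    refine key.congr_deriv ?_
    simp only [Pg, Ng, R]
    ring
  have hle : ∀ t, 0 ≤ t → Pg t ^ 2 - k * g 0 t * Pg t - Ng t ^ 2 - R t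
      ≤ -((p0 ^ 2 - k * p0) * g 0 t ^ 2) := by
    intro t ht
    have := hP t ht
    have e1 := mul_nonneg r1 (sq_nonneg (g 1 t))
    have e2 := mul_nonneg r2 (sq_nonneg (g 2 t))
    have e3 := mul_nonneg r3 (sq_nonneg (g 3 t))
    have e4 := mul_nonneg r4 (sq_nonneg (g 4 t))
    have e5 := mul_nonneg r5 (sq_nonneg (g 5 t))
    have e6 := sq_nonneg (Ng t)
    have e7 : R t = _ := rfl
    simp only [Pg]
    simp only [R] at *
    linarith
  have hQc : Continuous Q := continuous_iff_continuousAt.2 fun t => (hQ t).continuousAt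
  have hanti : AntitoneOn Q (Set.Ici 0) := by
    apply antitoneOn_of_deriv_nonpos (convex_Ici 0) hQc.continuousOn
      (fun t _ => (hQ t).differentiableAt.differentiableWithinAt)
    intro t ht
    rw [interior_Ici] at ht
    rw [(hQ t).deriv]
    exact (hle t (le_of_lt ht)).trans (neg_nonpos.2 (mul_nonneg r0.le (sq_nonneg _)))
  have hlimQ : Tendsto Q atTop (𝓝 0) := by
    have l0 := hlim 0 (by norm_num)
    have l1 := hlim 1 (by norm_num)
    have l2 := hlim 2 (by norm_num)
    have l3 := hlim 3 (by norm_num)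
    have l4 := hlim 4 (by norm_num)
    have l5 := hlim 5 (by norm_num)
    let F : ℝ × ℝ × ℝ × ℝ × ℝ × ℝ → ℝ := fun x =>
      let g0 := x.1; let g1 := x.2.1; let g2 := x.2.2.1; let g3 := x.2.2.2.1
      let g4 := x.2.2.2.2.1; let g5 := x.2.2.2.2.2
      2 * (p0 * p1 * (g0 ^ 2 / 2) + (p0 * p2) * (g0 * g1) + (p0 * p3) * (g0 * g2 - g1 ^ 2 / 2)
      + (p0 * p4) * (g0 * g3 - g1 * g2)
      + (p0 * p5) * (g0 * g4 - g1 * g3 + g2 ^ 2 / 2) + (-p0) * (g0 * g5 - g1 * g4 + g2 * g3)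
      + (p1 * p2 - n1 * n2) * (g1 ^ 2 / 2) + (p1 * p3 - n1 * n3) * (g1 * g2)
      + (p1 * p4 - n1 * n4) * (g1 * g3 - g2 ^ 2 / 2)
      + (p1 * p5 - n1 * n5) * (g1 * g4 - g2 * g3)
      + (-p1 - n1) * (g1 * g5 - g2 * g4 + g3 ^ 2 / 2)
      + (p2 * p3 - n2 * n3) * (g2 ^ 2 / 2) + (p2 * p4 - n2 * n4) * (g2 * g3)
      + (p2 * p5 - n2 * n5) * (g2 * g4 - g3 ^ 2 / 2)
      + (-p2 - n2) * (g2 * g5 - g3 * g4)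
      + (p3 * p4 - n3 * n4) * (g3 ^ 2 / 2) + (p3 * p5 - n3 * n5) * (g3 * g4)
      + (-p3 - n3) * (g3 * g5 - g4 ^ 2 / 2)
      + (p4 * p5 - n4 * n5) * (g4 ^ 2 / 2) + (-p4 - n4) * (g4 * g5) + (-p5 - n5) * (g5 ^ 2 / 2))
    - k * (p1 * (g0 ^ 2 / 2) + p2 * (g0 * g1) + p3 * (g0 * g2 - g1 ^ 2 / 2)
      + p4 * (g0 * g3 - g1 * g2)
      + p5 * (g0 * g4 - g1 * g3 + g2 ^ 2 / 2) - (g0 * g5 - g1 * g4 + g2 * g3))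
    have hF : Continuous F := by fun_prop
    have := (hF.tendsto (0, 0, 0, 0, 0, 0)).comp
      (l0.prodMk_nhds (l1.prodMk_nhds (l2.prodMk_nhds (l3.prodMk_nhds (l4.prodMk_nhds l5)))))
    have z : F (0, 0, 0, 0, 0, 0) = 0 := by simp [F]
    rw [z] at this
    exact this
  have hQ0 : Q 0 ≤ 0 := by
    refine le_trans (le_of_eq ?_) hB
    simp only [Q, E01, E02, E03, E04, E05, E06, E12, E13, E14, E15, E16, E23, E24, E25, E26, E34,
      E35, E36, E45, E46, E56, h0, h1, h2]
    ring
  have hQz : ∀ t, 0 ≤ t → Q t = 0 := by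
    intro t ht
    apply le_antisymm ((hanti Set.self_mem_Ici ht ht).trans hQ0)
    apply le_of_tendsto hlimQ
    filter_upwards [eventually_ge_atTop t] with s hs
    exact hanti ht (ht.trans hs) hs
  have hpos : ∀ t, 0 < t → g 0 t = 0 := by
    intro t ht
    have e : Q =ᶠ[𝓝 t] fun _ => 0 := by
      filter_upwards [lt_mem_nhds ht] with s hs
      exact hQz s hs.le
    have hz : Pg t ^ 2 - k * g 0 t * Pg t - Ng t ^ 2 - R t = 0 := by
      have := e.deriv_eq
      rw [(hQ t).deriv] at this
      simpa using this
    have h3 := hle t ht.le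
    rw [hz] at h3
    have h4 : (p0 ^ 2 - k * p0) * g 0 t ^ 2 = 0 :=
      le_antisymm (by linarith) (mul_nonneg r0.le (sq_nonneg _))
    rcases mul_eq_zero.1 h4 with h | h
    · exact absurd h r0.ne'
    · exact pow_eq_zero_iff (two_ne_zero) |>.1 h
  intro t ht
  rcases ht.eq_or_lt with rfl | h
  · exact h0
  · exact hpos t h

/-- The sixth-order equation `(a²-D²)((a+2)²-D²)((a+4)²-D²) v = a(a+1)⋯(a+5) v^(1+6/a)`
for a positive function `v = V 0` with derivatives `V i`. -/
structure IsEmdenFowler (a : ℝ) (V : ℕ → ℝ → ℝ) : Prop where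
  deriv : ∀ i < 6, ∀ t, HasDerivAt (V i) (V (i + 1) t) t
  pos : ∀ t, 0 < V 0 t
  ode : ∀ t, (a * (a + 2) * (a + 4)) ^ 2 * V 0 t
    - (a ^ 2 * (a + 2) ^ 2 + a ^ 2 * (a + 4) ^ 2 + (a + 2) ^ 2 * (a + 4) ^ 2) * V 2 t
    + (a ^ 2 + (a + 2) ^ 2 + (a + 4) ^ 2) * V 4 t - V 6 t
    = a * (a + 1) * (a + 2) * (a + 3) * (a + 4) * (a + 5) * V 0 t ^ (1 + 6 / a)

theorem coeff_two_nonneg {x : ℝ} (hx : 0 ≤ x) :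
    0 ≤ 10142232077 / 19531250 + 22614695581 / 500000000 * x - 245276715173 / 5000000000 * x ^ 2
      - 376157243287 / 40000000000 * x ^ 3 + 130440531913 / 40000000000 * x ^ 4 := by
  nlinarith [sq_nonneg (x ^ 2 - 1.44 * x - 7), mul_nonneg hx (sq_nonneg (x - 3)), sq_nonneg x,
    sq_nonneg (x - 2)]

theorem coeff_three_nonneg {x : ℝ} (hx : 0 ≤ x) :
    0 ≤ 7662237257619599 / 64000000000000 - 123663827426477 / 16000000000000 * x
      - 103412237586187 / 32000000000000 * x ^ 2 + 7436359560267 / 16000000000000 * x ^ 3 := by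
  nlinarith [mul_nonneg hx (sq_nonneg (x - 4.5)), sq_nonneg x, sq_nonneg (x - 5)]

theorem coeff_one_nonneg {x : ℝ} (hx : 0 ≤ x) :
    0 ≤ 1265422223 / 100000000 * x ^ 6 - 1380351 / 50000000 * x ^ 7
      + 384671 / 100000000 * x ^ 8 := by
  have : 0 ≤ x ^ 6 * (1265422223 / 100000000 - 1380351 / 50000000 * x
      + 384671 / 100000000 * x ^ 2) :=
    mul_nonneg (by positivity) (by nlinarith [sq_nonneg (x - 1)])
  linarith

theorem boundary_form_nonpos {x : ℝ} (hx : 0 ≤ x) (α β : ℝ) :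
    (- 126188918707601 / 64000000000000 - 2903086615731877 / 16000000000000 * x
      - 4039919698268587 / 32000000000000 * x ^ 2 - 360170285068133 / 16000000000000 * x ^ 3
      - 82163264551841 / 64000000000000 * x ^ 4 - 3673377491 / 80000000000 * x ^ 5) * α ^ 2
    + (- 1200439 / 800000 + 20891093 / 1000000 * x + 25574153 / 4000000 * x ^ 2
      + 449929 / 2000000 * x ^ 3) * (α * β) + (- 15301 / 2000 - 577 / 2000 * x) * β ^ 2 ≤ 0 := by
  have hd : 0 < 15301 / 2000 + 577 / 2000 * x := by positivity
  have hdisc : 0 ≤ 1858763955508952901 / 32000000000000000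
    + 35951920571706849137 / 6400000000000000 * x
    + 11697794219307904349 / 3200000000000000 * x ^ 2
    + 1817918181235753753 / 3200000000000000 * x ^ 3
    + 95918850174689621 / 6400000000000000 * x ^ 4
    + 320858157149057 / 32000000000000000 * x ^ 5
    + 95177761897 / 40000000000000 * x ^ 6 := by positivity
  have h1 := mul_nonneg hdisc (sq_nonneg α)
  have h2 := sq_nonneg (2 * (15301 / 2000 + 577 / 2000 * x) * β
    - (- 1200439 / 800000 + 20891093 / 1000000 * x + 25574153 / 4000000 * x ^ 2
      + 449929 / 2000000 * x ^ 3) * α)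
  by_contra hcon
  push Not at hcon
  have h3 := mul_pos hd hcon
  linarith

/-- Uniqueness for odd parts: the comparison inequality forces a decaying solution with
vanishing second-order jet to be zero. -/
theorem eq_zero_of_sixth_order {a : ℝ} (ha : 1 / 2 ≤ a) (W : ℕ → ℝ → ℝ)
    (hW : ∀ i < 6, ∀ t, HasDerivAt (W i) (W (i + 1) t) t)
    (hb : ∀ i < 6, ∃ M, ∀ t, |W i t| ≤ M)
    (h0 : W 0 0 = 0) (h1 : W 1 0 = 0) (h2 : W 2 0 = 0) (h4 : W 4 0 = 0)
    (hode : ∀ t, ((a * (a + 2) * (a + 4)) ^ 2 * W 0 t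
      - (a ^ 2 * (a + 2) ^ 2 + a ^ 2 * (a + 4) ^ 2 + (a + 2) ^ 2 * (a + 4) ^ 2) * W 2 t
      + (a ^ 2 + (a + 2) ^ 2 + (a + 4) ^ 2) * W 4 t - W 6 t) ^ 2 ≤
      16 / 5 * ((a + 1) * (a + 2) * (a + 3) * (a + 4) * (a + 5) * (a + 6)) * W 0 t *
      ((a * (a + 2) * (a + 4)) ^ 2 * W 0 t
      - (a ^ 2 * (a + 2) ^ 2 + a ^ 2 * (a + 4) ^ 2 + (a + 2) ^ 2 * (a + 4) ^ 2) * W 2 t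
      + (a ^ 2 + (a + 2) ^ 2 + (a + 4) ^ 2) * W 4 t - W 6 t)) :
    ∀ t, 0 ≤ t → W 0 t = 0 := by
  obtain ⟨x, hx, rfl⟩ : ∃ x : ℝ, 0 ≤ x ∧ a = (x + 1) / 2 := ⟨2 * a - 1, by linarith, by ring⟩
  obtain ⟨l, hl⟩ : ∃ l : ℝ, l = (x + 3) / 2 := ⟨_, rfl⟩
  have hlpos : 0 < l := by rw [hl]; positivity
  let h : ℕ → ℕ → ℝ → ℝ := fun i => Nat.rec (fun j => W j)
    (fun _ f j t => f (j + 1) t - l * f j t) i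
  have hs : ∀ i j t, h (i + 1) j t = h i (j + 1) t - l * h i j t := fun i j t => rfl
  have hz : ∀ j t, h 0 j t = W j t := fun j t => rfl
  have hd : ∀ i j, i + j < 6 → ∀ t, HasDerivAt (h i j) (h i (j + 1) t) t := by
    intro i
    induction i with
    | zero => intro j hj t; exact hW j (by omega) t
    | succ i ih =>
      intro j hj t
      exact (ih (j + 1) (by omega) t).sub ((ih j (by omega) t).const_mul l)
  have hbd : ∀ i j, i + j < 6 → ∃ M, ∀ t, |h i j t| ≤ M := by
    intro i
    induction i with
    | zero => intro j hj; exact hb j (by omega)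
    | succ i ih =>
      intro j hj
      obtain ⟨M1, hM1⟩ := ih (j + 1) (by omega)
      obtain ⟨M2, hM2⟩ := ih j (by omega)
      refine ⟨M1 + l * M2, fun t => ?_⟩
      rw [hs]
      refine (abs_sub _ _).trans (add_le_add (hM1 t) ?_)
      rw [abs_mul, abs_of_pos hlpos]
      exact mul_le_mul_of_nonneg_left (hM2 t) hlpos.le
  let g : ℕ → ℝ → ℝ := fun i t => exp (-(l * t)) * h i 0 t
  have hg : ∀ i < 6, ∀ t, HasDerivAt (g i) (g (i + 1) t) t := by
    intro i hi t
    have e1 : HasDerivAt (fun t => exp (-(l * t))) (exp (-(l * t)) * (-(l * 1))) t :=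
      (((hasDerivAt_id t).const_mul l).neg).exp
    refine (e1.mul (hd i 0 (by omega) t)).congr_deriv ?_
    simp only [g, hs]
    ring
  have hlim : ∀ i < 6, Tendsto (g i) atTop (𝓝 0) := by
    intro i hi
    obtain ⟨M, hM⟩ := hbd i 0 (by omega)
    have t1 : Tendsto (fun t : ℝ => exp (-(l * t)) * M) atTop (𝓝 0) := by
      have : Tendsto (fun t : ℝ => exp (-(l * t))) atTop (𝓝 0) :=
        tendsto_exp_neg_atTop_nhds_zero.comp (tendsto_id.const_mul_atTop hlpos)
      simpa using this.mul_const M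
    refine squeeze_zero_norm (fun t => ?_) t1
    simp only [g, norm_mul, norm_eq_abs, abs_exp]
    exact mul_le_mul_of_nonneg_left (hM t) (exp_pos _).le
  suffices H : ∀ t, 0 ≤ t → g 0 t = 0 by
    intro t ht
    have := H t ht
    simp only [g, hz] at this
    exact (mul_eq_zero.1 this).resolve_left (exp_ne_zero _)
  have c2 := coeff_two_nonneg hx
  have c3 := coeff_three_nonneg hx
  have c1 := coeff_one_nonneg hx
  refine eq_zero_of_lyapunov g hg (- 144 - 132 * x - 36 * x ^ 2 - 3 * x ^ 3)
    (- 84 - 28 * x + 3 * x ^ 2 + x ^ 3) (152 + 147 * x + 39 * x ^ 2 + 3 * x ^ 3)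
    (93 + 31 * x - 3 * x ^ 2 - x ^ 3) (- 7 - 15 * x - 3 * x ^ 2) (- 9 - 3 * x)
    (181056 / 625 + 164281 / 625 * x + 104031 / 1250 * x ^ 2 + 104337 / 10000 * x ^ 3
      + 3823 / 10000 * x ^ 4)
    (65586 / 125 + 1058953 / 2500 * x + 1166559 / 10000 * x ^ 2 + 7761 / 625 * x ^ 3
      + 3823 / 10000 * x ^ 4)
    (2595957401 / 8000000 + 800847477 / 4000000 * x + 298719329 / 8000000 * x ^ 2
      + 19839 / 10000 * x ^ 3)
    (841174201 / 8000000 + 171075077 / 4000000 * x + 31270529 / 8000000 * x ^ 2)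
    (33301 / 2000 + 6577 / 2000 * x)
    (27027 / 4 + 32268 / 5 * x + 48259 / 20 * x ^ 2 + 456 * x ^ 3 + 185 / 4 * x ^ 4
      + 12 / 5 * x ^ 5 + 1 / 20 * x ^ 6) ?_ ?_ ?_ ?_ ?_ ?_ ?_ hlim ?_ ?_ ?_ ?_
  · intro t ht
    have := hode t
    have e2 : 0 ≤ exp (-(l * t)) ^ 2 := by positivity
    have := mul_le_mul_of_nonneg_left this e2
    simp only [g, hs, hz]
    generalize exp (-(l * t)) = e at this ⊢
    subst hl
    refine le_of_eq_of_le ?_ (this.trans (le_of_eq ?_)) <;> ring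
  · have : 0 < 993708 + 9296127 / 5 * x + 1470375 * x ^ 2 + 2588565 / 4 * x ^ 3 + 175167 * x ^ 4
      + 606429 / 20 * x ^ 5 + 3366 * x ^ 6 + 927 / 4 * x ^ 7 + 9 * x ^ 8 + 3 / 20 * x ^ 9 := by
      positivity
    linarith
  · have h0 : 0 ≤ 993708 + 9296127 / 5 * x + 1470375 * x ^ 2 + 2588565 / 4 * x ^ 3 + 175167 * x ^ 4
      + 606429 / 20 * x ^ 5 + 3366 * x ^ 6 + 927 / 4 * x ^ 7 + 9 * x ^ 8 + 3 / 20 * x ^ 9 := by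
      positivity
    have h1 : 0 ≤ 89818614 / 390625 + 77878842237 / 1562500 * x + 82095655837 / 1562500 * x ^ 2
      + 6674615769 / 312500 * x ^ 3 + 13009369543 / 3125000 * x ^ 4
      + 2395562527 / 6250000 * x ^ 5 := by positivity
    linarith
  · have h1 : 0 ≤ 89818614 / 390625 + 77878842237 / 1562500 * x + 82095655837 / 1562500 * x ^ 2
      + 6674615769 / 312500 * x ^ 3 + 13009369543 / 3125000 * x ^ 4
      + 2395562527 / 6250000 * x ^ 5 := by positivity
    have h2 : 0 ≤ 5644199163 / 8000000000 * x ^ 5 + 112863967 / 40000000000 * x ^ 6 := by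
      positivity
    linarith
  · have h2 : 0 ≤ 5644199163 / 8000000000 * x ^ 5 + 112863967 / 40000000000 * x ^ 6 := by
      positivity
    have h3 : 0 ≤ 298675260159 / 64000000000000 * x ^ 4 := by positivity
    linarith
  · have h3 : 0 ≤ 298675260159 / 64000000000000 * x ^ 4 := by positivity
    have h4 : 0 ≤ 34 / 625 + 17 / 625 * x + 17 / 5000 * x ^ 2 := by positivity
    linarith
  · have h4 : 0 ≤ 34 / 625 + 17 / 625 * x + 17 / 5000 * x ^ 2 := by positivity
    linarith
  · simp [g, hz, h0]
  · simp [g, hs, hz, h0, h1]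
  · simp [g, hs, hz, h0, h1, h2]
  · have e3 : g 3 0 = W 3 0 := by simp [g, hs, hz, h0, h1, h2]
    have e4 : g 4 0 = -4 * l * W 3 0 := by simp [g, hs, hz, h0, h1, h2, h4]; ring
    have e5 : g 5 0 = W 5 0 + 10 * l ^ 2 * W 3 0 := by
      simp [g, hs, hz, h0, h1, h2, h4]; ring
    rw [e3, e4, e5, hl]
    have := boundary_form_nonpos hx (W 3 0) (W 5 0)
    linarith

theorem rpow_sub_rpow_sq_le {a x y : ℝ} (ha : 0 < a) (hx : 0 < x) (hy : 0 < y)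
    (hxb : x ^ (6 / a) ≤ 16 / 5) (hyb : y ^ (6 / a) ≤ 16 / 5) :
    (x ^ (1 + 6 / a) - y ^ (1 + 6 / a)) ^ 2 ≤
      16 / 5 * (1 + 6 / a) * (x - y) * (x ^ (1 + 6 / a) - y ^ (1 + 6 / a)) := by
  have key : ∀ {x y : ℝ}, 0 < x → 0 < y → y ≤ x → x ^ (6 / a) ≤ 16 / 5 →
      0 ≤ x ^ (1 + 6 / a) - y ^ (1 + 6 / a) ∧
      x ^ (1 + 6 / a) - y ^ (1 + 6 / a) ≤ 16 / 5 * (1 + 6 / a) * (x - y) := by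
    intro x y hx hy hyx hxb
    have hp : 0 < 6 / a := by positivity
    refine ⟨sub_nonneg.2 (rpow_le_rpow hy.le hyx (by positivity)), ?_⟩
    have b := one_add_mul_self_le_rpow_one_add (s := y / x - 1) (p := 1 + 6 / a)
      (by have : 0 < y / x := by positivity
          linarith) (by linarith)
    rw [add_sub_cancel, div_rpow hy.le hx.le] at b
    have hX : x ^ (1 + 6 / a) = x * x ^ (6 / a) := by rw [rpow_add hx, rpow_one]
    have hXp : 0 < x ^ (1 + 6 / a) := by positivity
    rw [le_div_iff₀ hXp] at b
    have e : (1 + (1 + 6 / a) * (y / x - 1)) * x ^ (1 + 6 / a)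
        = x ^ (1 + 6 / a) - (1 + 6 / a) * x ^ (6 / a) * (x - y) := by
      rw [hX]; field_simp; ring
    rw [e] at b
    have : (1 + 6 / a) * x ^ (6 / a) * (x - y) ≤ (1 + 6 / a) * (16 / 5) * (x - y) := by
      gcongr
    linarith
  rcases le_total y x with h | h
  · obtain ⟨k1, k2⟩ := key hx hy h hxb
    nlinarith
  · obtain ⟨k1, k2⟩ := key hy hx h hyb
    nlinarith

/-- Bounded solutions are symmetric about each of their critical points. -/
theorem IsEmdenFowler.symm_of_critical {a : ℝ} (ha : 1 / 2 ≤ a) {V : ℕ → ℝ → ℝ}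
    (hV : IsEmdenFowler a V) (hb : ∀ i < 6, ∃ M, ∀ t, |V i t| ≤ M)
    (hup : ∀ t, V 0 t ^ (6 / a) ≤ 16 / 5) {t₀ : ℝ} (ht₀ : V 1 t₀ = 0) (t : ℝ) :
    V 0 (t₀ + t) = V 0 (t₀ - t) := by
  have ha0 : 0 < a := by linarith
  let W : ℕ → ℝ → ℝ := fun i t => V i (t₀ + t) - (-1) ^ i * V i (t₀ - t)
  have hW : ∀ i < 6, ∀ t, HasDerivAt (W i) (W (i + 1) t) t := by
    intro i hi t
    have d1 : HasDerivAt (fun t => V i (t₀ + t)) (V (i + 1) (t₀ + t)) t :=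
      HasDerivAt.comp_const_add t₀ t (hV.deriv i hi (t₀ + t))
    have d2 : HasDerivAt (fun t => V i (t₀ - t)) (-V (i + 1) (t₀ - t)) t :=
      HasDerivAt.comp_const_sub t₀ t (hV.deriv i hi (t₀ - t))
    refine (d1.sub (d2.const_mul ((-1) ^ i))).congr_deriv ?_
    simp only [W, pow_succ]
    ring
  have hWb : ∀ i < 6, ∃ M, ∀ t, |W i t| ≤ M := by
    intro i hi
    obtain ⟨M, hM⟩ := hb i hi
    refine ⟨M + M, fun t => (abs_sub _ _).trans (add_le_add (hM _) ?_)⟩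
    rw [abs_mul, abs_pow, abs_neg, abs_one, one_pow, one_mul]
    exact hM _
  have main : ∀ t, 0 ≤ t → W 0 t = 0 := by
    refine eq_zero_of_sixth_order ha W hW hWb (by simp [W]) (by simp [W, ht₀]) (by simp [W])
      (by norm_num [W]) ?_
    intro t
    have o1 := hV.ode (t₀ + t)
    have o2 := hV.ode (t₀ - t)
    have e : (a * (a + 2) * (a + 4)) ^ 2 * W 0 t
      - (a ^ 2 * (a + 2) ^ 2 + a ^ 2 * (a + 4) ^ 2 + (a + 2) ^ 2 * (a + 4) ^ 2) * W 2 t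
      + (a ^ 2 + (a + 2) ^ 2 + (a + 4) ^ 2) * W 4 t - W 6 t
      = a * (a + 1) * (a + 2) * (a + 3) * (a + 4) * (a + 5) *
        (V 0 (t₀ + t) ^ (1 + 6 / a) - V 0 (t₀ - t) ^ (1 + 6 / a)) := by
      simp only [W]
      linear_combination o1 - o2
    rw [e]
    have h := rpow_sub_rpow_sq_le ha0 (hV.pos (t₀ + t)) (hV.pos (t₀ - t)) (hup _) (hup _)
    have hc : 0 ≤ (a * (a + 1) * (a + 2) * (a + 3) * (a + 4) * (a + 5)) ^ 2 := by positivity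
    have h' := mul_le_mul_of_nonneg_left h hc
    have hw : W 0 t = V 0 (t₀ + t) - V 0 (t₀ - t) := by simp [W]
    rw [hw]
    refine le_of_le_of_eq (le_of_eq_of_le (by ring) h') ?_
    field_simp
  rcases le_total 0 t with h | h
  · have := main t h
    simp only [W, pow_zero, one_mul] at this
    linarith
  · have := main (-t) (by linarith)
    simp only [W, pow_zero, one_mul, sub_neg_eq_add, ← sub_eq_add_neg] at this
    linarith

/-- The quotient `P(D)/(D-μ)` applied to `e`, for a root `μ` of
`P = (a²-D²)((a+2)²-D²)((a+4)²-D²)`. -/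
def concomitant (a μ : ℝ) (e : ℕ → ℝ → ℝ) (t : ℝ) : ℝ :=
  -e 5 t - μ * e 4 t + ((a ^ 2 + (a + 2) ^ 2 + (a + 4) ^ 2) - μ ^ 2) * e 3 t
    + ((a ^ 2 + (a + 2) ^ 2 + (a + 4) ^ 2) * μ - μ ^ 3) * e 2 t
    + (-(a ^ 2 * (a + 2) ^ 2 + a ^ 2 * (a + 4) ^ 2 + (a + 2) ^ 2 * (a + 4) ^ 2)
      + (a ^ 2 + (a + 2) ^ 2 + (a + 4) ^ 2) * μ ^ 2 - μ ^ 4) * (e 1 t + μ * e 0 t)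

theorem hasDerivAt_exp_mul_concomitant {a μ : ℝ}
    (hμ : (a ^ 2 - μ ^ 2) * ((a + 2) ^ 2 - μ ^ 2) * ((a + 4) ^ 2 - μ ^ 2) = 0) {e : ℕ → ℝ → ℝ}
    (he : ∀ i < 6, ∀ t, HasDerivAt (e i) (e (i + 1) t) t) (t : ℝ) :
    HasDerivAt (fun t => exp (-(μ * t)) * concomitant a μ e t)
      (exp (-(μ * t)) * ((a * (a + 2) * (a + 4)) ^ 2 * e 0 t
        - (a ^ 2 * (a + 2) ^ 2 + a ^ 2 * (a + 4) ^ 2 + (a + 2) ^ 2 * (a + 4) ^ 2) * e 2 t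
        + (a ^ 2 + (a + 2) ^ 2 + (a + 4) ^ 2) * e 4 t - e 6 t)) t := by
  have e1 : HasDerivAt (fun t => exp (-(μ * t))) (exp (-(μ * t)) * (-(μ * 1))) t :=
    (((hasDerivAt_id t).const_mul μ).neg).exp
  have d := ((((he 5 (by norm_num) t).neg.sub ((he 4 (by norm_num) t).const_mul μ)).add
    ((he 3 (by norm_num) t).const_mul ((a ^ 2 + (a + 2) ^ 2 + (a + 4) ^ 2) - μ ^ 2))).add
    ((he 2 (by norm_num) t).const_mul ((a ^ 2 + (a + 2) ^ 2 + (a + 4) ^ 2) * μ - μ ^ 3))).add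
    (((he 1 (by norm_num) t).add ((he 0 (by norm_num) t).const_mul μ)).const_mul
      (-(a ^ 2 * (a + 2) ^ 2 + a ^ 2 * (a + 4) ^ 2 + (a + 2) ^ 2 * (a + 4) ^ 2)
      + (a ^ 2 + (a + 2) ^ 2 + (a + 4) ^ 2) * μ ^ 2 - μ ^ 4))
  refine (e1.mul d).congr_deriv ?_
  simp only [Pi.neg_apply, Pi.add_apply, Pi.sub_apply]
  linear_combination (exp (-(μ * t)) * (-e 0 t)) * hμ

theorem tendsto_exp_mul_concomitant {a μ : ℝ} (hμ : 0 < μ) {e : ℕ → ℝ → ℝ}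
    (hb : ∀ i < 6, ∃ M, ∀ t, |e i t| ≤ M) :
    Tendsto (fun t => exp (-(μ * t)) * concomitant a μ e t) atTop (𝓝 0) := by
  have hexp : Tendsto (fun t : ℝ => exp (-(μ * t))) atTop (𝓝 0) :=
    tendsto_exp_neg_atTop_nhds_zero.comp (tendsto_id.const_mul_atTop hμ)
  have key : ∀ i < 6, Tendsto (fun t => exp (-(μ * t)) * e i t) atTop (𝓝 0) := by
    intro i hi
    obtain ⟨M, hM⟩ := hb i hi
    refine squeeze_zero_norm (fun t => ?_) (by simpa using hexp.mul_const M)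
    rw [norm_mul, norm_eq_abs, abs_exp]
    exact mul_le_mul_of_nonneg_left (hM t) (exp_pos _).le
  have := ((((key 5 (by norm_num)).neg.sub ((key 4 (by norm_num)).const_mul μ)).add
    ((key 3 (by norm_num)).const_mul ((a ^ 2 + (a + 2) ^ 2 + (a + 4) ^ 2) - μ ^ 2))).add
    ((key 2 (by norm_num)).const_mul ((a ^ 2 + (a + 2) ^ 2 + (a + 4) ^ 2) * μ - μ ^ 3))).add
    (((key 1 (by norm_num)).add ((key 0 (by norm_num)).const_mul μ)).const_mul
      (-(a ^ 2 * (a + 2) ^ 2 + a ^ 2 * (a + 4) ^ 2 + (a + 2) ^ 2 * (a + 4) ^ 2)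
      + (a ^ 2 + (a + 2) ^ 2 + (a + 4) ^ 2) * μ ^ 2 - μ ^ 4))
  simp only [neg_zero, mul_zero, sub_zero, add_zero] at this
  refine this.congr fun t => ?_
  simp only [concomitant]
  ring

/-- The combination of the three exponential multipliers. -/
def multiplier (a x y z : ℝ) (e : ℕ → ℝ → ℝ) (t : ℝ) : ℝ :=
  x * (exp (-(a * t)) * concomitant a a e t)
    + y * (exp (-((a + 2) * t)) * concomitant a (a + 2) e t)
    + z * (exp (-((a + 4) * t)) * concomitant a (a + 4) e t)

theorem hasDerivAt_multiplier (a x y z : ℝ) {e : ℕ → ℝ → ℝ}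
    (he : ∀ i < 6, ∀ t, HasDerivAt (e i) (e (i + 1) t) t) (t : ℝ) :
    HasDerivAt (multiplier a x y z e)
      ((x * exp (-(a * t)) + y * exp (-((a + 2) * t)) + z * exp (-((a + 4) * t))) *
        ((a * (a + 2) * (a + 4)) ^ 2 * e 0 t
        - (a ^ 2 * (a + 2) ^ 2 + a ^ 2 * (a + 4) ^ 2 + (a + 2) ^ 2 * (a + 4) ^ 2) * e 2 t
        + (a ^ 2 + (a + 2) ^ 2 + (a + 4) ^ 2) * e 4 t - e 6 t)) t := by
  have h1 := hasDerivAt_exp_mul_concomitant (a := a) (μ := a) (by ring) he t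
  have h2 := hasDerivAt_exp_mul_concomitant (a := a) (μ := a + 2) (by ring) he t
  have h3 := hasDerivAt_exp_mul_concomitant (a := a) (μ := a + 4) (by ring) he t
  exact (((h1.const_mul x).add (h2.const_mul y)).add (h3.const_mul z)).congr_deriv (by ring)

theorem tendsto_multiplier {a : ℝ} (ha : 0 < a) (x y z : ℝ) {e : ℕ → ℝ → ℝ}
    (hb : ∀ i < 6, ∃ M, ∀ t, |e i t| ≤ M) :
    Tendsto (multiplier a x y z e) atTop (𝓝 0) := by
  have h1 := tendsto_exp_mul_concomitant (a := a) (μ := a) ha hb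
  have h2 := tendsto_exp_mul_concomitant (a := a) (μ := a + 2) (by linarith) hb
  have h3 := tendsto_exp_mul_concomitant (a := a) (μ := a + 4) (by linarith) hb
  have := ((h1.const_mul x).add (h2.const_mul y)).add (h3.const_mul z)
  simp only [mul_zero, add_zero] at this
  exact this

theorem hasDerivAt_exp_neg_mul (μ t : ℝ) :
    HasDerivAt (fun t => exp (-(μ * t))) (-μ * exp (-(μ * t))) t := by
  have e1 : HasDerivAt (fun t => exp (-(μ * t))) (exp (-(μ * t)) * (-(μ * 1))) t :=
    (((hasDerivAt_id t).const_mul μ).neg).exp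
  exact e1.congr_deriv (by ring)

theorem tendsto_exp_neg_mul {μ : ℝ} (hμ : 0 < μ) :
    Tendsto (fun t : ℝ => exp (-(μ * t))) atTop (𝓝 0) :=
  tendsto_exp_neg_atTop_nhds_zero.comp (tendsto_id.const_mul_atTop hμ)

/-- A function with nonnegative derivative on `[0, ∞)` tending to zero is nonpositive at `0`. -/
theorem nonpos_of_deriv_nonneg_of_tendsto {F F' : ℝ → ℝ} (hF : ∀ t, HasDerivAt F (F' t) t)
    (hF' : ∀ t, 0 < t → 0 ≤ F' t) (hlim : Tendsto F atTop (𝓝 0)) : F 0 ≤ 0 := by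
  have hmono : MonotoneOn F (Set.Ici 0) := by
    apply monotoneOn_of_deriv_nonneg (convex_Ici 0)
      (fun t _ => (hF t).continuousAt.continuousWithinAt)
      (fun t _ => (hF t).differentiableAt.differentiableWithinAt)
    intro t ht
    rw [interior_Ici] at ht
    rw [(hF t).deriv]
    exact hF' t ht
  apply ge_of_tendsto hlim
  filter_upwards [eventually_ge_atTop 0] with t ht
  exact hmono Set.self_mem_Ici ht ht

theorem green_kernel_nonneg {a : ℝ} (ha : 0 < a) {y : ℝ} :
    0 ≤ 1 / (64 * a * (a + 1) * (a + 2)) - 1 / (32 * (a + 1) * (a + 2) * (a + 3)) * y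
      + 1 / (64 * (a + 2) * (a + 3) * (a + 4)) * y ^ 2 := by
  have e : 1 / (64 * a * (a + 1) * (a + 2)) - 1 / (32 * (a + 1) * (a + 2) * (a + 3)) * y
      + 1 / (64 * (a + 2) * (a + 3) * (a + 4)) * y ^ 2
      = ((a + 3) * (a + 4) - 2 * a * (a + 4) * y + a * (a + 1) * y ^ 2) /
        (64 * a * (a + 1) * (a + 2) * (a + 3) * (a + 4)) := by
    field_simp
    ring
  rw [e]
  apply div_nonneg _ (by positivity)
  have h1 : 0 ≤ ((a + 1) * y - (a + 4)) ^ 2 * a := by positivity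
  have h2 : 0 < a + 1 := by linarith
  have h3 : 0 ≤ (a + 1) * ((a + 3) * (a + 4) - 2 * a * (a + 4) * y + a * (a + 1) * y ^ 2) := by
    nlinarith
  exact nonneg_of_mul_nonneg_right h3 h2

/-- The a priori bound coming from the positive Green kernel. -/
theorem IsEmdenFowler.rpow_le {a : ℝ} (ha : 0 < a) {V : ℕ → ℝ → ℝ}
    (hV : IsEmdenFowler a V) (hb : ∀ i < 6, ∃ M, ∀ t, |V i t| ≤ M)
    (hincr : Monotone fun t => exp (a * t) * V 0 t)
    (hdecr : Antitone fun t => exp (-(a * t)) * V 0 t) (s : ℝ) :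
    V 0 s ^ (6 / a) ≤ 16 / 5 := by
  let e : ℕ → ℝ → ℝ := fun i t => V i (s + t) + (-1) ^ i * V i (s - t)
  have he : ∀ i < 6, ∀ t, HasDerivAt (e i) (e (i + 1) t) t := by
    intro i hi t
    have d1 : HasDerivAt (fun t => V i (s + t)) (V (i + 1) (s + t)) t :=
      HasDerivAt.comp_const_add s t (hV.deriv i hi (s + t))
    have d2 : HasDerivAt (fun t => V i (s - t)) (-V (i + 1) (s - t)) t :=
      HasDerivAt.comp_const_sub s t (hV.deriv i hi (s - t))
    refine (d1.add (d2.const_mul ((-1) ^ i))).congr_deriv ?_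
    simp only [e, pow_succ]
    ring
  have heb : ∀ i < 6, ∃ M, ∀ t, |e i t| ≤ M := by
    intro i hi
    obtain ⟨M, hM⟩ := hb i hi
    refine ⟨M + M, fun t => (abs_add_le _ _).trans (add_le_add (hM _) ?_)⟩
    rw [abs_mul, abs_pow, abs_neg, abs_one, one_pow, one_mul]
    exact hM _
  obtain ⟨x, hx⟩ : ∃ x, x = 1 / (64 * a * (a + 1) * (a + 2)) := ⟨_, rfl⟩
  obtain ⟨y, hy⟩ : ∃ y, y = 1 / (32 * (a + 1) * (a + 2) * (a + 3)) := ⟨_, rfl⟩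
  obtain ⟨z, hz⟩ : ∃ z, z = 1 / (64 * (a + 2) * (a + 3) * (a + 4)) := ⟨_, rfl⟩
  obtain ⟨C, hC⟩ : ∃ C, C = a * (a + 1) * (a + 2) * (a + 3) * (a + 4) * (a + 5) := ⟨_, rfl⟩
  have hCpos : 0 < C := by rw [hC]; positivity
  have hvp := hV.pos s
  have hpw : ∀ r : ℝ, ∀ t, 0 ≤ t → r = s + t ∨ r = s - t →
      V 0 s ^ (1 + 6 / a) * exp (-((a + 6) * t)) ≤ V 0 r ^ (1 + 6 / a) := by
    intro r t ht hr
    have h1 : V 0 s * exp (-(a * t)) ≤ V 0 r := by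
      rcases hr with rfl | rfl
      · have := hincr (show s ≤ s + t by linarith)
        simp only [mul_add, exp_add] at this
        rw [exp_neg, ← div_eq_mul_inv, div_le_iff₀ (exp_pos _)]
        rw [mul_assoc] at this
        have := le_of_mul_le_mul_left this (exp_pos _)
        linarith
      · have := hdecr (show s - t ≤ s by linarith)
        have hs : exp (-(a * (s - t))) = exp (-(a * s)) * exp (a * t) := by
          rw [← exp_add]; ring_nf
        simp only [hs, mul_assoc] at this
        rw [exp_neg, ← div_eq_mul_inv, div_le_iff₀ (exp_pos _)]
        have := le_of_mul_le_mul_left this (exp_pos _)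
        linarith
    have h2 := rpow_le_rpow (by positivity) h1 (show 0 ≤ 1 + 6 / a by positivity)
    rw [mul_rpow hvp.le (exp_pos _).le, ← exp_mul] at h2
    refine le_of_eq_of_le ?_ h2
    congr 2
    field_simp
  let F : ℝ → ℝ := fun t => multiplier a x (-y) z e t + 2 * C * V 0 s ^ (1 + 6 / a) *
    (x / (2 * a + 6) * exp (-((2 * a + 6) * t)) - y / (2 * a + 8) * exp (-((2 * a + 8) * t))
      + z / (2 * a + 10) * exp (-((2 * a + 10) * t)))
  have hF0 : F 0 ≤ 0 := by
    refine nonpos_of_deriv_nonneg_of_tendsto (F := F) (F' := fun t =>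
      (x * exp (-(a * t)) + (-y) * exp (-((a + 2) * t)) + z * exp (-((a + 4) * t))) *
        (C * V 0 (s + t) ^ (1 + 6 / a) + C * V 0 (s - t) ^ (1 + 6 / a)
          - 2 * C * V 0 s ^ (1 + 6 / a) * exp (-((a + 6) * t)))) ?_ ?_ ?_
    · intro t
      have h1 := hasDerivAt_multiplier a x (-y) z he t
      have h2 := (((hasDerivAt_exp_neg_mul (2 * a + 6) t).const_mul (x / (2 * a + 6))).sub
        ((hasDerivAt_exp_neg_mul (2 * a + 8) t).const_mul (y / (2 * a + 8)))).add
        ((hasDerivAt_exp_neg_mul (2 * a + 10) t).const_mul (z / (2 * a + 10)))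
      refine (h1.add (h2.const_mul (2 * C * V 0 s ^ (1 + 6 / a)))).congr_deriv ?_
      have o1 := hV.ode (s + t)
      have o2 := hV.ode (s - t)
      rw [← hC] at o1 o2
      rw [← o1, ← o2]
      have E1 : exp (-((2 * a + 6) * t)) = exp (-(a * t)) * exp (-((a + 6) * t)) := by
        rw [← exp_add]; ring_nf
      have E2 : exp (-((2 * a + 8) * t)) = exp (-((a + 2) * t)) * exp (-((a + 6) * t)) := by
        rw [← exp_add]; ring_nf
      have E3 : exp (-((2 * a + 10) * t)) = exp (-((a + 4) * t)) * exp (-((a + 6) * t)) := by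
        rw [← exp_add]; ring_nf
      rw [E1, E2, E3]
      simp only [e]
      field_simp
      ring
    · intro t ht
      apply mul_nonneg
      · have k := green_kernel_nonneg ha (y := exp (-(2 * t)))
        rw [← hx, ← hy, ← hz] at k
        have k2 := mul_nonneg (exp_pos (-(a * t))).le k
        have E2 : exp (-((a + 2) * t)) = exp (-(a * t)) * exp (-(2 * t)) := by
          rw [← exp_add]; ring_nf
        have E3 : exp (-((a + 4) * t)) = exp (-(a * t)) * exp (-(2 * t)) ^ 2 := by
          rw [← exp_nat_mul, ← exp_add]; push_cast; ring_nf
        rw [E2, E3]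
        refine le_of_le_of_eq k2 (by ring)
      · have h1 := mul_le_mul_of_nonneg_left (hpw _ t ht.le (Or.inl rfl)) hCpos.le
        have h2 := mul_le_mul_of_nonneg_left (hpw _ t ht.le (Or.inr rfl)) hCpos.le
        linarith
    · have h1 := tendsto_multiplier ha x (-y) z heb
      have h2 := (((tendsto_exp_neg_mul (show 0 < 2 * a + 6 by linarith)).const_mul
        (x / (2 * a + 6))).sub
        ((tendsto_exp_neg_mul (show 0 < 2 * a + 8 by linarith)).const_mul (y / (2 * a + 8)))).add
        ((tendsto_exp_neg_mul (show 0 < 2 * a + 10 by linarith)).const_mul (z / (2 * a + 10)))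
      simpa using h1.add (h2.const_mul (2 * C * V 0 s ^ (1 + 6 / a)))
  have hval : F 0 = -V 0 s + 5 / 16 * V 0 s ^ (1 + 6 / a) := by
    have h1 : multiplier a x (-y) z e 0 = - V 0 s := by
      simp only [multiplier, concomitant, e, mul_zero, neg_zero, exp_zero, add_zero, sub_zero]
      rw [hx, hy, hz]
      field_simp
      ring
    have h2 : 2 * C * (x / (2 * a + 6) - y / (2 * a + 8) + z / (2 * a + 10)) = 5 / 16 := by
      rw [hx, hy, hz, hC]
      have e1 : 2 * a + 6 = 2 * (a + 3) := by ring
      have e2 : 2 * a + 8 = 2 * (a + 4) := by ring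
      have e3 : 2 * a + 10 = 2 * (a + 5) := by ring
      rw [e1, e2, e3]
      field_simp
      ring
    simp only [F, h1, mul_zero, neg_zero, exp_zero, mul_one]
    linear_combination V 0 s ^ (1 + 6 / a) * h2
  rw [hval, rpow_add hvp, rpow_one] at hF0
  have : V 0 s * (V 0 s ^ (6 / a)) ≤ V 0 s * (16 / 5) := by linarith
  exact le_of_mul_le_mul_left this hvp

/-- The boundary expression obtained by integrating `ψ * (K₄ V⁗ - K₂ V'' - V⁽⁶⁾)` by parts. -/
def boundaryForm (K₂ K₄ : ℝ) (x y : ℕ → ℝ) : ℝ :=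
  -(x 0 * y 5 - x 1 * y 4 + x 2 * y 3 - x 3 * y 2 + x 4 * y 1 - x 5 * y 0)
    + K₄ * (x 0 * y 3 - x 1 * y 2 + x 2 * y 1 - x 3 * y 0) - K₂ * (x 0 * y 1 - x 1 * y 0)

theorem hasDerivAt_boundaryForm (K₂ K₄ : ℝ) {ψ V : ℕ → ℝ → ℝ}
    (hψ : ∀ i < 6, ∀ s, HasDerivAt (ψ i) (ψ (i + 1) s) s)
    (hV : ∀ i < 6, ∀ s, HasDerivAt (V i) (V (i + 1) s) s) (s : ℝ) :
    HasDerivAt (fun s => boundaryForm K₂ K₄ (fun i => ψ i s) (fun i => V i s))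
      (ψ 0 s * (K₄ * V 4 s - K₂ * V 2 s - V 6 s)
        + (ψ 6 s - K₄ * ψ 4 s + K₂ * ψ 2 s) * V 0 s) s := by
  have h : ∀ i < 6, ∀ j < 6, HasDerivAt (fun s => ψ i s * V j s)
      (ψ (i + 1) s * V j s + ψ i s * V (j + 1) s) s :=
    fun i hi j hj => (hψ i hi s).mul (hV j hj s)
  have a0 := h 0 (by norm_num) 5 (by norm_num)
  have a1 := h 1 (by norm_num) 4 (by norm_num)
  have a2 := h 2 (by norm_num) 3 (by norm_num)
  have a3 := h 3 (by norm_num) 2 (by norm_num)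
  have a4 := h 4 (by norm_num) 1 (by norm_num)
  have a5 := h 5 (by norm_num) 0 (by norm_num)
  have b0 := h 0 (by norm_num) 3 (by norm_num)
  have b1 := h 1 (by norm_num) 2 (by norm_num)
  have b2 := h 2 (by norm_num) 1 (by norm_num)
  have b3 := h 3 (by norm_num) 0 (by norm_num)
  have c0 := h 0 (by norm_num) 1 (by norm_num)
  have c1 := h 1 (by norm_num) 0 (by norm_num)
  exact ((((((((a0.sub a1).add a2).sub a3).add a4).sub a5).neg.add
    ((((b0.sub b1).add b2).sub b3).const_mul K₄)).sub
    ((c0.sub c1).const_mul K₂)).congr_deriv (by ring))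

theorem exists_abs_boundaryForm_le (K₂ K₄ : ℝ) {ψ V : ℕ → ℝ → ℝ}
    (hψ : ∀ i < 6, ∀ s, HasDerivAt (ψ i) (ψ (i + 1) s) s)
    (hψc : ∀ i, Continuous (ψ i)) (hψ1 : ∀ i < 6, ψ i 1 = 0)
    (hV : ∀ i < 6, ∀ s, HasDerivAt (V i) (V (i + 1) s) s)
    (h0 : ∃ M, ∀ t, |V 0 t| ≤ M) (hf : ∃ M, ∀ t, |K₄ * V 4 t - K₂ * V 2 t - V 6 t| ≤ M) :
    ∃ M, ∀ t, |boundaryForm K₂ K₄ (fun i => ψ i 0) (fun i => V i t)| ≤ M := by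
  obtain ⟨M₀, hM₀⟩ := h0
  obtain ⟨M₁, hM₁⟩ := hf
  obtain ⟨A, hA⟩ := (isCompact_Icc (a := (0 : ℝ)) (b := 1)).exists_bound_of_continuousOn
    (hψc 0).continuousOn
  obtain ⟨B, hB⟩ := (isCompact_Icc (a := (0 : ℝ)) (b := 1)).exists_bound_of_continuousOn
    (f := fun s => ψ 6 s - K₄ * ψ 4 s + K₂ * ψ 2 s)
    ((((hψc 6).sub ((hψc 4).const_mul K₄)).add ((hψc 2).const_mul K₂))).continuousOn
  refine ⟨A * M₁ + B * M₀, fun t => ?_⟩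
  have hd := hasDerivAt_boundaryForm K₂ K₄ hψ (V := fun i s => V i (t + s))
    (fun i hi s => HasDerivAt.comp_const_add t s (hV i hi (t + s)))
  have hmv := (convex_Icc (0 : ℝ) 1).norm_image_sub_le_of_norm_hasDerivWithin_le
    (C := A * M₁ + B * M₀) (fun s _ => (hd s).hasDerivWithinAt) (fun s hs => ?_)
    (Set.right_mem_Icc.2 zero_le_one) (Set.left_mem_Icc.2 zero_le_one)
  · have e1 : boundaryForm K₂ K₄ (fun i => ψ i 1) (fun i => V i (t + 1)) = 0 := by
      simp [boundaryForm, hψ1]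
    simpa [e1] using hmv
  · have hA0 := (norm_nonneg _).trans (hA s hs)
    have hB0 := (norm_nonneg _).trans (hB s hs)
    refine (norm_add_le _ _).trans (add_le_add ?_ ?_)
    · rw [norm_mul]
      exact mul_le_mul (hA s hs) (hM₁ _) (norm_nonneg _) hA0
    · rw [norm_mul]
      exact mul_le_mul (hB s hs) (hM₀ _) (norm_nonneg _) hB0

open Polynomial in
/-- There is a smooth function with a zero of order exactly `j` at `0` and order `6` at `1`. -/
theorem exists_cutoff_jet (j : ℕ) : ∃ ψ : ℕ → ℝ → ℝ,
    (∀ i, ∀ s, HasDerivAt (ψ i) (ψ (i + 1) s) s) ∧ (∀ i, Continuous (ψ i)) ∧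
    (∀ i < 6, ψ i 1 = 0) ∧ (∀ i < j, ψ i 0 = 0) ∧ ψ j 0 ≠ 0 := by
  let P : ℝ[X] := X ^ j * (X - C 1) ^ 6
  have hP : P ≠ 0 := mul_ne_zero (pow_ne_zero _ X_ne_zero) (pow_ne_zero _ (X_sub_C_ne_zero 1))
  have hz : ∀ i, (derivative^[i] P).eval 0 = i.factorial * P.coeff i := by
    intro i
    rw [← coeff_zero_eq_eval_zero, coeff_iterate_derivative]
    simp [Nat.descFactorial_self]
  refine ⟨fun i s => (derivative^[i] P).eval s, fun i s => ?_, fun i => Polynomial.continuous _,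
    fun i hi => ?_, fun i hi => ?_, ?_⟩
  · simp only [Function.iterate_succ_apply']
    exact Polynomial.hasDerivAt _ _
  · apply isRoot_iterate_derivative_of_lt_rootMultiplicity
    refine hi.trans_le ((le_rootMultiplicity_iff hP).2 (dvd_mul_left _ _))
  · simp only [hz, P]
    rw [coeff_X_pow_mul', if_neg (by omega), mul_zero]
  · simp only [hz, P]
    rw [coeff_X_pow_mul', if_pos le_rfl, Nat.sub_self, coeff_zero_eq_eval_zero]
    simp [Nat.factorial_ne_zero]

/-- All lower order derivatives of a bounded solution are bounded. -/
theorem IsEmdenFowler.exists_bound {a : ℝ} (ha : 0 < a) {V : ℕ → ℝ → ℝ} (hV : IsEmdenFowler a V)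
    (hb : ∃ M, ∀ t, V 0 t ≤ M) : ∀ i < 6, ∃ M, ∀ t, |V i t| ≤ M := by
  have h0 : ∃ M, ∀ t, |V 0 t| ≤ M := by
    obtain ⟨M, hM⟩ := hb
    exact ⟨M, fun t => by rw [abs_of_pos (hV.pos t)]; exact hM t⟩
  obtain ⟨K₂, hK₂⟩ : ∃ K, K = a ^ 2 * (a + 2) ^ 2 + a ^ 2 * (a + 4) ^ 2
    + (a + 2) ^ 2 * (a + 4) ^ 2 := ⟨_, rfl⟩
  obtain ⟨K₄, hK₄⟩ : ∃ K, K = a ^ 2 + (a + 2) ^ 2 + (a + 4) ^ 2 := ⟨_, rfl⟩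
  have hf : ∃ M, ∀ t, |K₄ * V 4 t - K₂ * V 2 t - V 6 t| ≤ M := by
    obtain ⟨M, hM⟩ := hb
    refine ⟨a * (a + 1) * (a + 2) * (a + 3) * (a + 4) * (a + 5) * M ^ (1 + 6 / a)
      + (a * (a + 2) * (a + 4)) ^ 2 * M, fun t => ?_⟩
    have h1 := hV.ode t
    rw [← hK₂, ← hK₄] at h1
    have h2 : K₄ * V 4 t - K₂ * V 2 t - V 6 t = a * (a + 1) * (a + 2) * (a + 3) * (a + 4) * (a + 5)
      * V 0 t ^ (1 + 6 / a) - (a * (a + 2) * (a + 4)) ^ 2 * V 0 t := by linarith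
    have hp := hV.pos t
    rw [h2]
    refine (abs_sub _ _).trans (add_le_add ?_ ?_)
    · rw [abs_of_nonneg (by positivity)]
      gcongr
      exact hM t
    · rw [abs_of_nonneg (by positivity)]
      gcongr
      exact hM t
  have key : ∀ k < 6, (∀ m < k, ∃ M, ∀ t, |V m t| ≤ M) → ∃ M, ∀ t, |V k t| ≤ M := by
    intro k hk ih
    rcases Nat.eq_zero_or_pos k with rfl | hk0
    · exact h0
    obtain ⟨ψ, hψ, hψc, hψ1, hψ0, hψj⟩ := exists_cutoff_jet (5 - k)
    obtain ⟨M, hM⟩ := exists_abs_boundaryForm_le K₂ K₄ (fun i _ => hψ i) hψc hψ1 hV.deriv h0 hf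
    have hsum : ∀ {f g : ℝ → ℝ}, (∃ M, ∀ t, |f t| ≤ M) → (∃ M, ∀ t, |g t| ≤ M) →
        ∃ M, ∀ t, |f t + g t| ≤ M := by
      rintro f g ⟨A, hA⟩ ⟨B, hB⟩
      exact ⟨A + B, fun t => (abs_add_le _ _).trans (add_le_add (hA t) (hB t))⟩
    have hmul : ∀ {f : ℝ → ℝ} (c : ℝ), (∃ M, ∀ t, |f t| ≤ M) → ∃ M, ∀ t, |c * f t| ≤ M := by
      rintro f c ⟨A, hA⟩
      exact ⟨|c| * A, fun t => by rw [abs_mul]; gcongr; exact hA t⟩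
    have hpick : ∀ f : ℝ → ℝ, (∃ M, ∀ t, |f t| ≤ M) → (∀ t, f t = ψ (5 - k) 0 * V k t) →
        ∃ M, ∀ t, |V k t| ≤ M := by
      intro f h h'
      obtain ⟨A, hA⟩ := hmul (ψ (5 - k) 0)⁻¹ h
      exact ⟨A, fun t => by simpa [h', hψj] using hA t⟩
    have hM' := fun c : ℝ => hmul c ⟨M, hM⟩
    interval_cases k
    · refine hpick _ (hsum (hM' (-1)) (hmul (ψ 5 0) (ih 0 (by norm_num)))) fun t => ?_
      simp [boundaryForm, hψ0]
    · refine hpick _ (hsum (hsum (hM' 1) (hmul (ψ 4 0) (ih 1 (by norm_num))))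
        (hmul (K₄ * ψ 3 0 - ψ 5 0) (ih 0 (by norm_num)))) fun t => ?_
      simp [boundaryForm, hψ0]
      ring
    · refine hpick _ (hsum (hsum (hsum (hM' (-1)) (hmul (ψ 3 0) (ih 2 (by norm_num))))
        (hmul (K₄ * ψ 2 0 - ψ 4 0) (ih 1 (by norm_num))))
        (hmul (ψ 5 0 - K₄ * ψ 3 0) (ih 0 (by norm_num)))) fun t => ?_
      simp [boundaryForm, hψ0]
      ring
    · refine hpick _ (hsum (hsum (hsum (hsum (hM' 1) (hmul (ψ 2 0) (ih 3 (by norm_num))))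
        (hmul (K₄ * ψ 1 0 - ψ 3 0) (ih 2 (by norm_num))))
        (hmul (ψ 4 0 - K₄ * ψ 2 0) (ih 1 (by norm_num))))
        (hmul (K₄ * ψ 3 0 - K₂ * ψ 1 0 - ψ 5 0) (ih 0 (by norm_num)))) fun t => ?_
      simp [boundaryForm, hψ0]
      ring
    · refine hpick _ (hsum (hsum (hsum (hsum (hsum (hM' (-1)) (hmul (ψ 1 0) (ih 4 (by norm_num))))
        (hmul (K₄ * ψ 0 0 - ψ 2 0) (ih 3 (by norm_num))))
        (hmul (ψ 3 0 - K₄ * ψ 1 0) (ih 2 (by norm_num))))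
        (hmul (K₄ * ψ 2 0 - K₂ * ψ 0 0 - ψ 4 0) (ih 1 (by norm_num))))
        (hmul (ψ 5 0 - K₄ * ψ 3 0 + K₂ * ψ 1 0) (ih 0 (by norm_num)))) fun t => ?_
      simp [boundaryForm]
      ring
  intro i hi
  induction i using Nat.strong_induction_on with
  | _ i ih => exact key i hi fun m hm => ih m hm (hm.trans hi)

theorem IsEmdenFowler.comp_const_sub {a : ℝ} {V : ℕ → ℝ → ℝ} (hV : IsEmdenFowler a V) (s : ℝ) :
    IsEmdenFowler a (fun i t => (-1) ^ i * V i (s - t)) where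
  deriv i hi t := by
    have d2 : HasDerivAt (fun t => V i (s - t)) (-V (i + 1) (s - t)) t :=
      HasDerivAt.comp_const_sub s t (hV.deriv i hi (s - t))
    exact (d2.const_mul ((-1) ^ i)).congr_deriv (by rw [pow_succ]; ring)
  pos t := by simpa using hV.pos (s - t)
  ode t := by
    have := hV.ode (s - t)
    norm_num
    linarith

theorem IsEmdenFowler.comp_const_add {a : ℝ} {V : ℕ → ℝ → ℝ} (hV : IsEmdenFowler a V) (s : ℝ) :
    IsEmdenFowler a (fun i t => V i (s + t)) where
  deriv i hi t := HasDerivAt.comp_const_add s t (hV.deriv i hi (s + t))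
  pos t := hV.pos (s + t)
  ode t := hV.ode (s + t)

/-- If the equation's right hand side, weighted by the kernel, is dominated by an exponential then
the boundary value of the multiplier is controlled. -/
theorem IsEmdenFowler.neg_multiplier_le {a : ℝ} (ha : 0 < a) {W : ℕ → ℝ → ℝ}
    (hW : IsEmdenFowler a W) (hb : ∀ i < 6, ∃ M, ∀ t, |W i t| ≤ M) (x y z D ν : ℝ) (hν : 0 < ν)
    (h : ∀ t, 0 < t → (x * exp (-(a * t)) + y * exp (-((a + 2) * t)) + z * exp (-((a + 4) * t)))
      * (a * (a + 1) * (a + 2) * (a + 3) * (a + 4) * (a + 5) * W 0 t ^ (1 + 6 / a))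
        ≤ D * exp (-(ν * t))) :
    -multiplier a x y z W 0 ≤ D / ν := by
  have h1 := nonpos_of_deriv_nonneg_of_tendsto
    (F := fun t => -multiplier a x y z W t - D / ν * exp (-(ν * t)))
    (fun t => (hasDerivAt_multiplier a x y z hW.deriv t).neg.sub
      ((hasDerivAt_exp_neg_mul ν t).const_mul (D / ν))) ?_ ?_
  · simpa using h1
  · intro t ht
    have := h t ht
    rw [hW.ode t]
    have e : D / ν * (-ν * exp (-(ν * t))) = -(D * exp (-(ν * t))) := by field_simp
    rw [e]
    linarith
  · have := (tendsto_multiplier ha x y z hb).neg.sub ((tendsto_exp_neg_mul hν).const_mul (D / ν))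
    simpa only [neg_zero, mul_zero, sub_zero] using this

theorem neg_multiplier_add {a : ℝ} (ha : 0 < a) (V : ℕ → ℝ → ℝ) (s : ℝ) :
    -multiplier a (1 / (32 * (a + 1) * (a + 2))) (-(1 / (16 * (a + 2) * (a + 3))))
        (1 / (32 * (a + 3) * (a + 4))) (fun i t => V i (s + t)) 0
      - multiplier a 0 (1 / (16 * (a + 1) * (a + 2) * (a + 3)))
        (-(1 / (16 * (a + 2) * (a + 3) * (a + 4)))) (fun i t => (-1) ^ i * V i (s - t)) 0
      = V 1 s + a * V 0 s := by
  simp only [multiplier, concomitant]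
  simp only [mul_zero, neg_zero, exp_zero, add_zero, sub_zero, one_mul]
  have h1 : a + 1 ≠ 0 := by positivity
  have h2 : a + 2 ≠ 0 := by positivity
  have h3 : a + 3 ≠ 0 := by positivity
  have h4 : a + 4 ≠ 0 := by positivity
  field_simp
  ring

theorem exp_combination_le {a : ℝ} (x y z : ℝ) {t : ℝ} (ht : 0 ≤ t) :
    x * exp (-(a * t)) + y * exp (-((a + 2) * t)) + z * exp (-((a + 4) * t))
      ≤ (|x| + |y| + |z|) * exp (-(a * t)) := by
  have h1 : exp (-((a + 2) * t)) ≤ exp (-(a * t)) := exp_le_exp.2 (by nlinarith)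
  have h2 : exp (-((a + 4) * t)) ≤ exp (-(a * t)) := exp_le_exp.2 (by nlinarith)
  have h3 := mul_le_mul_of_nonneg_right (le_abs_self x) (exp_pos (-(a * t))).le
  have h4 := mul_le_mul (le_abs_self y) h1 (exp_pos _).le (abs_nonneg y)
  have h5 := mul_le_mul (le_abs_self z) h2 (exp_pos _).le (abs_nonneg z)
  linarith

/-- Where a solution is decreasing it satisfies a first order differential inequality. -/
theorem IsEmdenFowler.exists_deriv_add_le {a : ℝ} (ha : 0 < a) {V : ℕ → ℝ → ℝ}
    (hV : IsEmdenFowler a V) (hb : ∀ i < 6, ∃ M, ∀ t, |V i t| ≤ M)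
    (hincr : Monotone fun t => exp (a * t) * V 0 t) {T : ℝ} (hanti : AntitoneOn (V 0) (Set.Ici T)) :
    ∃ D, 0 ≤ D ∧ ∀ s, T ≤ s → V 1 s + a * V 0 s ≤ D * V 0 s ^ (1 + 1 / a) := by
  obtain ⟨M, hM⟩ := hb 0 (by norm_num)
  have hM0 : ∀ t, V 0 t ≤ M := fun t => (le_abs_self _).trans (hM t)
  have hMpos : 0 < M := (hV.pos 0).trans_le (hM0 0)
  obtain ⟨x, hx⟩ : ∃ x, x = 1 / (32 * (a + 1) * (a + 2)) := ⟨_, rfl⟩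
  obtain ⟨y, hy⟩ : ∃ x, x = -(1 / (16 * (a + 2) * (a + 3))) := ⟨_, rfl⟩
  obtain ⟨z, hz⟩ : ∃ x, x = 1 / (32 * (a + 3) * (a + 4)) := ⟨_, rfl⟩
  obtain ⟨y', hy'⟩ : ∃ x, x = 1 / (16 * (a + 1) * (a + 2) * (a + 3)) := ⟨_, rfl⟩
  obtain ⟨z', hz'⟩ : ∃ x, x = -(1 / (16 * (a + 2) * (a + 3) * (a + 4))) := ⟨_, rfl⟩
  obtain ⟨C, hC⟩ : ∃ C, C = a * (a + 1) * (a + 2) * (a + 3) * (a + 4) * (a + 5) := ⟨_, rfl⟩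
  have hCpos : 0 < C := by rw [hC]; positivity
  have hsplit : ∀ w, 0 < w → w ≤ M → w ^ (1 + 6 / a) ≤ M ^ (5 / a) * w ^ (1 + 1 / a) := by
    intro w hw hwM
    have : (1 + 6 / a) = 5 / a + (1 + 1 / a) := by ring
    rw [this, rpow_add hw]
    gcongr
  refine ⟨(|x| + |y| + |z|) * C * M ^ (5 / a) / a + (|y'| + |z'| + |0|) * C * M ^ (5 / a) / 1,
    by positivity, fun s hs => ?_⟩
  have hvs := hV.pos s
  have h1 := (hV.comp_const_add s).neg_multiplier_le ha (fun i hi => ?_) x y z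
    ((|x| + |y| + |z|) * C * M ^ (5 / a) * V 0 s ^ (1 + 1 / a)) a ha (fun t ht => ?_)
  have h2 := (hV.comp_const_sub s).neg_multiplier_le ha (fun i hi => ?_) 0 y' z'
    ((|y'| + |z'| + |0|) * C * M ^ (5 / a) * V 0 s ^ (1 + 1 / a)) 1 one_pos (fun t ht => ?_)
  · have h3 := neg_multiplier_add ha V s
    rw [← hx, ← hy, ← hz, ← hy', ← hz'] at h3
    refine le_of_eq_of_le h3.symm ?_
    refine (add_le_add h1 h2).trans (le_of_eq (by ring))
  · obtain ⟨A, hA⟩ := hb i hi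
    exact ⟨A, fun t => by simpa [abs_mul] using hA (s - t)⟩
  · rw [← hC]
    have hvt := hV.pos (s - t)
    have hle : V 0 (s - t) ≤ V 0 s * exp (a * t) := by
      have := hincr (show s - t ≤ s by linarith)
      have e : exp (a * s) = exp (a * (s - t)) * exp (a * t) := by rw [← exp_add]; ring_nf
      simp only [e, mul_assoc] at this
      have := le_of_mul_le_mul_left this (exp_pos _)
      linarith
    have hp : V 0 (s - t) ^ (1 + 6 / a)
        ≤ M ^ (5 / a) * (V 0 s ^ (1 + 1 / a) * exp ((a + 1) * t)) := by
      refine (hsplit _ hvt (hM0 _)).trans ?_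
      gcongr
      refine (rpow_le_rpow hvt.le hle (by positivity)).trans (le_of_eq ?_)
      rw [mul_rpow hvs.le (exp_pos _).le, ← exp_mul]
      congr 2
      field_simp
    have hk := exp_combination_le (a := a + 2) y' z' 0 ht.le
    have e2 : exp (-(1 * t)) = exp (-((a + 2) * t)) * exp ((a + 1) * t) := by
      rw [← exp_add]; ring_nf
    have e3 : (a + 2 + 2) = a + 4 := by ring
    rw [e3] at hk
    simp only [pow_zero, one_mul]
    rw [one_mul] at e2
    calc _ ≤ ((|y'| + |z'| + |0|) * exp (-((a + 2) * t)))
          * (C * (M ^ (5 / a) * (V 0 s ^ (1 + 1 / a) * exp ((a + 1) * t)))) :=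
          mul_le_mul (by linarith) (by gcongr) (by positivity) (by positivity)
      _ = _ := by rw [e2]; ring
  · obtain ⟨A, hA⟩ := hb i hi
    exact ⟨A, fun t => hA _⟩
  · rw [← hC]
    have hvt := hV.pos (s + t)
    have hle : V 0 (s + t) ≤ V 0 s := hanti hs (by simp; linarith) (by linarith)
    have hp : V 0 (s + t) ^ (1 + 6 / a) ≤ M ^ (5 / a) * V 0 s ^ (1 + 1 / a) :=
      (rpow_le_rpow hvt.le hle (by positivity)).trans (hsplit _ hvs (hM0 _))
    calc _ ≤ ((|x| + |y| + |z|) * exp (-(a * t)))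
          * (C * (M ^ (5 / a) * (V 0 s ^ (1 + 1 / a)))) :=
          mul_le_mul (exp_combination_le x y z ht.le) (by gcongr) (by positivity) (by positivity)
      _ = _ := by ring

/-- A solution decreasing to zero decays like the fast exponential. -/
theorem IsEmdenFowler.exists_exp_mul_le_of_tendsto_zero {a : ℝ} (ha : 0 < a) {V : ℕ → ℝ → ℝ}
    (hV : IsEmdenFowler a V) (hb : ∀ i < 6, ∃ M, ∀ t, |V i t| ≤ M)
    (hincr : Monotone fun t => exp (a * t) * V 0 t) {T : ℝ} (hanti : AntitoneOn (V 0) (Set.Ici T))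
    (hlim : Tendsto (V 0) atTop (𝓝 0)) : ∃ M, ∀ t, exp (a * t) * V 0 t ≤ M := by
  obtain ⟨D, hD0, hD⟩ := hV.exists_deriv_add_le ha hb hincr hanti
  have hy : Tendsto (fun t => V 0 t ^ (-(1 / a))) atTop atTop :=
    (tendsto_rpow_neg_nhdsGT_zero (neg_lt_zero.2 (by positivity : 0 < 1 / a))).comp
      (tendsto_nhdsWithin_iff.2 ⟨hlim, Eventually.of_forall hV.pos⟩)
  obtain ⟨s, hs, hTs⟩ := ((hy.eventually_ge_atTop (D / a + 1)).and
    (eventually_ge_atTop T)).exists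
  have hder : ∀ t, HasDerivAt (fun t => exp (-(1 * t)) * (V 0 t ^ (-(1 / a)) - D / a))
      (-1 * exp (-(1 * t)) * (V 0 t ^ (-(1 / a)) - D / a)
        + exp (-(1 * t)) * (V 1 t * (-(1 / a)) * V 0 t ^ (-(1 / a) - 1))) t := fun t =>
    (hasDerivAt_exp_neg_mul 1 t).mul
      (((hV.deriv 0 (by norm_num) t).rpow_const (Or.inl (hV.pos t).ne')).sub_const _)
  have hmono : MonotoneOn (fun t => exp (-(1 * t)) * (V 0 t ^ (-(1 / a)) - D / a))
      (Set.Ici T) := by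
    apply monotoneOn_of_deriv_nonneg (convex_Ici T)
      (fun t _ => (hder t).continuousAt.continuousWithinAt)
      (fun t _ => (hder t).differentiableAt.differentiableWithinAt)
    intro t ht
    rw [interior_Ici] at ht
    rw [(hder t).deriv]
    have h1 := hD t (le_of_lt ht)
    have hv := hV.pos t
    have h2 := mul_le_mul_of_nonneg_left h1 (show 0 ≤ V 0 t ^ (-(1 / a) - 1) by positivity)
    have e1 : V 0 t ^ (-(1 / a) - 1) * (D * V 0 t ^ (1 + 1 / a)) = D := by
      rw [mul_left_comm, ← rpow_add hv]; ring_nf; simp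
    have e2 : V 0 t ^ (-(1 / a)) = V 0 t ^ (-(1 / a) - 1) * V 0 t := by
      nth_rewrite 3 [← rpow_one (V 0 t)]
      rw [← rpow_add hv]; ring_nf
    rw [e1] at h2
    have e3 : -1 * exp (-(1 * t)) * (V 0 t ^ (-(1 / a)) - D / a)
        + exp (-(1 * t)) * (V 1 t * (-(1 / a)) * V 0 t ^ (-(1 / a) - 1))
        = exp (-(1 * t)) / a * (D - V 0 t ^ (-(1 / a) - 1) * (V 1 t + a * V 0 t)) := by
      rw [e2]; field_simp; ring
    rw [e3]
    exact mul_nonneg (by positivity) (by linarith)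
  refine ⟨exp (a * s), fun t => ?_⟩
  refine (hincr (le_max_left t s)).trans ?_
  obtain ⟨r, hr⟩ : ∃ r, r = max t s := ⟨_, rfl⟩
  have hrs : s ≤ r := hr ▸ le_max_right t s
  simp only [← hr]
  have h1 := hmono hTs (hTs.trans hrs : T ≤ r) hrs
  simp only [one_mul] at h1
  have hv := hV.pos r
  have h2 : exp (r - s) ≤ V 0 r ^ (-(1 / a)) := by
    have h3 : exp (-s) * 1 ≤ exp (-s) * (V 0 s ^ (-(1 / a)) - D / a) := by
      gcongr
      linarith
    have h4 : exp (-s) = exp (-r) * exp (r - s) := by rw [← exp_add]; ring_nf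
    have h5 := h3.trans h1
    rw [mul_one, h4] at h5
    have := le_of_mul_le_mul_left h5 (exp_pos _)
    have : 0 ≤ D / a := by positivity
    linarith
  have h3 : exp (r - s) ^ a ≤ (V 0 r ^ (-(1 / a))) ^ a :=
    rpow_le_rpow (exp_pos _).le h2 ha.le
  rw [← rpow_mul hv.le, ← exp_mul, show -(1 / a) * a = -1 by field_simp, rpow_neg_one] at h3
  have h4 : exp (a * r) = exp ((r - s) * a) * exp (a * s) := by rw [← exp_add]; ring_nf
  rw [h4]
  calc _ ≤ ((V 0 r)⁻¹ * exp (a * s)) * V 0 r := by gcongr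
    _ = exp (a * s) := by field_simp

theorem not_tendsto_pos_deriv_of_bounded {F F' : ℝ → ℝ} {c : ℝ} (hc : 0 < c)
    (hF : ∀ t, HasDerivAt F (F' t) t) (hb : ∃ M, ∀ t, |F t| ≤ M) (T : ℝ)
    (hT : ∀ t, T ≤ t → c ≤ F' t) : False := by
  obtain ⟨M, hM⟩ := hb
  have key : ∀ t, T ≤ t → c * (t - T) ≤ F t - F T := fun t ht =>
    (convex_Ici T).mul_sub_le_image_sub_of_le_deriv
      (fun t _ => (hF t).continuousAt.continuousWithinAt)
      (fun t _ => (hF t).differentiableAt.differentiableWithinAt)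
      (fun s hs => by
        rw [interior_Ici] at hs
        rw [(hF s).deriv]
        exact hT s (le_of_lt hs)) T Set.self_mem_Ici t ht ht
  have hM0 : 0 ≤ M := (abs_nonneg _).trans (hM 0)
  have h1 := key (T + (2 * M + 1) / c) (by simp; positivity)
  rw [add_sub_cancel_left, mul_div_cancel₀ _ hc.ne'] at h1
  have h2 := abs_le.1 (hM T)
  have h3 := abs_le.1 (hM (T + (2 * M + 1) / c))
  linarith

theorem eq_zero_of_tendsto_deriv_of_bounded {F F' : ℝ → ℝ} {c : ℝ}
    (hF : ∀ t, HasDerivAt F (F' t) t) (hb : ∃ M, ∀ t, |F t| ≤ M)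
    (hc : Tendsto F' atTop (𝓝 c)) : c = 0 := by
  rcases lt_trichotomy c 0 with h | h | h
  · obtain ⟨T, hT⟩ := eventually_atTop.1 (hc.eventually (eventually_le_nhds
      (show c < c / 2 by linarith)))
    refine (not_tendsto_pos_deriv_of_bounded (c := -(c / 2)) (by linarith) (fun t => (hF t).neg)
      ?_ T fun t ht => neg_le_neg (hT t ht)).elim
    simpa using hb
  · exact h
  · obtain ⟨T, hT⟩ := eventually_atTop.1 (hc.eventually (eventually_ge_nhds
      (show c / 2 < c by linarith)))
    exact (not_tendsto_pos_deriv_of_bounded (c := c / 2) (by linarith) hF hb T hT).elim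

/-- A bounded function on the line is not strictly convex. -/
theorem not_bounded_of_strictMono_deriv {Y Z : ℝ → ℝ} (hY : ∀ t, HasDerivAt Y (Z t) t)
    (hb : ∃ M, ∀ t, |Y t| ≤ M) (hZ : StrictMono Z) : False := by
  by_cases h : ∃ s, 0 < Z s
  · obtain ⟨s, hs⟩ := h
    exact not_tendsto_pos_deriv_of_bounded hs hY hb s fun t ht => hZ.monotone ht
  · push Not at h
    have h0 : Z 0 < 0 := (hZ zero_lt_one).trans_le (h 1)
    obtain ⟨M, hM⟩ := hb
    refine not_tendsto_pos_deriv_of_bounded (F := fun t => Y (-t)) (F' := fun t => -Z (-t))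
      (c := -Z 0) (by linarith) (fun t => ?_) ⟨M, fun t => hM _⟩ 0 fun t ht =>
        neg_le_neg (hZ.monotone (by linarith))
    exact ((hY (-t)).comp t (hasDerivAt_neg t)).congr_deriv (by ring)

namespace IsEmdenFowler

variable {a : ℝ} {V : ℕ → ℝ → ℝ}

/-- The nonlinearity of the sixth-order equation, with the zeroth order term included. -/
def force (a x : ℝ) : ℝ :=
  a * (a + 1) * (a + 2) * (a + 3) * (a + 4) * (a + 5) * x ^ (1 + 6 / a)
    - (a * (a + 2) * (a + 4)) ^ 2 * x

theorem force_eq {x : ℝ} (hx : 0 < x) : force a x =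
    x * (a * (a + 1) * (a + 2) * (a + 3) * (a + 4) * (a + 5) * x ^ (6 / a)
      - (a * (a + 2) * (a + 4)) ^ 2) := by
  rw [force, rpow_add hx, rpow_one]
  ring

theorem force_neg (ha : 0 < a) {x l : ℝ} (hx : 0 < x) (hxl : x < l) (hl : force a l = 0) :
    force a x < 0 := by
  rw [force_eq (hx.trans hxl)] at hl
  rw [force_eq hx]
  have h1 := (mul_eq_zero.1 hl).resolve_left (hx.trans hxl).ne'
  have h2 : x ^ (6 / a) < l ^ (6 / a) := rpow_lt_rpow hx.le hxl (by positivity)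
  refine mul_neg_of_pos_of_neg hx ?_
  have := mul_lt_mul_of_pos_left h2
    (show 0 < a * (a + 1) * (a + 2) * (a + 3) * (a + 4) * (a + 5) by positivity)
  linarith

theorem force_pos (ha : 0 < a) {x l : ℝ} (hl0 : 0 < l) (hxl : l < x) (hl : force a l = 0) :
    0 < force a x := by
  rw [force_eq hl0] at hl
  rw [force_eq (hl0.trans hxl)]
  have h1 := (mul_eq_zero.1 hl).resolve_left hl0.ne'
  have h2 : l ^ (6 / a) < x ^ (6 / a) := rpow_lt_rpow hl0.le hxl (by positivity)
  refine mul_pos (hl0.trans hxl) ?_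
  have := mul_lt_mul_of_pos_left h2
    (show 0 < a * (a + 1) * (a + 2) * (a + 3) * (a + 4) * (a + 5) by positivity)
  linarith

theorem continuous_force (ha : 0 < a) : Continuous (force a) := by
  unfold force
  have : 0 ≤ 1 + 6 / a := by positivity
  exact (continuous_const.mul (continuous_rpow_const this)).sub (by fun_prop)

theorem hasDerivAt_flux (hV : IsEmdenFowler a V) (t : ℝ) :
    HasDerivAt (fun t => -V 5 t + (a ^ 2 + (a + 2) ^ 2 + (a + 4) ^ 2) * V 3 t
      - (a ^ 2 * (a + 2) ^ 2 + a ^ 2 * (a + 4) ^ 2 + (a + 2) ^ 2 * (a + 4) ^ 2) * V 1 t)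
      (force a (V 0 t)) t := by
  refine (((hV.deriv 5 (by norm_num) t).neg.add
    ((hV.deriv 3 (by norm_num) t).const_mul _)).sub
    ((hV.deriv 1 (by norm_num) t).const_mul _)).congr_deriv ?_
  have := hV.ode t
  rw [force]
  linarith

theorem hasDerivAt_potential (hV : IsEmdenFowler a V) (t : ℝ) :
    HasDerivAt (fun t => -V 4 t + (a ^ 2 + (a + 2) ^ 2 + (a + 4) ^ 2) * V 2 t
      - (a ^ 2 * (a + 2) ^ 2 + a ^ 2 * (a + 4) ^ 2 + (a + 2) ^ 2 * (a + 4) ^ 2) * V 0 t)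
      (-V 5 t + (a ^ 2 + (a + 2) ^ 2 + (a + 4) ^ 2) * V 3 t
      - (a ^ 2 * (a + 2) ^ 2 + a ^ 2 * (a + 4) ^ 2 + (a + 2) ^ 2 * (a + 4) ^ 2) * V 1 t) t :=
  ((hV.deriv 4 (by norm_num) t).neg.add
    ((hV.deriv 2 (by norm_num) t).const_mul _)).sub
    ((hV.deriv 0 (by norm_num) t).const_mul _)

theorem exists_abs_combination_le (hb : ∀ i < 6, ∃ M, ∀ t, |V i t| ≤ M) {i j k : ℕ} (hi : i < 6)
    (hj : j < 6) (hk : k < 6) (x y : ℝ) : ∃ M, ∀ t, |-V i t + x * V j t - y * V k t| ≤ M := by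
  obtain ⟨A, hA⟩ := hb i hi
  obtain ⟨B, hB⟩ := hb j hj
  obtain ⟨C, hC⟩ := hb k hk
  refine ⟨A + |x| * B + |y| * C, fun t => (abs_sub _ _).trans
    (add_le_add ((abs_add_le _ _).trans (add_le_add ?_ ?_)) ?_)⟩
  · rw [abs_neg]; exact hA t
  · rw [abs_mul]; gcongr; exact hB t
  · rw [abs_mul]; gcongr; exact hC t

theorem not_forall_force_neg (hV : IsEmdenFowler a V) (hb : ∀ i < 6, ∃ M, ∀ t, |V i t| ≤ M)
    (h : ∀ t, force a (V 0 t) < 0) : False := by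
  obtain ⟨M, hM⟩ := exists_abs_combination_le hb (i := 4) (j := 2) (k := 0) (by norm_num)
    (by norm_num) (by norm_num) (a ^ 2 + (a + 2) ^ 2 + (a + 4) ^ 2)
    (a ^ 2 * (a + 2) ^ 2 + a ^ 2 * (a + 4) ^ 2 + (a + 2) ^ 2 * (a + 4) ^ 2)
  refine not_bounded_of_strictMono_deriv (fun t => (hV.hasDerivAt_potential t).neg)
    ⟨M, fun t => ?_⟩ (strictMono_of_deriv_pos fun t => ?_)
  · rw [Pi.neg_apply, abs_neg]; exact hM t
  · refine lt_of_lt_of_eq (neg_pos.2 (h t)) ?_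
    exact (hV.hasDerivAt_flux t).neg.deriv.symm

theorem not_forall_force_pos (hV : IsEmdenFowler a V) (hb : ∀ i < 6, ∃ M, ∀ t, |V i t| ≤ M)
    (h : ∀ t, 0 < force a (V 0 t)) : False := by
  refine not_bounded_of_strictMono_deriv hV.hasDerivAt_potential
    (exists_abs_combination_le hb (by norm_num) (by norm_num) (by norm_num) _ _)
    (strictMono_of_deriv_pos fun t => ?_)
  rw [(hV.hasDerivAt_flux t).deriv]
  exact h t

theorem force_eq_zero_of_tendsto (ha : 0 < a) (hV : IsEmdenFowler a V)
    (hb : ∀ i < 6, ∃ M, ∀ t, |V i t| ≤ M) {l : ℝ} (hl : Tendsto (V 0) atTop (𝓝 l)) :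
    force a l = 0 :=
  eq_zero_of_tendsto_deriv_of_bounded hV.hasDerivAt_flux
    (exists_abs_combination_le hb (by norm_num) (by norm_num) (by norm_num) _ _)
    (((continuous_force ha).tendsto l).comp hl)

theorem tendsto_of_deriv_pos (hV : IsEmdenFowler a V) (hb : ∀ i < 6, ∃ M, ∀ t, |V i t| ≤ M)
    {T : ℝ} (h : ∀ t, T < t → 0 < V 1 t) :
    ∃ l, Tendsto (V 0) atTop (𝓝 l) ∧ ∀ t, T ≤ t → V 0 t < l := by
  have hmono : StrictMonoOn (V 0) (Set.Ici T) := by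
    apply strictMonoOn_of_deriv_pos (convex_Ici T)
      (fun t _ => (hV.deriv 0 (by norm_num) t).continuousAt.continuousWithinAt)
    intro t ht
    rw [interior_Ici] at ht
    rw [(hV.deriv 0 (by norm_num) t).deriv]
    exact h t ht
  obtain ⟨M, hM⟩ := hb 0 (by norm_num)
  have hm : Monotone fun t => V 0 (max T t) := fun s t hst =>
    hmono.monotoneOn (Set.mem_Ici.2 (le_max_left _ _)) (Set.mem_Ici.2 (le_max_left _ _))
      (max_le_max le_rfl hst)
  have hlim := tendsto_atTop_ciSup hm ⟨M, by rintro _ ⟨t, rfl⟩; exact (le_abs_self _).trans (hM _)⟩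
  refine ⟨_, hlim.congr' ?_, fun t ht => ?_⟩
  · filter_upwards [eventually_ge_atTop T] with t ht
    rw [max_eq_right ht]
  · refine (hmono ht (ht.trans (by linarith) : T ≤ t + 1) (by linarith)).trans_le ?_
    have := hm.ge_of_tendsto hlim (t + 1)
    rwa [max_eq_right (by linarith)] at this

theorem tendsto_of_deriv_neg (hV : IsEmdenFowler a V)
    {T : ℝ} (h : ∀ t, T < t → V 1 t < 0) :
    ∃ l, Tendsto (V 0) atTop (𝓝 l) ∧ ∀ t, T ≤ t → l < V 0 t := by
  have hmono : StrictAntiOn (V 0) (Set.Ici T) := by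
    apply strictAntiOn_of_deriv_neg (convex_Ici T)
      (fun t _ => (hV.deriv 0 (by norm_num) t).continuousAt.continuousWithinAt)
    intro t ht
    rw [interior_Ici] at ht
    rw [(hV.deriv 0 (by norm_num) t).deriv]
    exact h t ht
  have hm : Antitone fun t => V 0 (max T t) := fun s t hst =>
    hmono.antitoneOn (Set.mem_Ici.2 (le_max_left _ _)) (Set.mem_Ici.2 (le_max_left _ _))
      (max_le_max le_rfl hst)
  have hlim := tendsto_atTop_ciInf hm ⟨0, by rintro _ ⟨t, rfl⟩; exact (hV.pos _).le⟩
  refine ⟨_, hlim.congr' ?_, fun t ht => ?_⟩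
  · filter_upwards [eventually_ge_atTop T] with t ht
    rw [max_eq_right ht]
  · refine lt_of_le_of_lt ?_ (hmono ht (ht.trans (by linarith) : T ≤ t + 1) (by linarith))
    have := hm.le_of_tendsto hlim (t + 1)
    rwa [max_eq_right (by linarith)] at this

theorem not_forall_deriv_pos (ha : 0 < a) (hV : IsEmdenFowler a V)
    (hb : ∀ i < 6, ∃ M, ∀ t, |V i t| ≤ M) (h : ∀ t, 0 < V 1 t) : False := by
  obtain ⟨l, hl, -⟩ := hV.tendsto_of_deriv_pos hb (T := 0) fun t _ => h t
  refine hV.not_forall_force_neg hb fun t => force_neg ha (hV.pos t) ?_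
    (hV.force_eq_zero_of_tendsto ha hb hl)
  obtain ⟨l', hl', h'⟩ := hV.tendsto_of_deriv_pos hb (T := t) fun t _ => h t
  rw [tendsto_nhds_unique hl hl']
  exact h' t le_rfl

theorem exists_deriv_eq_zero (ha : 0 < a) (hV : IsEmdenFowler a V)
    (hb : ∀ i < 6, ∃ M, ∀ t, |V i t| ≤ M) : ∃ t, V 1 t = 0 := by
  by_contra! h
  have hc : Continuous (V 1) :=
    continuous_iff_continuousAt.2 fun t => (hV.deriv 1 (by norm_num) t).continuousAt
  by_cases h0 : ∀ t, 0 < V 1 t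
  · exact hV.not_forall_deriv_pos ha hb h0
  push Not at h0
  obtain ⟨s, hs⟩ := h0
  have hneg : ∀ t, V 1 t < 0 := by
    intro t
    by_contra! ht
    obtain ⟨r, hr⟩ := mem_range_of_exists_le_of_exists_ge hc ⟨s, hs⟩ ⟨t, ht⟩
    exact h r hr
  refine (hV.comp_const_sub 0).not_forall_deriv_pos ha (fun i hi => ?_) fun t => ?_
  · obtain ⟨A, hA⟩ := hb i hi
    exact ⟨A, fun t => by simpa [abs_mul] using hA (0 - t)⟩
  · simpa using hneg (-t)

theorem exists_second_critical (ha : 0 < a) (hV : IsEmdenFowler a V)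
    (hb : ∀ i < 6, ∃ M, ∀ t, |V i t| ≤ M) (hincr : Monotone fun t => exp (a * t) * V 0 t)
    (hunb : ¬ ∃ M, ∀ t, exp (a * t) * V 0 t ≤ M) {s : ℝ}
    (hsymm : ∀ t, V 0 (s + t) = V 0 (s - t)) : ∃ t, s < t ∧ V 1 t = 0 := by
  by_contra! h
  have hall : ∀ t, ∃ r, s ≤ r ∧ V 0 t = V 0 r := by
    intro t
    rcases le_total s t with hst | hst
    · exact ⟨t, hst, rfl⟩
    · refine ⟨s + (s - t), by linarith, ?_⟩
      rw [hsymm]; ring_nf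
  have hc : Continuous (V 1) :=
    continuous_iff_continuousAt.2 fun t => (hV.deriv 1 (by norm_num) t).continuousAt
  by_cases h0 : ∀ t, s < t → 0 < V 1 t
  · obtain ⟨l, hl, hlt⟩ := hV.tendsto_of_deriv_pos hb h0
    refine hV.not_forall_force_neg hb fun t => ?_
    obtain ⟨r, hr, e⟩ := hall t
    rw [e]
    exact force_neg ha (hV.pos r) (hlt r hr) (hV.force_eq_zero_of_tendsto ha hb hl)
  push Not at h0
  obtain ⟨q, hq, hq'⟩ := h0
  have hneg : ∀ t, s < t → V 1 t < 0 := by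
    intro t hst
    by_contra! ht
    obtain ⟨r, hr, hr'⟩ := (isPreconnected_Ioi (a := s)).intermediate_value hq hst
      hc.continuousOn ⟨hq', ht⟩
    exact h r hr hr'
  obtain ⟨l, hl, hlt⟩ := hV.tendsto_of_deriv_neg hneg
  rcases (ge_of_tendsto' hl fun t => (hV.pos t).le : 0 ≤ l).eq_or_lt with rfl | hl0
  · refine hunb (hV.exists_exp_mul_le_of_tendsto_zero ha hb hincr (T := s) ?_ hl)
    apply antitoneOn_of_deriv_nonpos (convex_Ici s)
      (fun t _ => (hV.deriv 0 (by norm_num) t).continuousAt.continuousWithinAt)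
      (fun t _ => (hV.deriv 0 (by norm_num) t).differentiableAt.differentiableWithinAt)
    intro t ht
    rw [interior_Ici] at ht
    rw [(hV.deriv 0 (by norm_num) t).deriv]
    exact (hneg t ht).le
  · refine hV.not_forall_force_pos hb fun t => ?_
    obtain ⟨r, hr, e⟩ := hall t
    rw [e]
    exact force_pos ha hl0 (hlt r hr) (hV.force_eq_zero_of_tendsto ha hb hl)

/-- Bounded solutions which are squeezed between the two slow exponentials and do not decay fast
are periodic. -/
theorem exists_periodic (ha : 1 / 2 ≤ a) (hV : IsEmdenFowler a V) (hb0 : ∃ M, ∀ t, V 0 t ≤ M)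
    (hincr : Monotone fun t => exp (a * t) * V 0 t)
    (hdecr : Antitone fun t => exp (-(a * t)) * V 0 t)
    (hunb : ¬ ∃ M, ∀ t, exp (a * t) * V 0 t ≤ M) : ∃ p, 0 < p ∧ Function.Periodic (V 0) p := by
  have ha0 : 0 < a := by linarith
  have hb := hV.exists_bound ha0 hb0
  have hup := hV.rpow_le ha0 hb hincr hdecr
  obtain ⟨s, hs⟩ := hV.exists_deriv_eq_zero ha0 hb
  have hss := hV.symm_of_critical ha hb hup hs
  obtain ⟨r, hr, hr'⟩ := hV.exists_second_critical ha0 hb hincr hunb hss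
  have hrr := hV.symm_of_critical ha hb hup hr'
  refine ⟨2 * (r - s), by linarith, fun t => ?_⟩
  have h1 := hrr (t + r - 2 * s)
  have h2 := hss (s - t)
  rw [show t + 2 * (r - s) = r + (t + r - 2 * s) by ring, h1,
    show r - (t + r - 2 * s) = s + (s - t) by ring, h2]
  ring_nf

end IsEmdenFowler

/-- Euclidean space of dimension `n`. -/
abbrev Pt (n : ℕ) := EuclideanSpace ℝ (Fin n)

/-- The third power of the Laplacian. -/
abbrev triLaplacian {n : ℕ} (f : Pt n → ℝ) : Pt n → ℝ := laplacian (laplacian (laplacian f))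

section Laplacian
variable {n : ℕ}

theorem laplacian_eq_sum_fderiv_fderiv (f : Pt n → ℝ) (x : Pt n) : laplacian f x =
    ∑ i : Fin n, fderiv ℝ (fderiv ℝ f) x (EuclideanSpace.single i 1) (EuclideanSpace.single i 1) := by
  simp [laplacian, iteratedFDeriv_two_apply]

theorem laplacian_eq_sum {f : Pt n → ℝ} {x : Pt n} (hf : ContDiffAt ℝ 2 f x) : laplacian f x =
    ∑ i : Fin n, fderiv ℝ (fun y => fderiv ℝ f y (EuclideanSpace.single i 1)) x
      (EuclideanSpace.single i 1) := by
  rw [laplacian_eq_sum_fderiv_fderiv]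
  have h : DifferentiableAt ℝ (fderiv ℝ f) x :=
    (hf.fderiv_right (m := 1) (by norm_num)).differentiableAt (by norm_num)
  refine Finset.sum_congr rfl fun i _ => ?_
  rw [fderiv_clm_apply h (differentiableAt_const _)]
  simp

theorem laplacian_congr {f g : Pt n → ℝ} {x : Pt n} (h : f =ᶠ[𝓝 x] g) :
    laplacian f =ᶠ[𝓝 x] laplacian g := by
  filter_upwards [h.iteratedFDeriv ℝ 2] with y hy
  simp only [laplacian, hy]

theorem triLaplacian_congr {f g : Pt n → ℝ} {x : Pt n} (h : f =ᶠ[𝓝 x] g) :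
    triLaplacian f x = triLaplacian g x :=
  (laplacian_congr (laplacian_congr (laplacian_congr h))).eq_of_nhds

theorem ContDiffAt.laplacian {f : Pt n → ℝ} {x : Pt n} {k m : WithTop ℕ∞} (hf : ContDiffAt ℝ m f x)
    (hk : k + 2 ≤ m) : ContDiffAt ℝ k (laplacian f) x := by
  have h2 : ContDiffAt ℝ k (fderiv ℝ (fderiv ℝ f)) x := by
    refine ContDiffAt.fderiv_right (ContDiffAt.fderiv_right (m := k + 1) hf ?_) le_rfl
    rwa [add_assoc, one_add_one_eq_two]
  have : _root_.laplacian f = fun x => ∑ i : Fin n, fderiv ℝ (fderiv ℝ f) x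
      (EuclideanSpace.single i 1) (EuclideanSpace.single i 1) :=
    funext (laplacian_eq_sum_fderiv_fderiv f)
  rw [this]
  exact ContDiffAt.sum fun i _ => (h2.clm_apply contDiffAt_const).clm_apply contDiffAt_const

theorem ContDiff.laplacian {f : Pt n → ℝ} (hf : ContDiff ℝ ∞ f) : ContDiff ℝ ∞ (laplacian f) :=
  contDiff_iff_contDiffAt.2 fun x => (hf.contDiffAt (x := x)).laplacian le_rfl

theorem ContDiffOn.laplacian {f : Pt n → ℝ} {s : Set (Pt n)} (hs : IsOpen s) {k m : WithTop ℕ∞}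
    (hf : ContDiffOn ℝ m f s) (hk : k + 2 ≤ m) : ContDiffOn ℝ k (laplacian f) s :=
  fun _ hx => ((hf.contDiffAt (hs.mem_nhds hx)).laplacian hk).contDiffWithinAt

theorem laplacian_comp_affine (f : Pt n → ℝ) (c : ℝ) (b x : Pt n) :
    laplacian (fun y => f (c • y + b)) x = c ^ 2 * laplacian f (c • x + b) := by
  have h1 : ∀ {F : Type} [NormedAddCommGroup F] [NormedSpace ℝ F] (g : Pt n → F),
      fderiv ℝ (fun y => g (c • y + b)) = fun y => c • fderiv ℝ g (c • y + b) := by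
    intro F _ _ g
    funext y
    rw [fderiv_comp_smul (f := fun z => g (z + b)) c, fderiv_comp_add_right]
  simp only [laplacian_eq_sum_fderiv_fderiv, Finset.mul_sum]
  refine Finset.sum_congr rfl fun i _ => ?_
  have h2 := congrFun (fderiv_const_smul_field (𝕜 := ℝ) (f := fun y => fderiv ℝ f (c • y + b)) c) x
  rw [h1 f]
  erw [h2]
  rw [Pi.smul_apply, h1]
  simp only [_root_.smul_apply, smul_eq_mul]
  ring

theorem laplacian_const_mul (f : Pt n → ℝ) (c : ℝ) (x : Pt n) :
    laplacian (fun y => c * f y) x = c * laplacian f x := by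
  simp only [laplacian_eq_sum_fderiv_fderiv, Finset.mul_sum]
  refine Finset.sum_congr rfl fun i _ => ?_
  have h1 : ∀ {F : Type} [NormedAddCommGroup F] [NormedSpace ℝ F] (g : Pt n → F),
      fderiv ℝ (fun y => c • g y) = fun y => c • fderiv ℝ g y := by
    intro F _ _ g
    funext y
    exact congrFun (fderiv_const_smul_field (𝕜 := ℝ) (f := g) c) y
  have h2 := h1 f
  simp only [smul_eq_mul] at h2
  rw [h2, h1 (fderiv ℝ f)]
  rfl

theorem triLaplacian_comp_affine (f : Pt n → ℝ) (c : ℝ) (b x : Pt n) :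
    triLaplacian (fun y => f (c • y + b)) x = c ^ 6 * triLaplacian f (c • x + b) := by
  have h1 : laplacian (fun y => f (c • y + b)) = fun y => c ^ 2 * laplacian f (c • y + b) :=
    funext (laplacian_comp_affine f c b)
  have h2 : laplacian (fun y => c ^ 2 * laplacian f (c • y + b))
      = fun y => c ^ 4 * laplacian (laplacian f) (c • y + b) := by
    funext y
    rw [laplacian_const_mul (fun y => laplacian f (c • y + b)), laplacian_comp_affine]
    ring
  rw [triLaplacian, h1, h2, laplacian_const_mul (fun y => laplacian (laplacian f) (c • y + b)),
    laplacian_comp_affine]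
  ring

theorem triLaplacian_const_mul (f : Pt n → ℝ) (c : ℝ) (x : Pt n) :
    triLaplacian (fun y => c * f y) x = c * triLaplacian f x := by
  have h1 : ∀ g : Pt n → ℝ, laplacian (fun y => c * g y) = fun y => c * laplacian g y :=
    fun g => funext (laplacian_const_mul g c)
  rw [triLaplacian, h1, h1, h1]

/-- The Laplacian of a radial function. -/
theorem laplacian_radial {H H' : ℝ → ℝ} {H'' : ℝ} {x : Pt n}
    (hH : ∀ᶠ r in 𝓝 (‖x‖ ^ 2), HasDerivAt H (H' r) r) (hH' : HasDerivAt H' H'' (‖x‖ ^ 2)) :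
    laplacian (fun y => H (‖y‖ ^ 2)) x = 2 * n * H' (‖x‖ ^ 2) + 4 * ‖x‖ ^ 2 * H'' := by
  have hq : ∀ y : Pt n, HasFDerivAt (fun y : Pt n => ‖y‖ ^ 2) (2 • innerSL ℝ y) y :=
    fun y => (hasStrictFDerivAt_norm_sq y).hasFDerivAt
  have h1 : fderiv ℝ (fun y : Pt n => H (‖y‖ ^ 2))
      =ᶠ[𝓝 x] fun y => H' (‖y‖ ^ 2) • (2 • innerSL ℝ y : Pt n →L[ℝ] ℝ) := by
    have hc : Tendsto (fun y : Pt n => ‖y‖ ^ 2) (𝓝 x) (𝓝 (‖x‖ ^ 2)) := (hq x).continuousAt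
    filter_upwards [hc.eventually hH] with y hy
    exact (hy.comp_hasFDerivAt y (hq y)).fderiv
  have h2 : HasFDerivAt (fun y : Pt n => (2 • innerSL ℝ y : Pt n →L[ℝ] ℝ)) (2 • innerSL ℝ) x :=
    (innerSL ℝ (E := Pt n)).hasFDerivAt.const_smul 2
  have h3 : HasFDerivAt (fun y : Pt n => H' (‖y‖ ^ 2) • (2 • innerSL ℝ y : Pt n →L[ℝ] ℝ)) _ x :=
    (hH'.comp_hasFDerivAt x (hq x)).smul h2
  rw [laplacian_eq_sum_fderiv_fderiv, h1.fderiv_eq, h3.fderiv]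
  have hs : ∀ i : Fin n, innerSL ℝ (EuclideanSpace.single i (1 : ℝ))
      (EuclideanSpace.single i (1 : ℝ)) = (1 : ℝ) := fun i => by
    rw [innerSL_apply_apply]
    simp
  have hs' : ∀ i : Fin n, inner ℝ x (EuclideanSpace.single i (1 : ℝ)) = x i := fun i => by
    rw [real_inner_comm, EuclideanSpace.inner_single_left]
    simp
  simp [Finset.sum_add_distrib, EuclideanSpace.real_norm_sq_eq, Finset.mul_sum, hs, hs']
  rw [Finset.sum_mul]
  congr 1
  · ring
  · exact Finset.sum_congr rfl fun i _ => by ring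

end Laplacian

section IntegrationByParts
variable {n : ℕ}

theorem integrable_mul_of_tsupport_subset {f g : Pt n → ℝ} {U : Set (Pt n)} (hU : IsOpen U)
    (hf : ContinuousOn f U) (hg : Continuous g) (hc : HasCompactSupport g) (hs : tsupport g ⊆ U) :
    Integrable fun x => f x * g x := by
  have h1 : Continuous fun x => f x * g x :=
    (hf.mul hg.continuousOn).continuous_of_tsupport_subset hU
      (tsupport_mul_subset_right.trans hs)
  exact h1.integrable_of_hasCompactSupport (hc.mul_left (f := f))

theorem integral_mul_fderiv_of_tsupport_subset {f g : Pt n → ℝ} {U : Set (Pt n)} (hU : IsOpen U)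
    (hf : ContDiffOn ℝ 1 f U) (hg : ContDiff ℝ 1 g) (hc : HasCompactSupport g)
    (hs : tsupport g ⊆ U) (e : Pt n) :
    ∫ x, f x * fderiv ℝ g x e = -∫ x, fderiv ℝ f x e * g x := by
  have hf' : ContinuousOn (fun x => fderiv ℝ f x e) U :=
    (hf.continuousOn_fderiv_of_isOpen hU le_rfl).clm_apply continuousOn_const
  have hg' : Continuous fun x => fderiv ℝ g x e :=
    (hg.continuous_fderiv one_ne_zero).clm_apply continuous_const
  exact integral_mul_fderiv_eq_neg_fderiv_mul_of_integrable
    (integrable_mul_of_tsupport_subset hU hf' hg.continuous hc hs)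
    (integrable_mul_of_tsupport_subset hU hf.continuousOn hg' (hc.fderiv_apply ℝ e)
      ((tsupport_fderiv_apply_subset ℝ e).trans hs))
    (integrable_mul_of_tsupport_subset hU hf.continuousOn hg.continuous hc hs)
    (fun x hx => (hf.contDiffAt (hU.mem_nhds (hs hx))).differentiableAt one_ne_zero)
    (fun x _ => hg.differentiable one_ne_zero x)

theorem laplacian_const (c : ℝ) : laplacian (fun _ : Pt n => c) = fun _ => 0 := by
  funext x
  have h : fderiv ℝ (fun _ : Pt n => c) = fun _ => 0 := by
    funext y
    simp
  rw [laplacian_eq_sum_fderiv_fderiv, h]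
  simp

theorem tsupport_laplacian_subset (f : Pt n → ℝ) : tsupport (laplacian f) ⊆ tsupport f := by
  intro x hx
  by_contra h
  rw [notMem_tsupport_iff_eventuallyEq] at h
  have h1 := laplacian_congr h
  have h2 : laplacian (0 : Pt n → ℝ) = 0 := laplacian_const 0
  rw [h2] at h1
  exact (notMem_tsupport_iff_eventuallyEq.2 h1) hx

theorem HasCompactSupport.laplacian {f : Pt n → ℝ} (hf : HasCompactSupport f) :
    HasCompactSupport (laplacian f) :=
  hf.of_isClosed_subset (isClosed_tsupport _) (tsupport_laplacian_subset f)

theorem integral_mul_laplacian {f g : Pt n → ℝ} {U : Set (Pt n)} (hU : IsOpen U)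
    (hf : ContDiffOn ℝ 2 f U) (hg : ContDiff ℝ 2 g) (hc : HasCompactSupport g)
    (hs : tsupport g ⊆ U) : ∫ x, f x * laplacian g x = ∫ x, laplacian f x * g x := by
  have hg1 : ∀ e, ContDiff ℝ 1 fun x => fderiv ℝ g x e := fun e =>
    (hg.fderiv_right (m := 1) (by norm_num)).clm_apply contDiff_const
  have hf1 : ∀ e, ContDiffOn ℝ 1 (fun x => fderiv ℝ f x e) U := fun e =>
    (hf.fderiv_of_isOpen hU (m := 1) (by norm_num)).clm_apply contDiffOn_const
  have hc1 : ∀ e, HasCompactSupport fun x => fderiv ℝ g x e := fun e => hc.fderiv_apply ℝ e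
  have hs1 : ∀ e, tsupport (fun x => fderiv ℝ g x e) ⊆ U := fun e =>
    (tsupport_fderiv_apply_subset ℝ e).trans hs
  have key : ∀ e, ∫ x, f x * fderiv ℝ (fun x => fderiv ℝ g x e) x e
      = ∫ x, fderiv ℝ (fun x => fderiv ℝ f x e) x e * g x := fun e => by
    rw [integral_mul_fderiv_of_tsupport_subset hU (hf.of_le (by norm_num)) (hg1 e) (hc1 e) (hs1 e),
      integral_mul_fderiv_of_tsupport_subset hU (hf1 e) (hg.of_le (by norm_num)) hc hs, neg_neg]
  have hi1 : ∀ e, Integrable fun x => f x * fderiv ℝ (fun x => fderiv ℝ g x e) x e := fun e =>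
    integrable_mul_of_tsupport_subset hU hf.continuousOn
      (((hg1 e).continuous_fderiv one_ne_zero).clm_apply continuous_const)
      ((hc1 e).fderiv_apply ℝ e) ((tsupport_fderiv_apply_subset ℝ e).trans (hs1 e))
  have hi2 : ∀ e, Integrable fun x => fderiv ℝ (fun x => fderiv ℝ f x e) x e * g x := fun e =>
    integrable_mul_of_tsupport_subset hU
      (((hf1 e).continuousOn_fderiv_of_isOpen hU le_rfl).clm_apply continuousOn_const)
      hg.continuous hc hs
  have h1 : ∀ x, f x * laplacian g x = ∑ i : Fin n, f x *
      fderiv ℝ (fun x => fderiv ℝ g x (EuclideanSpace.single i 1)) x (EuclideanSpace.single i 1) :=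
    fun x => by rw [laplacian_eq_sum hg.contDiffAt, Finset.mul_sum]
  have h2 : ∀ x, laplacian f x * g x = ∑ i : Fin n,
      fderiv ℝ (fun x => fderiv ℝ f x (EuclideanSpace.single i 1)) x (EuclideanSpace.single i 1)
        * g x := fun x => by
    by_cases hx : x ∈ tsupport g
    · rw [laplacian_eq_sum (hf.contDiffAt (hU.mem_nhds (hs hx))), Finset.sum_mul]
    · simp [image_eq_zero_of_notMem_tsupport hx]
  simp only [h1, h2]
  rw [integral_finsetSum _ fun i _ => hi1 _, integral_finsetSum _ fun i _ => hi2 _]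
  exact Finset.sum_congr rfl fun i _ => key _

theorem two_le_infty : (2 : WithTop ℕ∞) ≤ ∞ := WithTop.coe_le_coe.2 le_top

theorem integral_mul_triLaplacian {f g : Pt n → ℝ} {U : Set (Pt n)} (hU : IsOpen U)
    (hf : ContDiffOn ℝ 6 f U) (hg : ContDiff ℝ ∞ g) (hc : HasCompactSupport g)
    (hs : tsupport g ⊆ U) : ∫ x, f x * triLaplacian g x = ∫ x, triLaplacian f x * g x := by
  have h2 : ∀ {g : Pt n → ℝ}, ContDiff ℝ ∞ g → ContDiff ℝ 2 g := fun h =>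
    h.of_le two_le_infty
  have hf4 : ContDiffOn ℝ 4 (laplacian f) U := hf.laplacian hU (by norm_num)
  have hf2 : ContDiffOn ℝ 2 (laplacian (laplacian f)) U := hf4.laplacian hU (by norm_num)
  have hs1 := (tsupport_laplacian_subset g).trans hs
  have hs2 := (tsupport_laplacian_subset (laplacian g)).trans hs1
  rw [integral_mul_laplacian hU (hf.of_le (by norm_num)) (h2 hg.laplacian.laplacian)
      hc.laplacian.laplacian hs2,
    integral_mul_laplacian hU (hf4.of_le (by norm_num)) (h2 hg.laplacian) hc.laplacian hs1,
    integral_mul_laplacian hU hf2 (h2 hg) hc hs]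

/-- A smooth power `η ^ (k + 1) * g` loses at most one power of `η` under differentiation. -/
theorem exists_fderiv_pow_mul {η g : Pt n → ℝ} (hη : ContDiff ℝ ∞ η) (hg : ContDiff ℝ ∞ g) (k : ℕ)
    (e : Pt n) : ∃ g' : Pt n → ℝ, ContDiff ℝ ∞ g' ∧
      ∀ x, fderiv ℝ (fun y => η y ^ (k + 1) * g y) x e = η x ^ k * g' x := by
  have hd : ∀ {h : Pt n → ℝ}, ContDiff ℝ ∞ h → ContDiff ℝ ∞ fun x => fderiv ℝ h x e := fun h =>
    (h.fderiv_right (m := ∞) le_rfl).clm_apply contDiff_const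
  refine ⟨fun x => (k + 1) * fderiv ℝ η x e * g x + η x * fderiv ℝ g x e,
    ((contDiff_const.mul (hd hη)).mul hg).add (hη.mul (hd hg)), fun x => ?_⟩
  have h1 := (hη.differentiable (by simp) x).hasFDerivAt.pow (k + 1)
  have h2 := (hg.differentiable (by simp) x).hasFDerivAt
  have h3 : HasFDerivAt (fun y => η y ^ (k + 1) * g y) _ x := h1.mul h2
  rw [h3.fderiv]
  simp
  ring

theorem exists_laplacian_pow_mul {η g : Pt n → ℝ} (hη : ContDiff ℝ ∞ η) (hg : ContDiff ℝ ∞ g)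
    (k : ℕ) : ∃ g' : Pt n → ℝ, ContDiff ℝ ∞ g' ∧
      laplacian (fun y => η y ^ (k + 2) * g y) = fun x => η x ^ k * g' x := by
  have h1 : ∀ e : Pt n, ∃ g' : Pt n → ℝ, ContDiff ℝ ∞ g' ∧ ∀ x,
      fderiv ℝ (fun x => fderiv ℝ (fun y => η y ^ (k + 2) * g y) x e) x e = η x ^ k * g' x := by
    intro e
    obtain ⟨g1, hg1, h1⟩ := exists_fderiv_pow_mul hη hg (k + 1) e
    obtain ⟨g2, hg2, h2⟩ := exists_fderiv_pow_mul hη hg1 k e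
    exact ⟨g2, hg2, fun x => by rw [funext h1, h2]⟩
  choose G hG hG' using h1
  refine ⟨fun x => ∑ i : Fin n, G (EuclideanSpace.single i 1) x,
    ContDiff.sum fun i _ => hG _, funext fun x => ?_⟩
  rw [laplacian_eq_sum (((hη.pow _).mul hg).of_le two_le_infty).contDiffAt,
    Finset.mul_sum]
  exact Finset.sum_congr rfl fun i _ => hG' _ x

theorem exists_triLaplacian_pow {η : Pt n → ℝ} (hη : ContDiff ℝ ∞ η) (m : ℕ) :
    ∃ g : Pt n → ℝ, ContDiff ℝ ∞ g ∧
      triLaplacian (fun y => η y ^ (m + 6)) = fun x => η x ^ m * g x := by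
  obtain ⟨g1, hg1, h1⟩ := exists_laplacian_pow_mul hη (contDiff_const (c := (1 : ℝ))) (m + 4)
  obtain ⟨g2, hg2, h2⟩ := exists_laplacian_pow_mul hη hg1 (m + 2)
  obtain ⟨g3, hg3, h3⟩ := exists_laplacian_pow_mul hη hg2 m
  simp only [mul_one] at h1
  exact ⟨g3, hg3, by rw [triLaplacian, h1, h2, h3]⟩

end IntegrationByParts

section Kernel
variable {n : ℕ}

/-- The Laplacian in the second variable of a jointly smooth function is jointly smooth. -/
theorem contDiffOn_laplacian_slice {F : ℝ × Pt n → ℝ} {U : Set (ℝ × Pt n)} (hU : IsOpen U)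
    (hF : ContDiffOn ℝ ∞ F U) :
    ContDiffOn ℝ ∞ (fun p : ℝ × Pt n => laplacian (fun z => F (p.1, z)) p.2) U := by
  have hslice : ∀ {G : ℝ × Pt n → ℝ}, ContDiffOn ℝ ∞ G U → ∀ p ∈ U, ∀ e,
      fderiv ℝ (fun z => G (p.1, z)) p.2 e = fderiv ℝ G p (0, e) := by
    intro G hG p hp e
    have h1 : HasFDerivAt G (fderiv ℝ G p) (p.1, p.2) :=
      ((hG.contDiffAt (hU.mem_nhds hp)).differentiableAt (by simp)).hasFDerivAt
    have h2 := h1.comp p.2 (hasFDerivAt_prodMk_right p.1 p.2)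
    have h3 : fderiv ℝ (fun z => G (p.1, z)) p.2 = _ := h2.fderiv
    rw [h3]
    simp
  have hsm : ∀ {G : ℝ × Pt n → ℝ} (e : Pt n), ContDiffOn ℝ ∞ G U →
      ContDiffOn ℝ ∞ (fun p => fderiv ℝ G p ((0 : ℝ), e)) U := fun e hG =>
    (hG.fderiv_of_isOpen hU (m := ∞) le_rfl).clm_apply contDiffOn_const
  refine (ContDiffOn.sum (s := Finset.univ) fun i _ =>
    hsm (EuclideanSpace.single i 1) (hsm (EuclideanSpace.single i 1) hF)).congr fun p hp => ?_
  have hc : Continuous fun z : Pt n => (p.1, z) := by fun_prop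
  have hev : ∀ᶠ z in 𝓝 p.2, (p.1, z) ∈ U := hc.continuousAt.eventually (hU.mem_nhds hp)
  rw [laplacian_eq_sum]
  · refine Finset.sum_congr rfl fun i _ => ?_
    rw [← hslice (hsm (EuclideanSpace.single i 1) hF) p hp]
    congr 1
    refine Filter.EventuallyEq.fderiv_eq ?_
    filter_upwards [hev] with z hz
    exact hslice hF (p.1, z) hz _
  · exact ((hF.contDiffAt (hU.mem_nhds hp)).of_le two_le_infty).comp p.2
      (contDiffAt_const.prodMk contDiffAt_id)

theorem contDiffOn_triLaplacian_slice {F : ℝ × Pt n → ℝ} {U : Set (ℝ × Pt n)} (hU : IsOpen U)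
    (hF : ContDiffOn ℝ ∞ F U) :
    ContDiffOn ℝ ∞ (fun p : ℝ × Pt n => triLaplacian (fun z => F (p.1, z)) p.2) U := by
  have h1 : ContDiffOn ℝ ∞ (fun p : ℝ × Pt n => laplacian (fun z => F (p.1, z)) p.2) U :=
    contDiffOn_laplacian_slice hU hF
  have h2 : ContDiffOn ℝ ∞ (fun p : ℝ × Pt n => laplacian (laplacian fun z => F (p.1, z)) p.2) U :=
    contDiffOn_laplacian_slice (F := fun p : ℝ × Pt n => laplacian (fun z => F (p.1, z)) p.2) hU h1
  exact contDiffOn_laplacian_slice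
    (F := fun p : ℝ × Pt n => laplacian (laplacian fun z => F (p.1, z)) p.2) hU h2

theorem exists_bound_triLaplacian_slice {F : ℝ × Pt n → ℝ} {U K : Set (ℝ × Pt n)} (hU : IsOpen U)
    (hF : ContDiffOn ℝ ∞ F U) (hK : IsCompact K) (hKU : K ⊆ U) :
    ∃ C, ∀ p ∈ K, |triLaplacian (fun z => F (p.1, z)) p.2| ≤ C :=
  hK.exists_bound_of_continuousOn ((contDiffOn_triLaplacian_slice hU hF).continuousOn.mono hKU)

theorem laplacian_add {f g : Pt n → ℝ} {x : Pt n} (hf : ContDiff ℝ 2 f) (hg : ContDiff ℝ 2 g) :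
    laplacian (fun y => f y + g y) x = laplacian f x + laplacian g x := by
  have hd : ∀ {h : Pt n → ℝ} (e : Pt n), ContDiff ℝ 2 h → Differentiable ℝ fun y => fderiv ℝ h y e :=
    fun e h => ((h.fderiv_right (m := 1) (by norm_num)).clm_apply contDiff_const).differentiable
      one_ne_zero
  rw [laplacian_eq_sum (hf.add hg).contDiffAt, laplacian_eq_sum hf.contDiffAt,
    laplacian_eq_sum hg.contDiffAt, ← Finset.sum_add_distrib]
  refine Finset.sum_congr rfl fun i _ => ?_
  have h1 : (fun y => fderiv ℝ (fun y => f y + g y) y (EuclideanSpace.single i 1)) = fun y =>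
      fderiv ℝ f y (EuclideanSpace.single i 1) + fderiv ℝ g y (EuclideanSpace.single i 1) := by
    funext y
    rw [fderiv_fun_add (hf.differentiable two_ne_zero y) (hg.differentiable two_ne_zero y)]
    rfl
  rw [h1, fderiv_fun_add (hd _ hf x) (hd _ hg x)]
  rfl

/-- The regularised power `(‖y‖ ^ 2 + e) ^ α`. -/
def regPow (n : ℕ) (e α : ℝ) (y : Pt n) : ℝ := (‖y‖ ^ 2 + e) ^ α

theorem contDiff_regPow {e : ℝ} (he : 0 < e) (α : ℝ) : ContDiff ℝ ∞ (regPow n e α) :=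
  ((contDiff_norm_sq ℝ).add contDiff_const).rpow_const_of_ne fun y => by positivity

theorem regPow_pos {e : ℝ} (he : 0 < e) (α : ℝ) (y : Pt n) : 0 < regPow n e α y :=
  rpow_pos_of_pos (by positivity) α

theorem laplacian_regPow {e : ℝ} (he : 0 < e) (α : ℝ) : laplacian (regPow n e α) = fun x =>
    2 * α * (n + 2 * α - 2) * regPow n e (α - 1) x
      + -(4 * e * α * (α - 1)) * regPow n e (α - 2) x := by
  funext x
  have hd : ∀ (β : ℝ) (r : ℝ), 0 < r + e →
      HasDerivAt (fun r => (r + e) ^ β) (β * (r + e) ^ (β - 1)) r := fun β r hr => by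
    simpa using ((hasDerivAt_id r).add_const e).rpow_const (p := β) (Or.inl hr.ne')
  have hx : 0 < ‖x‖ ^ 2 + e := by positivity
  have h := laplacian_radial (n := n) (x := x) (H := fun r => (r + e) ^ α)
    (H' := fun r => α * (r + e) ^ (α - 1)) (H'' := α * ((α - 1) * (‖x‖ ^ 2 + e) ^ (α - 1 - 1))) ?_
    ((hd _ _ hx).const_mul α)
  · unfold regPow
    rw [h, show (‖x‖ ^ 2 + e) ^ (α - 1) = (‖x‖ ^ 2 + e) * (‖x‖ ^ 2 + e) ^ (α - 2) by
      rw [show α - 1 = 1 + (α - 2) by ring, rpow_add hx, rpow_one],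
      show α - 1 - 1 = α - 2 by ring]
    ring
  · filter_upwards [eventually_gt_nhds (show -e < ‖x‖ ^ 2 by linarith [sq_nonneg ‖x‖])] with r hr
    exact hd _ _ (by linarith)

theorem triLaplacian_regPow {e : ℝ} (he : 0 < e) (x : Pt n) :
    triLaplacian (regPow n e (-(((n : ℝ) - 6) / 2))) x =
      -(n * (n - 6) * (n ^ 2 - 4) * (n ^ 2 - 16) * e ^ 3
        * regPow n e (-(((n : ℝ) + 6) / 2)) x) := by
  have hs : ∀ c α : ℝ, ContDiff ℝ 2 fun y : Pt n => c * regPow n e α y := fun c α =>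
    contDiff_const.mul ((contDiff_regPow he α).of_le two_le_infty)
  have h2 : ∀ a b α β : ℝ, laplacian (fun y => a * regPow n e α y + b * regPow n e β y) =
      fun x => a * laplacian (regPow n e α) x + b * laplacian (regPow n e β) x := fun a b α β => by
    funext x
    rw [laplacian_add (hs _ _) (hs _ _), laplacian_const_mul, laplacian_const_mul]
  have hρ : ∀ (α : ℝ) (x : Pt n), regPow n e (α + 1) x = (‖x‖ ^ 2 + e) * regPow n e α x :=
    fun α x => by
      unfold regPow
      rw [rpow_add (by positivity), rpow_one, mul_comm]
  have h3 : ∀ a b c α : ℝ, laplacian (fun y => a * regPow n e (α + 2) y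
      + b * regPow n e (α + 1) y + c * regPow n e α y) =
      fun x => a * laplacian (regPow n e (α + 2)) x + b * laplacian (regPow n e (α + 1)) x
        + c * laplacian (regPow n e α) x := fun a b c α => by
    funext x
    rw [laplacian_add ((hs _ _).add (hs _ _)) (hs _ _), laplacian_add (hs _ _) (hs _ _),
      laplacian_const_mul, laplacian_const_mul, laplacian_const_mul]
  set γ : ℝ := ((n : ℝ) - 6) / 2 with hγ
  have hn : (n : ℝ) = 2 * γ + 6 := by rw [hγ]; ring
  have e2 : laplacian (laplacian (regPow n e (-γ))) = fun y =>
      (2 * -γ * (n + 2 * -γ - 2) * (2 * (-γ - 1) * (n + 2 * (-γ - 1) - 2)))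
        * regPow n e ((-γ - 4) + 2) y
      + (2 * -γ * (n + 2 * -γ - 2) * -(4 * e * (-γ - 1) * (-γ - 1 - 1))
        + -(4 * e * -γ * (-γ - 1)) * (2 * (-γ - 2) * (n + 2 * (-γ - 2) - 2)))
        * regPow n e ((-γ - 4) + 1) y
      + (-(4 * e * -γ * (-γ - 1)) * -(4 * e * (-γ - 2) * (-γ - 2 - 1)))
        * regPow n e (-γ - 4) y := by
    rw [laplacian_regPow he, h2, laplacian_regPow he, laplacian_regPow he]
    funext y
    rw [show -γ - 1 - 1 = (-γ - 4) + 2 by ring, show -γ - 1 - 2 = (-γ - 4) + 1 by ring,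
      show -γ - 2 - 1 = (-γ - 4) + 1 by ring, show -γ - 2 - 2 = -γ - 4 by ring]
    ring
  rw [show -(((n : ℝ) + 6) / 2) = -γ - 6 by rw [hn]; ring, triLaplacian, e2, h3,
    laplacian_regPow he, laplacian_regPow he, laplacian_regPow he]
  have r1 := hρ (-γ - 6) x
  have r2 := hρ (-γ - 5) x
  have r3 := hρ (-γ - 4) x
  rw [show -γ - 6 + 1 = -γ - 5 by ring] at r1
  rw [show -γ - 5 + 1 = -γ - 4 by ring] at r2
  rw [show -γ - 4 + 1 = -γ - 3 by ring] at r3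
  simp only [show -γ - 4 + 2 - 1 = -γ - 3 by ring, show -γ - 4 + 2 - 2 = -γ - 4 by ring,
    show -γ - 4 + 1 - 1 = -γ - 4 by ring, show -γ - 4 + 1 - 2 = -γ - 5 by ring,
    show -γ - 4 - 1 = -γ - 5 by ring, show -γ - 4 - 2 = -γ - 6 by ring,
    r3, r2, r1, hn]
  ring

end Kernel

/-- The critical exponent `(n + 6) / (n - 6)`. -/
def critExp (n : ℕ) : ℝ := ((n : ℝ) + 6) / ((n : ℝ) - 6)

/-- The decay exponent `(n - 6) / 2`. -/
def decayExp (n : ℕ) : ℝ := ((n : ℝ) - 6) / 2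

/-- A positive solution of the critical sixth order equation on the punctured space. -/
structure IsPositiveSolution {n : ℕ} (u : Pt n → ℝ) : Prop where
  le_dim : 7 ≤ n
  pos : ∀ x, x ≠ 0 → 0 < u x
  contDiffOn : ContDiffOn ℝ 6 u {0}ᶜ
  pde : ∀ x, x ≠ 0 → triLaplacian u x = -(cN n * u x ^ critExp n)

section Annulus
variable {n : ℕ}

theorem one_le_sub_six (hn : 7 ≤ n) : (1 : ℝ) ≤ (n : ℝ) - 6 := by
  have : (7 : ℝ) ≤ n := by exact_mod_cast hn
  linarith

theorem decayExp_pos (hn : 7 ≤ n) : 0 < decayExp n := by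
  have := one_le_sub_six hn
  unfold decayExp
  linarith

theorem cN_pos (hn : 7 ≤ n) : 0 < cN n := by
  have h1 := one_le_sub_six hn
  have h2 : (49 : ℝ) ≤ (n : ℝ) ^ 2 := by nlinarith
  have h3 : 0 < (n : ℝ) ^ 4 - 20 * (n : ℝ) ^ 2 + 64 := by nlinarith
  have h4 : 0 < (n : ℝ) := by linarith
  unfold cN
  have h5 : 0 < (n : ℝ) - 6 := by linarith
  positivity

theorem critExp_eq (hn : 7 ≤ n) : critExp n = 1 + 12 / ((n : ℝ) - 6) := by
  have := one_le_sub_six hn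
  unfold critExp
  field_simp
  ring

theorem one_lt_critExp (hn : 7 ≤ n) : 1 < critExp n := by
  have := one_le_sub_six hn
  rw [critExp_eq hn]
  have : 0 < 12 / ((n : ℝ) - 6) := by positivity
  linarith

theorem decayExp_mul_critExp (hn : 7 ≤ n) : decayExp n * critExp n = decayExp n + 6 := by
  have := one_le_sub_six hn
  unfold critExp decayExp
  field_simp
  ring

/-- The closed annulus between the spheres of radii `R` and `2 * R`. -/
def annulus (n : ℕ) (R : ℝ) : Set (Pt n) := {y | R ≤ ‖y‖ ∧ ‖y‖ ≤ 2 * R}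

theorem isCompact_annulus (R : ℝ) : IsCompact (annulus n R) := by
  refine (isCompact_closedBall (0 : Pt n) (2 * R)).of_isClosed_subset ?_ fun y hy => by simpa using hy.2
  exact (isClosed_le continuous_const continuous_norm).inter
    (isClosed_le continuous_norm continuous_const)

theorem annulus_subset_compl {R : ℝ} (hR : 0 < R) : annulus n R ⊆ {0}ᶜ := fun y hy h => by
  rw [Set.mem_singleton_iff] at h
  have := hy.1
  rw [h, norm_zero] at this
  linarith

/-- A smooth cutoff equal to one on the unit ball and supported in the ball of radius two. -/
def cutoff (n : ℕ) : ContDiffBump (0 : Pt n) := ⟨1, 2, one_pos, one_lt_two⟩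

theorem contDiff_cutoff : ContDiff ℝ ∞ (cutoff n) := (cutoff n).contDiff

theorem cutoff_eq_one {y : Pt n} (hy : ‖y‖ ≤ 1) : cutoff n y = 1 :=
  (cutoff n).one_of_mem_closedBall (by simpa [cutoff] using hy)

theorem cutoff_eq_zero {y : Pt n} (hy : 2 ≤ ‖y‖) : cutoff n y = 0 :=
  (cutoff n).zero_of_le_dist (by simpa [cutoff] using hy)

theorem cutoff_nonneg (y : Pt n) : 0 ≤ cutoff n y := (cutoff n).nonneg

theorem cutoff_le_one (y : Pt n) : cutoff n y ≤ 1 := (cutoff n).le_one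

theorem IsPositiveSolution.scale {u : Pt n → ℝ} (hu : IsPositiveSolution u) {R : ℝ} (hR : 0 < R) :
    IsPositiveSolution fun y => R ^ decayExp n * u (R • y) where
  le_dim := hu.le_dim
  pos x hx := mul_pos (rpow_pos_of_pos hR _) (hu.pos _ (smul_ne_zero hR.ne' hx))
  contDiffOn := contDiffOn_const.mul (hu.contDiffOn.comp
    (contDiff_const_smul R).contDiffOn fun x hx => smul_ne_zero hR.ne' hx)
  pde x hx := by
    have h1 := triLaplacian_comp_affine u R 0 x
    simp only [add_zero] at h1
    have h2 := hu.pos _ (smul_ne_zero hR.ne' hx)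
    rw [triLaplacian_const_mul (fun y => u (R • y)), h1, hu.pde _ (smul_ne_zero hR.ne' hx),
      mul_rpow (rpow_pos_of_pos hR _).le h2.le, ← rpow_mul hR.le, decayExp_mul_critExp hu.le_dim,
      rpow_add hR, show ((6 : ℝ)) = ((6 : ℕ) : ℝ) by norm_num, rpow_natCast]
    ring

theorem IsPositiveSolution.continuousOn {u : Pt n → ℝ} (hu : IsPositiveSolution u) :
    ContinuousOn u {0}ᶜ := hu.contDiffOn.continuousOn

theorem IsPositiveSolution.continuousOn_rpow {u : Pt n → ℝ} (hu : IsPositiveSolution u) :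
    ContinuousOn (fun y => u y ^ critExp n) {0}ᶜ :=
  hu.continuousOn.rpow_const fun y hy => Or.inl (hu.pos y hy).ne'

theorem IsPositiveSolution.integral_mul_triLaplacian {u : Pt n → ℝ} (hu : IsPositiveSolution u)
    {g : Pt n → ℝ} (hg : ContDiff ℝ ∞ g) (hc : HasCompactSupport g) (hs : tsupport g ⊆ {0}ᶜ) :
    ∫ x, u x * triLaplacian g x = -(cN n * ∫ x, u x ^ critExp n * g x) := by
  rw [_root_.integral_mul_triLaplacian isOpen_compl_singleton hu.contDiffOn hg hc hs,
    ← integral_const_mul, ← integral_neg]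
  congr 1
  funext x
  by_cases hx : x = 0
  · rw [image_eq_zero_of_notMem_tsupport fun h => hs h hx]
    simp
  · rw [hu.pde x hx]
    ring

/-- Young's inequality in the weak form that a linear term is absorbed by a superlinear one. -/
theorem exists_mul_le_rpow_add {p a : ℝ} (hp : 1 < p) (ha : 0 < a) (B : ℝ) :
    ∃ C, ∀ s, 0 ≤ s → B * s ≤ a * s ^ p + C := by
  have hB : 0 ≤ |B| := abs_nonneg B
  set S := (|B| / a) ^ (1 / (p - 1)) with hS
  have hS0 : 0 ≤ S := by positivity
  refine ⟨|B| * S, fun s hs => ?_⟩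
  have h1 : B * s ≤ |B| * s := mul_le_mul_of_nonneg_right (le_abs_self B) hs
  rcases le_total s S with h | h
  · have := mul_le_mul_of_nonneg_left h hB
    have : 0 ≤ a * s ^ p := by positivity
    linarith
  · rcases hs.eq_or_lt with h0 | h0
    · rw [← h0] at h ⊢
      have : 0 ≤ a * (0 : ℝ) ^ p := by positivity
      have : 0 ≤ |B| * S := by positivity
      linarith
    · have h2 : |B| / a ≤ s ^ (p - 1) := by
        have := rpow_le_rpow hS0 h (show 0 ≤ p - 1 by linarith)
        rwa [hS, ← rpow_mul (by positivity), one_div_mul_cancel (by linarith), rpow_one] at this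
      rw [div_le_iff₀ ha] at h2
      have h3 : s ^ p = s ^ (p - 1) * s := by
        rw [← rpow_add_one h0.ne']
        congr 1
        ring
      have := mul_le_mul_of_nonneg_right h2 hs
      have : 0 ≤ |B| * S := by positivity
      rw [h3]
      nlinarith

theorem exists_unit_annulus_bound (hn : 7 ≤ n) : ∃ C, 0 ≤ C ∧ ∀ u : Pt n → ℝ,
    IsPositiveSolution u → ∫ y in annulus n 1, u y ^ critExp n ≤ C := by
  set η : Pt n → ℝ := fun y => cutoff n ((1 / 2 : ℝ) • y) * (1 - cutoff n ((2 : ℝ) • y)) with hη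
  have hηs : ContDiff ℝ ∞ η :=
    (contDiff_cutoff.comp (contDiff_const_smul _)).mul
      (contDiff_const.sub (contDiff_cutoff.comp (contDiff_const_smul _)))
  have hη0 : ∀ y, 0 ≤ η y := fun y =>
    mul_nonneg (cutoff_nonneg _) (sub_nonneg.2 (cutoff_le_one _))
  have hη1 : ∀ y, η y ≤ 1 := fun y =>
    mul_le_one₀ (cutoff_le_one _) (sub_nonneg.2 (cutoff_le_one _))
      (by linarith [cutoff_nonneg ((2 : ℝ) • y)])
  have hηa : ∀ y ∈ annulus n 1, η y = 1 := fun y hy => by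
    have h1 := hy.1
    have h2 := hy.2
    rw [hη]
    simp only
    rw [cutoff_eq_one (by rw [norm_smul, Real.norm_of_nonneg (by norm_num)]; linarith),
      cutoff_eq_zero (by rw [norm_smul, Real.norm_of_nonneg (by norm_num)]; linarith)]
    norm_num
  have hηz : ∀ y, ‖y‖ ≤ 1 / 2 → η y = 0 := fun y hy => by
    rw [hη]
    simp only
    rw [cutoff_eq_one (y := (2 : ℝ) • y)
      (by rw [norm_smul, Real.norm_of_nonneg (by norm_num)]; linarith)]
    norm_num
  have hηf : ∀ y, 4 ≤ ‖y‖ → η y = 0 := fun y hy => by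
    rw [hη]
    simp only
    rw [cutoff_eq_zero (y := (1 / 2 : ℝ) • y)
      (by rw [norm_smul, Real.norm_of_nonneg (by norm_num)]; linarith)]
    norm_num
  obtain ⟨g, hg, hgψ⟩ := exists_triLaplacian_pow hηs n
  set ψ : Pt n → ℝ := fun y => η y ^ (n + 6) with hψ
  have hψs : ContDiff ℝ ∞ ψ := hηs.pow _
  have hψc : HasCompactSupport ψ :=
    HasCompactSupport.intro (isCompact_closedBall (0 : Pt n) 4) fun y hy => by
      rw [hψ]
      simp only
      rw [hηf y (by simp at hy; linarith)]
      simp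
  have hψt : tsupport ψ ⊆ {0}ᶜ := fun y hy h => by
    rw [Set.mem_singleton_iff] at h
    subst h
    refine notMem_tsupport_iff_eventuallyEq.2 ?_ hy
    filter_upwards [Metric.ball_mem_nhds (0 : Pt n) (show (0 : ℝ) < 1 / 2 by norm_num)] with y hy
    rw [hψ]
    simp only
    rw [hηz y (by simp at hy; linarith)]
    simp
  have hψ3 : Continuous (triLaplacian ψ) := hψs.laplacian.laplacian.laplacian.continuous
  obtain ⟨B, hB⟩ := (isCompact_closedBall (0 : Pt n) 4).exists_bound_of_continuousOn
    hg.continuous.continuousOn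
  have hc := cN_pos hn
  obtain ⟨C, hC⟩ := exists_mul_le_rpow_add (one_lt_critExp hn) (half_pos hc) B
  have hC0 : 0 ≤ C := by
    have := hC 0 le_rfl
    rwa [zero_rpow (by linarith [one_lt_critExp hn]), mul_zero, mul_zero, zero_add] at this
  set V := volume.real (Metric.closedBall (0 : Pt n) 4) with hV
  refine ⟨2 * C * V / cN n, by positivity, fun u hu => ?_⟩
  have hI2 : Integrable fun y => u y ^ critExp n * ψ y := integrable_mul_of_tsupport_subset
    isOpen_compl_singleton hu.continuousOn_rpow hψs.continuous hψc hψt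
  have hI1 : Integrable fun y => u y * triLaplacian ψ y := integrable_mul_of_tsupport_subset
    isOpen_compl_singleton hu.continuousOn hψ3 hψc.laplacian.laplacian.laplacian
    ((tsupport_laplacian_subset _).trans ((tsupport_laplacian_subset _).trans
      ((tsupport_laplacian_subset _).trans hψt)))
  have hpt : ∀ y, -(u y * triLaplacian ψ y) ≤ cN n / 2 * (u y ^ critExp n * ψ y)
      + (Metric.closedBall (0 : Pt n) 4).indicator (fun _ => C) y := by
    intro y
    rw [hgψ]
    by_cases hy : η y = 0
    · have : 0 ≤ (Metric.closedBall (0 : Pt n) 4).indicator (fun _ => C) y :=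
        Set.indicator_nonneg (fun _ _ => hC0) y
      simp only [hy, hψ]
      rw [zero_pow (by omega), zero_pow (by omega)]
      simpa using this
    · have hy0 : y ≠ 0 := fun h => hy (hηz y (by rw [h]; norm_num))
      have hy4 : y ∈ Metric.closedBall (0 : Pt n) 4 := by
        by_contra h
        exact hy (hηf y (by simp at h; linarith))
      have hηp : 0 < η y := lt_of_le_of_ne (hη0 y) (Ne.symm hy)
      have hup := hu.pos y hy0
      rw [Set.indicator_of_mem hy4]
      have h1 := hC (u y * η y ^ n) (by positivity)
      have h2 : -(u y * (η y ^ n * g y)) ≤ B * (u y * η y ^ n) := by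
        have h3 := (abs_le.1 (hB y hy4)).1
        have h4 : 0 ≤ u y * η y ^ n := by positivity
        nlinarith
      have h3 : (u y * η y ^ n) ^ critExp n ≤ u y ^ critExp n * ψ y := by
        rw [mul_rpow hup.le (by positivity)]
        refine mul_le_mul_of_nonneg_left ?_ (by positivity)
        simp only [hψ]
        rw [← rpow_natCast, ← rpow_natCast, ← rpow_mul hηp.le]
        refine rpow_le_rpow_of_exponent_ge hηp (hη1 y) ?_
        rw [critExp_eq hn]
        have h6 := one_le_sub_six hn
        push_cast
        rw [mul_add, mul_div_assoc', mul_one, add_le_add_iff_left, le_div_iff₀ (by linarith)]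
        linarith
      nlinarith
  have hI3 : Integrable ((Metric.closedBall (0 : Pt n) 4).indicator fun _ => C) :=
    (integrable_indicator_iff measurableSet_closedBall).2
      (integrableOn_const (isCompact_closedBall _ _).measure_lt_top.ne)
  have h1 := integral_mono hI1.neg ((hI2.const_mul (cN n / 2)).add hI3) hpt
  simp only [Pi.neg_apply, Pi.add_apply] at h1
  rw [integral_neg, hu.integral_mul_triLaplacian hψs hψc hψt, integral_add (hI2.const_mul _) hI3,
    integral_const_mul, integral_indicator measurableSet_closedBall, setIntegral_const, smul_eq_mul,
    neg_neg] at h1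
  have h2 : ∫ y in annulus n 1, u y ^ critExp n ≤ ∫ y, u y ^ critExp n * ψ y := by
    have h3 : ∫ y in annulus n 1, u y ^ critExp n = ∫ y in annulus n 1, u y ^ critExp n * ψ y :=
      setIntegral_congr_fun (isCompact_annulus 1).measurableSet fun y hy => by
        simp only [hψ, hηa y hy]
        simp
    rw [h3]
    refine setIntegral_le_integral hI2 (Eventually.of_forall fun y => ?_)
    by_cases hy : y = 0
    · simp only [hψ, hηz y (by rw [hy]; norm_num)]
      simp
    · have := hu.pos y hy
      have := hη0 y
      simp only [hψ]
      positivity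
  rw [le_div_iff₀ hc]
  have : V * C = C * V := mul_comm _ _
  nlinarith

/-- Scale invariant integral bounds over annuli. -/
theorem IsPositiveSolution.exists_annulus_bound {u : Pt n → ℝ} (hu : IsPositiveSolution u) :
    ∃ C, 0 ≤ C ∧ ∀ R, 0 < R → ∫ y in annulus n R, u y ^ critExp n ≤ C * R ^ decayExp n ∧
      ∫ y in annulus n R, u y ≤ C * R ^ (n - decayExp n) := by
  obtain ⟨C, hC0, hC⟩ := exists_unit_annulus_bound hu.le_dim
  set V := volume.real (annulus n 1) with hV
  have hp := one_lt_critExp hu.le_dim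
  have hscale : ∀ R, 0 < R → R • annulus n 1 = annulus n R := by
    intro R hR
    ext y
    rw [Set.mem_smul_set_iff_inv_smul_mem₀ hR.ne']
    simp only [annulus, Set.mem_ofPred_eq, norm_smul, norm_inv, Real.norm_of_nonneg hR.le]
    rw [← div_eq_inv_mul, le_div_iff₀ hR, div_le_iff₀ hR]
    simp
  refine ⟨C + V, by positivity, fun R hR => ?_⟩
  have hs := hu.scale hR
  have hb1 := hC _ hs
  have hRp : 0 < R ^ decayExp n := rpow_pos_of_pos hR _
  have hRn : 0 < R ^ n := pow_pos hR _
  have hint : ∀ v : Pt n → ℝ, IsPositiveSolution v → IntegrableOn v (annulus n 1) ∧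
      IntegrableOn (fun y => v y ^ critExp n) (annulus n 1) := fun v hv =>
    ⟨(hv.continuousOn.mono (annulus_subset_compl one_pos)).integrableOn_compact
      (isCompact_annulus 1),
     (hv.continuousOn_rpow.mono (annulus_subset_compl one_pos)).integrableOn_compact
      (isCompact_annulus 1)⟩
  have hb2 : ∫ y in annulus n 1, R ^ decayExp n * u (R • y) ≤ C + V := by
    have h1 : ∫ y in annulus n 1, R ^ decayExp n * u (R • y) ≤
        ∫ y in annulus n 1, ((R ^ decayExp n * u (R • y)) ^ critExp n + 1) := by
      refine setIntegral_mono_on (hint _ hs).1 ((hint _ hs).2.add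
        (integrableOn_const (isCompact_annulus 1).measure_lt_top.ne))
        (isCompact_annulus 1).measurableSet fun y hy => ?_
      have hy := hs.pos y (annulus_subset_compl one_pos hy)
      rcases le_total (R ^ decayExp n * u (R • y)) 1 with h | h
      · have := rpow_pos_of_pos hy (critExp n)
        linarith
      · have := rpow_le_rpow_of_exponent_le h hp.le
        rw [rpow_one] at this
        linarith
    rw [integral_add (hint _ hs).2 (integrableOn_const (isCompact_annulus 1).measure_lt_top.ne),
      setIntegral_const, smul_eq_mul, mul_one] at h1
    linarith
  have e1 : ∫ y in annulus n 1, (R ^ decayExp n * u (R • y)) ^ critExp n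
      = R ^ (decayExp n + 6) * ((R ^ n)⁻¹ * ∫ y in annulus n R, u y ^ critExp n) := by
    have := Measure.setIntegral_comp_smul_of_pos volume (fun y => u y ^ critExp n)
      (annulus n 1) hR
    rw [hscale R hR, smul_eq_mul, finrank_euclideanSpace_fin] at this
    rw [← this, ← integral_const_mul]
    refine setIntegral_congr_fun (isCompact_annulus 1).measurableSet fun y hy => ?_
    have h2 := hu.pos _ (smul_ne_zero hR.ne' (annulus_subset_compl one_pos hy))
    rw [mul_rpow hRp.le h2.le, ← rpow_mul hR.le, decayExp_mul_critExp hu.le_dim]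
  have e2 : ∫ y in annulus n 1, R ^ decayExp n * u (R • y)
      = R ^ decayExp n * ((R ^ n)⁻¹ * ∫ y in annulus n R, u y) := by
    have := Measure.setIntegral_comp_smul_of_pos volume u (annulus n 1) hR
    rw [hscale R hR, smul_eq_mul, finrank_euclideanSpace_fin] at this
    rw [← this, ← integral_const_mul]
  rw [e1] at hb1
  rw [e2] at hb2
  have k1 : R ^ (decayExp n + 6) * R ^ decayExp n = R ^ n := by
    rw [← rpow_natCast R n, ← rpow_add hR]
    congr 1
    unfold decayExp
    ring
  have k2 : R ^ decayExp n * R ^ (n - decayExp n) = R ^ n := by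
    rw [← rpow_natCast R n, ← rpow_add hR]
    congr 1
    ring
  have hRq : 0 < R ^ (n - decayExp n) := rpow_pos_of_pos hR _
  have hRr : 0 < R ^ (decayExp n + 6) := rpow_pos_of_pos hR _
  have hV0 : 0 ≤ V := measureReal_nonneg
  constructor
  · have : ∫ y in annulus n R, u y ^ critExp n =
        R ^ (decayExp n + 6) * ((R ^ n)⁻¹ * ∫ y in annulus n R, u y ^ critExp n) * R ^ decayExp n := by
      rw [mul_right_comm, k1]
      field_simp
    rw [this]
    exact mul_le_mul_of_nonneg_right (by linarith) hRp.le
  · have : ∫ y in annulus n R, u y =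
        R ^ decayExp n * ((R ^ n)⁻¹ * ∫ y in annulus n R, u y) * R ^ (n - decayExp n) := by
      rw [mul_right_comm, k2]
      field_simp
    rw [this]
    exact mul_le_mul_of_nonneg_right (by linarith) hRq.le

end Annulus

section Weight
variable {n : ℕ}

/-- A function on the punctured space whose integrals over annuli decay geometrically at the origin
and at infinity is integrable. -/
theorem integrable_of_annulus_bound (hn : 0 < n) {f : Pt n → ℝ} (hf : ContinuousOn f {0}ᶜ)
    {C γ : ℝ} (hγ : 0 < γ) (h1 : ∀ R, 0 < R → ∫ y in annulus n R, ‖f y‖ ≤ C * R ^ γ)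
    (h2 : ∀ R, 0 < R → ∫ y in annulus n R, ‖f y‖ ≤ C * R ^ (-γ)) : Integrable f := by
  have : Nonempty (Fin n) := ⟨⟨0, hn⟩⟩
  have hU : (⋃ k : ℤ, annulus n ((2 : ℝ) ^ k)) = {0}ᶜ := by
    refine Set.Subset.antisymm (Set.iUnion_subset fun k => annulus_subset_compl (by positivity)) ?_
    intro y hy
    obtain ⟨k, hk⟩ := exists_mem_Ioc_zpow (norm_pos_iff.2 hy) (one_lt_two (α := ℝ))
    refine Set.mem_iUnion.2 ⟨k, hk.1.le, ?_⟩
    have := hk.2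
    rwa [zpow_add_one₀ two_ne_zero, mul_comm] at this
  have hg : Summable fun k : ℕ => C * ((2 : ℝ) ^ (-γ)) ^ k :=
    (summable_geometric_of_lt_one (by positivity)
      (rpow_lt_one_of_one_lt_of_neg one_lt_two (by linarith))).mul_left C
  have hint0 : ∀ k : ℤ, 0 ≤ ∫ y in annulus n ((2 : ℝ) ^ k), ‖f y‖ := fun k =>
    integral_nonneg fun y => norm_nonneg _
  have hsum : Summable fun k : ℤ => ∫ y in annulus n ((2 : ℝ) ^ k), ‖f y‖ := by
    refine Summable.of_nat_of_neg (hg.of_nonneg_of_le (fun k => hint0 k) fun k => ?_)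
      (hg.of_nonneg_of_le (fun k => hint0 _) fun k => ?_)
    · refine (h2 _ (by positivity)).trans (le_of_eq ?_)
      rw [zpow_natCast, ← rpow_natCast, ← rpow_natCast, ← rpow_mul two_pos.le, ← rpow_mul two_pos.le,
        mul_comm (k : ℝ)]
    · refine (h1 _ (by positivity)).trans (le_of_eq ?_)
      rw [← rpow_intCast, ← rpow_natCast, ← rpow_mul two_pos.le, ← rpow_mul two_pos.le]
      push_cast
      rw [show -(k : ℝ) * γ = -γ * k by ring]
  have h3 : IntegrableOn f ({0}ᶜ : Set (Pt n)) := by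
    rw [← hU]
    exact integrableOn_iUnion_of_summable_integral_norm (fun k =>
      (hf.mono (annulus_subset_compl (by positivity))).integrableOn_compact (isCompact_annulus _))
      hsum
  rwa [IntegrableOn, Measure.restrict_eq_self_of_ae_mem] at h3
  rw [ae_iff]
  simp

/-- The weight `(1 + ‖y‖) ^ (6 - n)`. -/
def farWeight (n : ℕ) (y : Pt n) : ℝ := ((1 + ‖y‖) ^ (n - 6))⁻¹

theorem farWeight_pos (y : Pt n) : 0 < farWeight n y := by
  unfold farWeight
  positivity

theorem continuous_farWeight : Continuous (farWeight n) := by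
  unfold farWeight
  exact Continuous.inv₀ (by fun_prop) fun y => by positivity

theorem farWeight_le_one (y : Pt n) : farWeight n y ≤ 1 :=
  inv_le_one_of_one_le₀ (one_le_pow₀ (by linarith [norm_nonneg y]))

theorem farWeight_le {R : ℝ} (hR : 0 < R) {y : Pt n} (hy : R ≤ ‖y‖) :
    farWeight n y ≤ (R ^ (n - 6))⁻¹ :=
  inv_anti₀ (by positivity) (pow_le_pow_left₀ hR.le (by linarith) _)

theorem continuousOn_norm_pow_inv : ContinuousOn (fun y : Pt n => (‖y‖ ^ 6)⁻¹) {0}ᶜ :=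
  ContinuousOn.inv₀ (by fun_prop) fun y hy => pow_ne_zero _ (norm_ne_zero_iff.2 hy)

theorem setIntegral_annulus_mul_le {R M : ℝ} (hR : 0 < R) {f g : Pt n → ℝ}
    (hf : ContinuousOn f {0}ᶜ) (hg : ContinuousOn g {0}ᶜ) (hf0 : ∀ y, y ≠ 0 → 0 ≤ f y)
    (hM : ∀ y ∈ annulus n R, |g y| ≤ M) :
    ∫ y in annulus n R, ‖f y * g y‖ ≤ M * ∫ y in annulus n R, f y := by
  have hs := annulus_subset_compl (n := n) hR
  rw [← integral_const_mul]
  refine setIntegral_mono_on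
    ((((hf.mul hg).norm.mono hs)).integrableOn_compact (isCompact_annulus _))
    (((continuousOn_const.mul hf).mono hs).integrableOn_compact (isCompact_annulus _))
    (isCompact_annulus _).measurableSet fun y hy => ?_
  rw [norm_mul, Real.norm_of_nonneg (hf0 y (hs hy)), mul_comm]
  exact mul_le_mul_of_nonneg_right (hM y hy) (hf0 y (hs hy))

theorem rpow_sub_six (hn : 7 ≤ n) {R : ℝ} (hR : 0 < R) :
    (R ^ (n - 6))⁻¹ = R ^ (-(2 * decayExp n)) := by
  rw [rpow_neg hR.le, ← rpow_natCast, Nat.cast_sub (by omega)]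
  congr 2
  unfold decayExp
  push_cast
  ring

theorem IsPositiveSolution.integrable_rpow_mul_farWeight {u : Pt n → ℝ}
    (hu : IsPositiveSolution u) : Integrable fun y => u y ^ critExp n * farWeight n y := by
  obtain ⟨C, hC0, hC⟩ := hu.exists_annulus_bound
  have hu0 : ∀ y, y ≠ 0 → 0 ≤ u y ^ critExp n := fun y hy => (rpow_pos_of_pos (hu.pos y hy) _).le
  have hI0 : ∀ R, 0 < R → 0 ≤ ∫ y in annulus n R, u y ^ critExp n := fun R hR =>
    setIntegral_nonneg (isCompact_annulus R).measurableSet fun y hy =>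
      hu0 y (annulus_subset_compl hR hy)
  refine integrable_of_annulus_bound (C := C) (by linarith [hu.le_dim])
    (hu.continuousOn_rpow.mul continuous_farWeight.continuousOn) (decayExp_pos hu.le_dim) ?_ ?_
  · intro R hR
    refine (setIntegral_annulus_mul_le (M := 1) hR hu.continuousOn_rpow
      continuous_farWeight.continuousOn hu0 fun y _ => ?_).trans ?_
    · rw [abs_of_pos (farWeight_pos y)]
      exact farWeight_le_one y
    · linarith [(hC R hR).1]
  · intro R hR
    refine (setIntegral_annulus_mul_le hR hu.continuousOn_rpow
      continuous_farWeight.continuousOn hu0 (M := (R ^ (n - 6))⁻¹) fun y hy => ?_).trans ?_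
    · rw [abs_of_pos (farWeight_pos y)]
      exact farWeight_le hR hy.1
    · refine (mul_le_mul_of_nonneg_left (hC R hR).1 (by positivity)).trans (le_of_eq ?_)
      rw [rpow_sub_six hu.le_dim hR, mul_left_comm, ← rpow_add hR]
      congr 2
      ring

theorem IsPositiveSolution.integrable_mul_farWeight {u : Pt n → ℝ}
    (hu : IsPositiveSolution u) : Integrable fun y => u y * ((‖y‖ ^ 6)⁻¹ * farWeight n y) := by
  obtain ⟨C, hC0, hC⟩ := hu.exists_annulus_bound
  have hu0 : ∀ y, y ≠ 0 → 0 ≤ u y := fun y hy => (hu.pos y hy).le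
  have hcont : ContinuousOn (fun y : Pt n => (‖y‖ ^ 6)⁻¹ * farWeight n y) {0}ᶜ :=
    continuousOn_norm_pow_inv.mul continuous_farWeight.continuousOn
  have habs : ∀ y : Pt n, |(‖y‖ ^ 6)⁻¹ * farWeight n y| = (‖y‖ ^ 6)⁻¹ * farWeight n y := fun y =>
    abs_of_nonneg (mul_nonneg (by positivity) (farWeight_pos y).le)
  have hle : ∀ {R : ℝ}, 0 < R → ∀ y ∈ annulus n R, (‖y‖ ^ 6)⁻¹ ≤ (R ^ 6)⁻¹ := fun hR y hy =>
    inv_anti₀ (by positivity) (pow_le_pow_left₀ hR.le hy.1 _)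
  have h6 : ∀ {R : ℝ}, 0 < R → (R ^ 6)⁻¹ = R ^ (-6 : ℝ) := fun hR => by
    rw [rpow_neg hR.le, show (6 : ℝ) = ((6 : ℕ) : ℝ) by norm_num, rpow_natCast]
  have hn : (n : ℝ) = 2 * decayExp n + 6 := by
    unfold decayExp
    ring
  refine integrable_of_annulus_bound (C := C) (by linarith [hu.le_dim])
    (hu.continuousOn.mul hcont) (decayExp_pos hu.le_dim) ?_ ?_
  · intro R hR
    refine (setIntegral_annulus_mul_le (M := (R ^ 6)⁻¹) hR hu.continuousOn
      hcont hu0 fun y hy => ?_).trans ?_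
    · rw [habs]
      exact (mul_le_of_le_one_right (by positivity) (farWeight_le_one y)).trans (hle hR y hy)
    · refine (mul_le_mul_of_nonneg_left (hC R hR).2 (by positivity)).trans (le_of_eq ?_)
      rw [h6 hR, mul_left_comm, ← rpow_add hR]
      congr 2
      rw [hn]
      ring
  · intro R hR
    refine (setIntegral_annulus_mul_le (M := (R ^ 6)⁻¹ * (R ^ (n - 6))⁻¹) hR hu.continuousOn
      hcont hu0 fun y hy => ?_).trans ?_
    · rw [habs]
      exact mul_le_mul (hle hR y hy) (farWeight_le hR hy.1) (farWeight_pos y).le (by positivity)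
    · refine (mul_le_mul_of_nonneg_left (hC R hR).2 (by positivity)).trans (le_of_eq ?_)
      rw [h6 hR, rpow_sub_six hu.le_dim hR, mul_left_comm, ← rpow_add hR, ← rpow_add hR]
      congr 2
      rw [hn]
      ring

/-- Polynomial decay of the translated regularised kernels. -/
theorem exists_regPow_le {e : ℝ} (he : 0 < e) (x : Pt n) (m : ℕ) :
    ∃ C, 0 ≤ C ∧ ∀ y, regPow n e (-((m : ℝ) / 2)) (y - x) ≤ C * ((1 + ‖y‖) ^ m)⁻¹ := by
  set A : ℝ := 2 * ((1 + ‖x‖) ^ 2 / e + 1) with hA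
  have hA0 : 0 < A := by positivity
  refine ⟨A ^ ((m : ℝ) / 2), by positivity, fun y => ?_⟩
  have h1 : 1 + ‖y‖ ≤ (1 + ‖x‖) + ‖y - x‖ := by
    have := norm_add_le (y - x) x
    rw [sub_add_cancel] at this
    linarith
  have h2 : (1 + ‖y‖) ^ 2 ≤ A * (‖y - x‖ ^ 2 + e) := by
    have h3 : (1 + ‖y‖) ^ 2 ≤ ((1 + ‖x‖) + ‖y - x‖) ^ 2 := pow_le_pow_left₀ (by positivity) h1 2
    have h4 : A * (‖y - x‖ ^ 2 + e) = 2 * ((1 + ‖x‖) ^ 2 + ‖y - x‖ ^ 2)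
        + 2 * ((1 + ‖x‖) ^ 2 / e * ‖y - x‖ ^ 2 + e) := by
      rw [hA]
      field_simp
      ring
    have h5 : 0 ≤ (1 + ‖x‖) ^ 2 / e * ‖y - x‖ ^ 2 := by positivity
    nlinarith [sq_nonneg ((1 + ‖x‖) - ‖y - x‖)]
  have hρ : 0 < ‖y - x‖ ^ 2 + e := by positivity
  unfold regPow
  rw [rpow_neg hρ.le, ← div_eq_mul_inv, inv_eq_one_div, div_le_div_iff₀ (by positivity)
    (by positivity), one_mul, ← mul_rpow hA0.le hρ.le]
  calc (1 + ‖y‖) ^ m = ((1 + ‖y‖) ^ 2) ^ ((m : ℝ) / 2) := by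
        rw [← rpow_natCast (1 + ‖y‖) 2, ← rpow_mul (by positivity), Nat.cast_ofNat,
          mul_div_cancel₀ _ (two_ne_zero), rpow_natCast]
    _ ≤ _ := rpow_le_rpow (by positivity) h2 (by positivity)

theorem exists_regPow_le_farWeight (hn : 7 ≤ n) {e : ℝ} (he : 0 < e) (x : Pt n) :
    ∃ C, 0 ≤ C ∧ ∀ y, regPow n e (-decayExp n) (y - x) ≤ C * farWeight n y := by
  obtain ⟨C, hC0, hC⟩ := exists_regPow_le he x (n - 6)
  refine ⟨C, hC0, fun y => ?_⟩
  have := hC y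
  rwa [Nat.cast_sub (by omega)] at this

theorem inv_pow_add_six_le (hn : 7 ≤ n) {y : Pt n} (hy : y ≠ 0) :
    ((1 + ‖y‖) ^ (n + 6))⁻¹ ≤ (‖y‖ ^ 6)⁻¹ * farWeight n y := by
  have hy' := norm_pos_iff.2 hy
  unfold farWeight
  rw [← mul_inv]
  refine inv_anti₀ (by positivity) ?_
  calc ‖y‖ ^ 6 * (1 + ‖y‖) ^ (n - 6) ≤ (1 + ‖y‖) ^ 6 * (1 + ‖y‖) ^ (n - 6) := by
        gcongr
        linarith
    _ = (1 + ‖y‖) ^ n := by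
        rw [← pow_add]
        congr 1
        omega
    _ ≤ _ := pow_le_pow_right₀ (by linarith) (by omega)

end Weight

section TestFunctions
variable {n : ℕ}

theorem triLaplacian_comp_smul (f : Pt n → ℝ) (c : ℝ) (x : Pt n) :
    triLaplacian (fun y => f (c • y)) x = c ^ 6 * triLaplacian f (c • x) := by
  simpa using triLaplacian_comp_affine f c 0 x

theorem inv_smul_mem_annulus {R : ℝ} (hR : 0 < R) {y : Pt n} (hy : y ∈ annulus n R) :
    R⁻¹ • y ∈ annulus n 1 := by
  have h : ‖R⁻¹ • y‖ = ‖y‖ / R := by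
    rw [norm_smul, norm_inv, Real.norm_of_nonneg hR.le, div_eq_inv_mul]
  refine ⟨?_, ?_⟩
  · rw [h, le_div_iff₀ hR, one_mul]
    exact hy.1
  · rw [h, div_le_iff₀ hR]
    linarith [hy.2]

/-- The translated regularised kernel. -/
def shiftedKernel (e : ℝ) (x y : Pt n) : ℝ := regPow n e (-decayExp n) (y - x)

theorem contDiff_shiftedKernel {e : ℝ} (he : 0 < e) (x : Pt n) :
    ContDiff ℝ ∞ (shiftedKernel e x) :=
  (contDiff_regPow he _).comp (contDiff_id.sub contDiff_const)

theorem shiftedKernel_pos {e : ℝ} (he : 0 < e) (x y : Pt n) : 0 < shiftedKernel e x y :=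
  regPow_pos he _ _

/-- The positive constant relating the regularised kernels. -/
def kernelConst (n : ℕ) : ℝ := n * (n - 6) * (n ^ 2 - 4) * (n ^ 2 - 16)

theorem kernelConst_pos (hn : 7 ≤ n) : 0 < kernelConst n := by
  have h1 := one_le_sub_six hn
  have h2 : (49 : ℝ) ≤ (n : ℝ) ^ 2 := by nlinarith
  unfold kernelConst
  have h3 : 0 < (n : ℝ) := by linarith
  have h4 : 0 < (n : ℝ) - 6 := by linarith
  have h5 : 0 < (n : ℝ) ^ 2 - 4 := by linarith
  have h6 : 0 < (n : ℝ) ^ 2 - 16 := by linarith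
  positivity

theorem triLaplacian_shiftedKernel {e : ℝ} (he : 0 < e) (x y : Pt n) :
    triLaplacian (shiftedKernel e x) y =
      -(kernelConst n * e ^ 3 * regPow n e (-(((n : ℝ) + 6) / 2)) (y - x)) := by
  have h := triLaplacian_comp_affine (regPow n e (-decayExp n)) 1 (-x) y
  simp only [one_smul, ← sub_eq_add_neg, one_pow, one_mul] at h
  refine h.trans ((triLaplacian_regPow he (y - x)).trans ?_)
  simp only [kernelConst]

theorem exists_bound_cutoff_far {e : ℝ} (he : 0 < e) (x : Pt n) (hn : 7 ≤ n) :
    ∃ C, ∀ R, 1 ≤ R → ∀ y ∈ annulus n R,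
      |triLaplacian (fun y => shiftedKernel e x y * cutoff n (R⁻¹ • y)) y| ≤ C * (R ^ n)⁻¹ := by
  set F : ℝ × Pt n → ℝ := fun p =>
    (‖p.2 - p.1 • x‖ ^ 2 + p.1 ^ 2 * e) ^ (-decayExp n) * cutoff n p.2 with hF
  set U : Set (ℝ × Pt n) := {p | 0 < ‖p.2 - p.1 • x‖ ^ 2 + p.1 ^ 2 * e} with hU
  have hUo : IsOpen U := isOpen_lt continuous_const (by fun_prop)
  have hsm : ContDiff ℝ ∞ fun p : ℝ × Pt n => ‖p.2 - p.1 • x‖ ^ 2 + p.1 ^ 2 * e :=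
    ((contDiff_norm_sq ℝ).comp (contDiff_snd.sub (contDiff_fst.smul contDiff_const))).add
      ((contDiff_fst.pow 2).mul contDiff_const)
  have hFs : ContDiffOn ℝ ∞ F U :=
    (hsm.contDiffOn.rpow_const_of_ne fun p (hp : 0 < _) => hp.ne').mul
      (contDiff_cutoff.comp contDiff_snd).contDiffOn
  have hK : IsCompact (Set.Icc (0 : ℝ) 1 ×ˢ annulus n 1) := isCompact_Icc.prod (isCompact_annulus 1)
  have hKU : Set.Icc (0 : ℝ) 1 ×ˢ annulus n 1 ⊆ U := by
    rintro ⟨σ, z⟩ ⟨hσ, hz⟩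
    simp only [hU, Set.mem_ofPred_eq]
    rcases eq_or_ne σ 0 with h | h
    · subst h
      have : 1 ≤ ‖z‖ := hz.1
      simp only [zero_smul, sub_zero]
      positivity
    · have : 0 < σ ^ 2 * e := by positivity
      positivity
  obtain ⟨C, hC⟩ := exists_bound_triLaplacian_slice hUo hFs hK hKU
  refine ⟨C, fun R hR y hy => ?_⟩
  have hR0 : 0 < R := by linarith
  have h1 : (fun y => shiftedKernel e x y * cutoff n (R⁻¹ • y)) =
      fun y => (R ^ (n - 6))⁻¹ * F (R⁻¹, R⁻¹ • y) := by
    funext y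
    have h2 : ‖y - x‖ ^ 2 + e = R ^ 2 * (‖R⁻¹ • y - R⁻¹ • x‖ ^ 2 + R⁻¹ ^ 2 * e) := by
      rw [← smul_sub, norm_smul, norm_inv, Real.norm_of_nonneg hR0.le]
      field_simp
    simp only [hF, shiftedKernel, regPow]
    rw [h2, mul_rpow (by positivity) (by positivity), rpow_sub_six hn hR0, ← rpow_natCast R 2,
      ← rpow_mul hR0.le]
    push_cast
    ring_nf
  have h3 := hC (R⁻¹, R⁻¹ • y) ⟨⟨by positivity, inv_le_one_of_one_le₀ hR⟩,
    inv_smul_mem_annulus hR0 hy⟩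
  simp only at h3
  rw [h1, triLaplacian_const_mul (fun y => F (R⁻¹, R⁻¹ • y)),
    triLaplacian_comp_smul (fun z => F (R⁻¹, z)), ← mul_assoc, abs_mul, mul_comm]
  refine mul_le_mul h3 (le_of_eq ?_) (abs_nonneg _) ((abs_nonneg _).trans h3)
  rw [abs_of_pos (by positivity), inv_pow, ← mul_inv, ← pow_add]
  congr 2
  omega

theorem exists_bound_cutoff_near {e : ℝ} (he : 0 < e) (x : Pt n) :
    ∃ C, ∀ R, 0 < R → R ≤ 1 → ∀ y ∈ annulus n R,
      |triLaplacian (fun y => shiftedKernel e x y * (1 - cutoff n (R⁻¹ • y))) y|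
        ≤ C * (R ^ 6)⁻¹ := by
  set F : ℝ × Pt n → ℝ := fun p =>
    shiftedKernel e x (p.1 • p.2) * (1 - cutoff n p.2) with hF
  have hFs : ContDiff ℝ ∞ F :=
    ((contDiff_shiftedKernel he x).comp (contDiff_fst.smul contDiff_snd)).mul
      (contDiff_const.sub (contDiff_cutoff.comp contDiff_snd))
  have hK : IsCompact (Set.Icc (0 : ℝ) 1 ×ˢ annulus n 1) := isCompact_Icc.prod (isCompact_annulus 1)
  obtain ⟨C, hC⟩ := exists_bound_triLaplacian_slice isOpen_univ hFs.contDiffOn hK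
    (Set.subset_univ _)
  refine ⟨C, fun R hR0 hR y hy => ?_⟩
  have h1 : (fun y => shiftedKernel e x y * (1 - cutoff n (R⁻¹ • y))) =
      fun y => F (R, R⁻¹ • y) := by
    funext y
    simp only [hF]
    rw [smul_inv_smul₀ hR0.ne']
  have h3 := hC (R, R⁻¹ • y) ⟨⟨hR0.le, hR⟩, inv_smul_mem_annulus hR0 hy⟩
  simp only at h3
  rw [h1, triLaplacian_comp_smul (fun z => F (R, z)), abs_mul, mul_comm, inv_pow,
    abs_of_pos (show 0 < (R ^ 6)⁻¹ by positivity)]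
  exact mul_le_mul_of_nonneg_right h3 (by positivity)

/-- The regularised kernel cut off near the origin and near infinity. -/
def cutKernel (e : ℝ) (x : Pt n) (R : ℝ) (y : Pt n) : ℝ :=
  shiftedKernel e x y * (cutoff n (R⁻¹ • y) - cutoff n (R • y))

theorem contDiff_cutKernel {e : ℝ} (he : 0 < e) (x : Pt n) (R : ℝ) :
    ContDiff ℝ ∞ (cutKernel e x R) :=
  (contDiff_shiftedKernel he x).mul ((contDiff_cutoff.comp (contDiff_const_smul _)).sub
    (contDiff_cutoff.comp (contDiff_const_smul _)))

theorem cutoff_smul_eq_one {c : ℝ} (hc : 0 < c) {y : Pt n} (hy : c * ‖y‖ ≤ 1) :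
    cutoff n (c • y) = 1 :=
  cutoff_eq_one (by rwa [norm_smul, Real.norm_of_nonneg hc.le])

theorem cutoff_smul_eq_zero {c : ℝ} (hc : 0 < c) {y : Pt n} (hy : 2 ≤ c * ‖y‖) :
    cutoff n (c • y) = 0 :=
  cutoff_eq_zero (by rwa [norm_smul, Real.norm_of_nonneg hc.le])

theorem cutKernel_of_lt {e : ℝ} (x : Pt n) {R : ℝ} (hR : 0 < R) {y : Pt n} (hy : ‖y‖ < R) :
    cutKernel e x R y = shiftedKernel e x y * (1 - cutoff n (R • y)) := by
  rw [cutKernel, cutoff_smul_eq_one (c := R⁻¹) (by positivity)]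
  rw [← div_eq_inv_mul, div_le_one hR]
  exact hy.le

theorem cutKernel_of_gt {e : ℝ} (x : Pt n) {R : ℝ} (hR : 0 < R) {y : Pt n} (hy : 2 < R * ‖y‖) :
    cutKernel e x R y = shiftedKernel e x y * cutoff n (R⁻¹ • y) := by
  rw [cutKernel, cutoff_smul_eq_zero (c := R) hR hy.le, sub_zero]

theorem cutKernel_mid {e : ℝ} (x : Pt n) {R : ℝ} (hR : 0 < R) {y : Pt n} (h1 : 2 < R * ‖y‖)
    (h2 : ‖y‖ < R) : cutKernel e x R y = shiftedKernel e x y := by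
  rw [cutKernel_of_lt x hR h2, cutoff_smul_eq_zero (c := R) hR h1.le, sub_zero, mul_one]

theorem cutKernel_inner {e : ℝ} (x : Pt n) {R : ℝ} (hR : 1 ≤ R) {y : Pt n} (h1 : R * ‖y‖ < 1) :
    cutKernel e x R y = 0 := by
  have hR0 : 0 < R := by linarith
  have : ‖y‖ < R := by nlinarith [norm_nonneg y]
  rw [cutKernel_of_lt x hR0 this, cutoff_smul_eq_one hR0 h1.le, sub_self, mul_zero]

theorem cutKernel_outer {e : ℝ} (x : Pt n) {R : ℝ} (hR : 2 ≤ R) {y : Pt n} (h1 : 2 * R < ‖y‖) :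
    cutKernel e x R y = 0 := by
  have hR0 : 0 < R := by linarith
  have : 2 < R * ‖y‖ := by nlinarith
  rw [cutKernel_of_gt x hR0 this, cutoff_smul_eq_zero (by positivity), mul_zero]
  rw [← div_eq_inv_mul, le_div_iff₀ hR0]
  exact h1.le

theorem abs_cutKernel_le {e : ℝ} (he : 0 < e) (x : Pt n) (R : ℝ) (y : Pt n) :
    |cutKernel e x R y| ≤ shiftedKernel e x y := by
  rw [cutKernel, abs_mul, abs_of_pos (shiftedKernel_pos he x y)]
  refine mul_le_of_le_one_right (shiftedKernel_pos he x y).le (abs_le.2 ⟨?_, ?_⟩)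
  · linarith [cutoff_nonneg (R⁻¹ • y), cutoff_le_one (R • y)]
  · linarith [cutoff_le_one (R⁻¹ • y), cutoff_nonneg (R • y)]

theorem exists_bound_triLaplacian_cutKernel {e : ℝ} (he : 0 < e) (x : Pt n) (hn : 7 ≤ n) :
    ∃ C, 0 ≤ C ∧ ∀ R, 3 ≤ R → ∀ y, y ≠ 0 →
      |triLaplacian (cutKernel e x R) y| ≤ C * ((‖y‖ ^ 6)⁻¹ * farWeight n y) := by
  obtain ⟨C1, h1⟩ := exists_bound_cutoff_far he x hn
  obtain ⟨C2, h2⟩ := exists_bound_cutoff_near he x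
  obtain ⟨C3, hC3, h3⟩ := exists_regPow_le he x (n + 6)
  have hk := kernelConst_pos hn
  have hw : ∀ y : Pt n, y ≠ 0 → 0 < (‖y‖ ^ 6)⁻¹ * farWeight n y := fun y hy => by
    have := norm_pos_iff.2 hy
    have := farWeight_pos y
    positivity
  refine ⟨|C1| * 3 ^ n + |C2| * 3 ^ n + kernelConst n * e ^ 3 * C3, by positivity,
    fun R hR y hy => ?_⟩
  have hR0 : 0 < R := by linarith
  have hyp := norm_pos_iff.2 hy
  have hwy := hw y hy
  have hzero : cutKernel e x R =ᶠ[𝓝 y] (fun _ => 0) → triLaplacian (cutKernel e x R) y = 0 :=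
    fun h => by
      rw [triLaplacian_congr h]
      simp only [triLaplacian, laplacian_const]
  have hnn : 0 ≤ (|C1| * 3 ^ n + |C2| * 3 ^ n + kernelConst n * e ^ 3 * C3)
      * ((‖y‖ ^ 6)⁻¹ * farWeight n y) := by positivity
  have hRn : IsOpen {z : Pt n | ‖z‖ < R} := isOpen_lt continuous_norm continuous_const
  have hR2 : IsOpen {z : Pt n | 2 < R * ‖z‖} := isOpen_lt continuous_const (by fun_prop)
  rcases lt_or_ge (R * ‖y‖) 1 with c1 | c1
  · rw [hzero, abs_zero]
    · exact hnn
    · have ho : IsOpen {z : Pt n | R * ‖z‖ < 1} := isOpen_lt (by fun_prop) continuous_const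
      filter_upwards [ho.mem_nhds c1] with z hz
      exact cutKernel_inner x (by linarith) hz
  rcases lt_or_ge (2 * R) ‖y‖ with c2 | c2
  · rw [hzero, abs_zero]
    · exact hnn
    · have ho : IsOpen {z : Pt n | 2 * R < ‖z‖} := isOpen_lt continuous_const continuous_norm
      filter_upwards [ho.mem_nhds c2] with z hz
      exact cutKernel_outer x (by linarith) hz
  rcases le_or_gt (R * ‖y‖) 2 with c3 | c3
  · have hyR : ‖y‖ < R := by nlinarith
    have hev : cutKernel e x R =ᶠ[𝓝 y]
        fun y => shiftedKernel e x y * (1 - cutoff n ((R⁻¹)⁻¹ • y)) := by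
      filter_upwards [hRn.mem_nhds hyR] with z hz
      rw [inv_inv]
      exact cutKernel_of_lt x hR0 hz
    have hya : y ∈ annulus n R⁻¹ := by
      constructor
      · rw [inv_eq_one_div, div_le_iff₀ hR0]
        linarith
      · rw [← div_eq_mul_inv, le_div_iff₀ hR0]
        linarith
    rw [triLaplacian_congr hev]
    have h4 := h2 R⁻¹ (by positivity) (inv_le_one_of_one_le₀ (by linarith)) y hya
    rw [show ((R⁻¹) ^ 6)⁻¹ = R ^ 6 by rw [inv_pow, inv_inv]] at h4
    have hy1 : ‖y‖ ≤ 1 := by nlinarith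
    have h5 : R ^ 6 ≤ 3 ^ n * ((‖y‖ ^ 6)⁻¹ * farWeight n y) := by
      unfold farWeight
      rw [← mul_inv, ← div_eq_mul_inv, le_div_iff₀ (by positivity)]
      calc R ^ 6 * (‖y‖ ^ 6 * (1 + ‖y‖) ^ (n - 6)) = (R * ‖y‖) ^ 6 * (1 + ‖y‖) ^ (n - 6) := by ring
        _ ≤ 3 ^ 6 * 3 ^ (n - 6) := by
          gcongr
          · linarith
          · linarith
        _ = 3 ^ n := by
          rw [← pow_add]
          congr 1
          omega
    have h6 : C2 * R ^ 6 ≤ |C2| * R ^ 6 := mul_le_mul_of_nonneg_right (le_abs_self _) (by positivity)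
    have h7 := mul_le_mul_of_nonneg_left h5 (abs_nonneg C2)
    have h8 : 0 ≤ (|C1| * 3 ^ n + kernelConst n * e ^ 3 * C3)
      * ((‖y‖ ^ 6)⁻¹ * farWeight n y) := by positivity
    linarith
  rcases lt_or_ge ‖y‖ R with c4 | c4
  · have hev : cutKernel e x R =ᶠ[𝓝 y] shiftedKernel e x := by
      filter_upwards [hRn.mem_nhds c4, hR2.mem_nhds c3] with z hz hz'
      exact cutKernel_mid x hR0 hz' hz
    rw [triLaplacian_congr hev, triLaplacian_shiftedKernel he, abs_neg,
      abs_of_nonneg (mul_nonneg (by positivity) (regPow_pos he _ _).le)]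
    have h4 := h3 y
    push_cast at h4
    have h5 := mul_le_mul_of_nonneg_left (inv_pow_add_six_le hn hy) hC3
    have h6 := mul_le_mul_of_nonneg_left (h4.trans h5) (show 0 ≤ kernelConst n * e ^ 3 by positivity)
    have h8 : 0 ≤ (|C1| * 3 ^ n + |C2| * 3 ^ n)
      * ((‖y‖ ^ 6)⁻¹ * farWeight n y) := by positivity
    linarith
  · have hev : cutKernel e x R =ᶠ[𝓝 y]
        fun y => shiftedKernel e x y * cutoff n (R⁻¹ • y) := by
      filter_upwards [hR2.mem_nhds c3] with z hz
      exact cutKernel_of_gt x hR0 hz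
    rw [triLaplacian_congr hev]
    have h4 := h1 R (by linarith) y ⟨c4, c2⟩
    have h5 : (R ^ n)⁻¹ ≤ 3 ^ n * ((‖y‖ ^ 6)⁻¹ * farWeight n y) := by
      unfold farWeight
      rw [← mul_inv, ← div_eq_mul_inv, inv_eq_one_div, div_le_div_iff₀ (by positivity)
        (by positivity), one_mul, ← mul_pow]
      calc ‖y‖ ^ 6 * (1 + ‖y‖) ^ (n - 6) ≤ (3 * R) ^ 6 * (3 * R) ^ (n - 6) := by
            gcongr
            · linarith
            · linarith
        _ = (3 * R) ^ n := by
          rw [← pow_add]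
          congr 1
          omega
    have h6 : C1 * (R ^ n)⁻¹ ≤ |C1| * (R ^ n)⁻¹ :=
      mul_le_mul_of_nonneg_right (le_abs_self _) (by positivity)
    have h7 := mul_le_mul_of_nonneg_left h5 (abs_nonneg C1)
    have h8 : 0 ≤ (|C2| * 3 ^ n + kernelConst n * e ^ 3 * C3)
      * ((‖y‖ ^ 6)⁻¹ * farWeight n y) := by positivity
    linarith

/-- The equation tested against the translated regularised kernel. -/
theorem IsPositiveSolution.integral_shiftedKernel {u : Pt n → ℝ} (hu : IsPositiveSolution u)
    {e : ℝ} (he : 0 < e) (x : Pt n) :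
    (Integrable fun y => u y ^ critExp n * shiftedKernel e x y) ∧
    (Integrable fun y => u y * regPow n e (-(((n : ℝ) + 6) / 2)) (y - x)) ∧
    cN n * ∫ y, u y ^ critExp n * shiftedKernel e x y =
      kernelConst n * e ^ 3 * ∫ y, u y * regPow n e (-(((n : ℝ) + 6) / 2)) (y - x) := by
  have hn := hu.le_dim
  have : Nonempty (Fin n) := ⟨⟨0, by omega⟩⟩
  obtain ⟨C1, hC1, h1⟩ := exists_bound_triLaplacian_cutKernel he x hn
  obtain ⟨C2, hC2, h2⟩ := exists_regPow_le_farWeight hn he x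
  have hne : ∀ᵐ y : Pt n, y ≠ 0 := by
    rw [ae_iff]
    simp
  have hu0 : ∀ᵐ y : Pt n, 0 < u y := hne.mono fun y hy => hu.pos y hy
  have hmeas : ∀ {f : Pt n → ℝ}, ContinuousOn f {0}ᶜ → AEStronglyMeasurable f volume := by
    intro f hf
    have h := hf.aestronglyMeasurable (μ := volume) (measurableSet_singleton (0 : Pt n)).compl
    rwa [Measure.restrict_eq_self_of_ae_mem] at h
    exact hne
  have hk3 : ∀ k : ℕ, (3 : ℝ) ≤ k + 3 := fun k => by
    have : (0 : ℝ) ≤ k := k.cast_nonneg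
    linarith
  have hmid : ∀ y : Pt n, y ≠ 0 → ∀ᶠ k : ℕ in atTop, 2 < ((k : ℝ) + 3) * ‖y‖ ∧ ‖y‖ < (k : ℝ) + 3 := by
    intro y hy
    have hyp := norm_pos_iff.2 hy
    have ht : Tendsto (fun k : ℕ => (k : ℝ) + 3) atTop atTop :=
      tendsto_atTop_add_const_right _ _ tendsto_natCast_atTop_atTop
    filter_upwards [ht.eventually_gt_atTop ‖y‖, ht.eventually_gt_atTop (2 / ‖y‖)] with k hk hk'
    rw [div_lt_iff₀ hyp] at hk'
    exact ⟨hk', hk⟩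
  have hL : Tendsto (fun k : ℕ => ∫ y, u y ^ critExp n * cutKernel e x ((k : ℝ) + 3) y) atTop
      (𝓝 (∫ y, u y ^ critExp n * shiftedKernel e x y)) := by
    refine tendsto_integral_of_dominated_convergence
      (fun y => C2 * (u y ^ critExp n * farWeight n y)) (fun k => hmeas ?_)
      (hu.integrable_rpow_mul_farWeight.const_mul C2) (fun k => ?_) ?_
    · exact hu.continuousOn_rpow.mul (contDiff_cutKernel he x _).continuous.continuousOn
    · filter_upwards [hu0] with y hy
      have hyp := rpow_pos_of_pos hy (critExp n)
      rw [norm_mul, Real.norm_of_nonneg hyp.le, mul_left_comm]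
      exact mul_le_mul_of_nonneg_left ((abs_cutKernel_le he x _ y).trans (h2 y)) hyp.le
    · filter_upwards [hne] with y hy
      refine tendsto_const_nhds.congr' ?_
      filter_upwards [hmid y hy] with k hk
      rw [cutKernel_mid x (by linarith [hk3 k]) hk.1 hk.2]
  have hR : Tendsto (fun k : ℕ => ∫ y, u y * triLaplacian (cutKernel e x ((k : ℝ) + 3)) y) atTop
      (𝓝 (∫ y, u y * triLaplacian (shiftedKernel e x) y)) := by
    refine tendsto_integral_of_dominated_convergence
      (fun y => C1 * (u y * ((‖y‖ ^ 6)⁻¹ * farWeight n y))) (fun k => hmeas ?_)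
      (hu.integrable_mul_farWeight.const_mul C1) (fun k => ?_) ?_
    · exact hu.continuousOn.mul
        (contDiff_cutKernel he x _).laplacian.laplacian.laplacian.continuous.continuousOn
    · filter_upwards [hu0, hne] with y hy hy0
      rw [norm_mul, Real.norm_of_nonneg hy.le, mul_left_comm]
      exact mul_le_mul_of_nonneg_left (h1 _ (hk3 k) y hy0) hy.le
    · filter_upwards [hne] with y hy
      refine tendsto_const_nhds.congr' ?_
      filter_upwards [hmid y hy] with k hk
      have hRn : IsOpen {z : Pt n | ‖z‖ < (k : ℝ) + 3} := isOpen_lt continuous_norm continuous_const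
      have hR2 : IsOpen {z : Pt n | 2 < ((k : ℝ) + 3) * ‖z‖} :=
        isOpen_lt continuous_const (by fun_prop)
      congr 1
      refine triLaplacian_congr ?_
      filter_upwards [hRn.mem_nhds hk.2, hR2.mem_nhds hk.1] with z hz hz'
      rw [cutKernel_mid x (by linarith [hk3 k]) hz' hz]
  have hLR : ∀ k : ℕ, ∫ y, u y * triLaplacian (cutKernel e x ((k : ℝ) + 3)) y =
      -(cN n * ∫ y, u y ^ critExp n * cutKernel e x ((k : ℝ) + 3) y) := by
    intro k
    have hk := hk3 k
    refine hu.integral_mul_triLaplacian (contDiff_cutKernel he x _) ?_ ?_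
    · refine HasCompactSupport.intro (isCompact_closedBall (0 : Pt n) (2 * ((k : ℝ) + 3))) fun y hy => ?_
      exact cutKernel_outer x (by linarith) (by simpa using hy)
    · intro y hy h
      rw [Set.mem_singleton_iff] at h
      subst h
      refine notMem_tsupport_iff_eventuallyEq.2 ?_ hy
      have ho : IsOpen {z : Pt n | ((k : ℝ) + 3) * ‖z‖ < 1} := isOpen_lt (by fun_prop) continuous_const
      filter_upwards [ho.mem_nhds (by simp)] with z hz
      exact cutKernel_inner x (by linarith) hz
  have hlim := tendsto_nhds_unique hR (by simpa only [hLR] using (hL.const_mul (cN n)).neg)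
  obtain ⟨C3, hC3, h3⟩ := exists_regPow_le he x (n + 6)
  refine ⟨?_, ?_, ?_⟩
  · refine (hu.integrable_rpow_mul_farWeight.const_mul C2).mono' (hmeas ?_) ?_
    · exact hu.continuousOn_rpow.mul (contDiff_shiftedKernel he x).continuous.continuousOn
    · filter_upwards [hu0] with y hy
      have hyp := rpow_pos_of_pos hy (critExp n)
      rw [norm_mul, Real.norm_of_nonneg hyp.le, mul_left_comm,
        Real.norm_of_nonneg (shiftedKernel_pos he x y).le]
      exact mul_le_mul_of_nonneg_left (h2 y) hyp.le
  · refine (hu.integrable_mul_farWeight.const_mul C3).mono' (hmeas ?_) ?_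
    · exact hu.continuousOn.mul ((contDiff_regPow he _).comp
        (contDiff_id.sub contDiff_const)).continuous.continuousOn
    · filter_upwards [hu0, hne] with y hy hy0
      rw [norm_mul, Real.norm_of_nonneg hy.le, mul_left_comm,
        Real.norm_of_nonneg (regPow_pos he _ _).le]
      have h4 := h3 y
      push_cast at h4
      exact mul_le_mul_of_nonneg_left (h4.trans
        (mul_le_mul_of_nonneg_left (inv_pow_add_six_le hn hy0) hC3)) hy.le
  · have h5 : ∀ y, u y * triLaplacian (shiftedKernel e x) y = -(kernelConst n * e ^ 3 *
        (u y * regPow n e (-(((n : ℝ) + 6) / 2)) (y - x))) := fun y => by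
      rw [triLaplacian_shiftedKernel he]
      ring
    simp only [h5] at hlim
    rw [integral_neg, integral_const_mul] at hlim
    linarith

end TestFunctions

section Representation
variable {n : ℕ}

theorem ae_ne (hn : 0 < n) (x : Pt n) : ∀ᵐ y : Pt n, y ≠ x := by
  have : Nonempty (Fin n) := ⟨⟨0, hn⟩⟩
  rw [ae_iff]
  simp

theorem aestronglyMeasurable_of_continuousOn_compl (hn : 0 < n) {f : Pt n → ℝ} {x : Pt n}
    (hf : ContinuousOn f {x}ᶜ) : AEStronglyMeasurable f volume := by
  have h := hf.aestronglyMeasurable (μ := volume) (measurableSet_singleton x).compl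
  rwa [Measure.restrict_eq_self_of_ae_mem] at h
  exact ae_ne hn x

/-- The profile of the approximate identity. -/
def peak (n : ℕ) : Pt n → ℝ := regPow n 1 (-(((n : ℝ) + 6) / 2))

theorem integrable_peak : Integrable (peak n) := by
  have h := integrable_rpow_neg_one_add_norm_sq (E := Pt n) (μ := volume) (r := (n : ℝ) + 6)
    (by simp)
  refine h.congr (Eventually.of_forall fun y => ?_)
  simp only [peak, regPow]
  rw [add_comm, neg_div]

theorem peak_pos (y : Pt n) : 0 < peak n y := regPow_pos one_pos _ _

theorem integral_peak_pos : 0 < ∫ y, peak n y := by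
  rw [integral_pos_iff_support_of_nonneg (fun y => (peak_pos y).le) integrable_peak]
  have : Function.support (peak n) = Set.univ := by
    ext y
    simp [(peak_pos y).ne']
  rw [this]
  exact Measure.measure_univ_pos.2 (NeZero.ne _)

theorem tendsto_norm_pow_mul_peak :
    Tendsto (fun y : Pt n => ‖y‖ ^ n * peak n y) (Bornology.cobounded _) (𝓝 0) := by
  have h1 : Tendsto (fun y : Pt n => (‖y‖ ^ 6)⁻¹) (Bornology.cobounded _) (𝓝 0) :=
    ((tendsto_pow_atTop (by norm_num)).comp tendsto_norm_cobounded_atTop).inv_tendsto_atTop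
  refine squeeze_zero' (Eventually.of_forall fun y => ?_) ?_ h1
  · exact mul_nonneg (by positivity) (peak_pos y).le
  · filter_upwards [tendsto_norm_cobounded_atTop.eventually_gt_atTop 0] with y hy
    have h2 : peak n y ≤ (‖y‖ ^ (n + 6))⁻¹ := by
      have h3 : (‖y‖ ^ 2) ^ (-(((n : ℝ) + 6) / 2)) = (‖y‖ ^ (n + 6))⁻¹ := by
        rw [← rpow_natCast ‖y‖ 2, ← rpow_mul hy.le, ← rpow_natCast ‖y‖ (n + 6), ← rpow_neg hy.le]
        congr 1
        push_cast
        ring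
      rw [← h3]
      refine rpow_le_rpow_of_nonpos (by positivity) (by linarith) ?_
      have : (0 : ℝ) ≤ n := n.cast_nonneg
      linarith
    calc ‖y‖ ^ n * peak n y ≤ ‖y‖ ^ n * (‖y‖ ^ (n + 6))⁻¹ := by gcongr
      _ = (‖y‖ ^ 6)⁻¹ := by
        rw [pow_add]
        field_simp

theorem pow_mul_peak_smul {c : ℝ} (hc : 0 < c) (z : Pt n) :
    c ^ n * peak n (c • z) = (c⁻¹ ^ 2) ^ 3 * regPow n (c⁻¹ ^ 2) (-(((n : ℝ) + 6) / 2)) z := by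
  have h1 : ‖c • z‖ ^ 2 + 1 = c ^ 2 * (‖z‖ ^ 2 + c⁻¹ ^ 2) := by
    rw [norm_smul, Real.norm_of_nonneg hc.le]
    field_simp
  have h2 : (c ^ 2) ^ (-(((n : ℝ) + 6) / 2)) = (c ^ (n + 6))⁻¹ := by
    rw [← rpow_natCast c 2, ← rpow_mul hc.le, ← rpow_natCast c (n + 6), ← rpow_neg hc.le]
    congr 1
    push_cast
    ring
  simp only [peak, regPow]
  rw [h1, mul_rpow (by positivity) (by positivity), h2, pow_add]
  field_simp

theorem regPow_le_of_le_norm {r e : ℝ} (hr : 0 < r) (he : 0 < e) {z : Pt n} (hz : r ≤ ‖z‖) {α : ℝ}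
    (hα : 0 ≤ α) : regPow n e (-α) z ≤ (1 + (r ^ 2)⁻¹) ^ α * regPow n 1 (-α) z := by
  have hA : 0 < 1 + (r ^ 2)⁻¹ := by positivity
  have hz0 : 0 < ‖z‖ := hr.trans_le hz
  have h1 : (1 + (r ^ 2)⁻¹)⁻¹ * (‖z‖ ^ 2 + 1) ≤ ‖z‖ ^ 2 + e := by
    rw [inv_mul_le_iff₀ hA]
    have h2 : r ^ 2 ≤ ‖z‖ ^ 2 := by gcongr
    have h3 : 1 ≤ (r ^ 2)⁻¹ * ‖z‖ ^ 2 := by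
      rw [← div_eq_inv_mul, one_le_div (by positivity)]
      exact h2
    have h4 : 0 ≤ (1 + (r ^ 2)⁻¹) * e := by positivity
    linarith
  have h5 := rpow_le_rpow_of_nonpos (z := -α) (by positivity) h1 (by linarith)
  rw [mul_rpow (by positivity) (by positivity), inv_rpow hA.le, ← rpow_neg hA.le, neg_neg] at h5
  exact h5

theorem IsPositiveSolution.tendsto_integral_peak {u : Pt n → ℝ} (hu : IsPositiveSolution u)
    {x : Pt n} (hx : x ≠ 0) :
    Tendsto (fun c : ℝ => ∫ y, u y * (c ^ n * peak n (c • (y - x)))) atTop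
      (𝓝 ((∫ y, peak n y) * u x)) := by
  have hn : 0 < n := by have := hu.le_dim; omega
  set κ := ∫ y, peak n y with hκ
  have hκ0 : 0 < κ := integral_peak_pos
  set r := ‖x‖ / 2 with hr
  have hr0 : 0 < r := by have := norm_pos_iff.2 hx; positivity
  set B := Metric.closedBall x r with hB
  have hBm : MeasurableSet B := Metric.isClosed_closedBall.measurableSet
  have hB0 : B ⊆ {0}ᶜ := by
    intro y hy h0
    rw [Set.mem_singleton_iff] at h0
    subst h0
    rw [hB, Metric.mem_closedBall, dist_zero_left] at hy
    linarith
  set g := B.indicator u with hg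
  have hgi : Integrable g := by
    rw [hg, integrable_indicator_iff hBm]
    exact (hu.continuousOn.mono hB0).integrableOn_compact (isCompact_closedBall x r)
  have hBn : B ∈ 𝓝 x := Metric.closedBall_mem_nhds x hr0
  have hgc : ContinuousAt g x := by
    have h1 : ContinuousAt u x := hu.continuousOn.continuousAt (isOpen_compl_singleton.mem_nhds hx)
    refine h1.congr ?_
    filter_upwards [hBn] with y hy
    rw [hg, Set.indicator_of_mem hy]
  have hgx : g x = u x := Set.indicator_of_mem (mem_of_mem_nhds hBn) u
  have hnear : Tendsto (fun c : ℝ => ∫ y, g y * (c ^ n * peak n (c • (y - x)))) atTop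
      (𝓝 (κ * u x)) := by
    have h1 := tendsto_integral_comp_smul_smul_of_integrable' (μ := (volume : Measure (Pt n)))
      (φ := fun y => κ⁻¹ * peak n y) (fun y => mul_nonneg (by positivity) (peak_pos y).le)
      (by rw [integral_const_mul]; exact inv_mul_cancel₀ hκ0.ne')
      (by
        have := (tendsto_norm_pow_mul_peak (n := n)).const_mul κ⁻¹
        rw [mul_zero] at this
        refine this.congr fun y => ?_
        rw [finrank_euclideanSpace_fin]
        ring) hgi hgc
    have h2 := h1.const_mul κ
    rw [hgx] at h2
    refine h2.congr fun c => ?_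
    rw [← integral_const_mul]
    congr 1
    ext y
    have h3 : peak n (c • (x - y)) = peak n (c • (y - x)) := by
      simp only [peak, regPow, norm_smul, norm_sub_rev]
    rw [finrank_euclideanSpace_fin, h3, smul_eq_mul]
    field_simp
  obtain ⟨-, hint1, -⟩ := hu.integral_shiftedKernel one_pos x
  have hα : (0 : ℝ) ≤ ((n : ℝ) + 6) / 2 := by positivity
  set A := (1 + (r ^ 2)⁻¹) ^ (((n : ℝ) + 6) / 2) with hA
  set J := ∫ y, u y * regPow n 1 (-(((n : ℝ) + 6) / 2)) (y - x) with hJ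
  have hupos : ∀ᵐ y, 0 < u y := (ae_ne hn 0).mono fun y hy => hu.pos y hy
  have hdiff : ∀ c : ℝ, 0 < c → |∫ y, (u y - g y) * (c ^ n * peak n (c • (y - x)))| ≤
      (c⁻¹ ^ 2) ^ 3 * (A * J) := by
    intro c hc
    rw [← integral_const_mul, ← integral_const_mul, ← Real.norm_eq_abs]
    refine norm_integral_le_of_norm_le ((hint1.const_mul _).const_mul _) ?_
    filter_upwards [hupos] with y hy
    have hpk := regPow_pos (n := n) one_pos (-(((n : ℝ) + 6) / 2)) (y - x)
    by_cases hyB : y ∈ B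
    · rw [hg, Set.indicator_of_mem hyB, sub_self, zero_mul, norm_zero]
      positivity
    · rw [hg, Set.indicator_of_notMem hyB, sub_zero, pow_mul_peak_smul hc, norm_mul,
        Real.norm_of_nonneg hy.le, Real.norm_of_nonneg
          (mul_nonneg (by positivity) (regPow_pos (by positivity) _ _).le)]
      have h4 : r ≤ ‖y - x‖ := by
        rw [hB, Metric.mem_closedBall, dist_eq_norm, not_le] at hyB
        exact hyB.le
      have h5 := regPow_le_of_le_norm hr0 (show 0 < c⁻¹ ^ 2 by positivity) h4 hα
      calc u y * ((c⁻¹ ^ 2) ^ 3 * regPow n (c⁻¹ ^ 2) (-(((n : ℝ) + 6) / 2)) (y - x))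
          ≤ u y * ((c⁻¹ ^ 2) ^ 3 * (A * regPow n 1 (-(((n : ℝ) + 6) / 2)) (y - x))) := by gcongr
        _ = _ := by ring
  have hfar : Tendsto (fun c : ℝ => ∫ y, (u y - g y) * (c ^ n * peak n (c • (y - x)))) atTop
      (𝓝 0) := by
    have h6 : Tendsto (fun c : ℝ => (c⁻¹ ^ 2) ^ 3 * (A * J)) atTop (𝓝 0) := by
      have := ((tendsto_inv_atTop_zero (𝕜 := ℝ)).pow 2).pow 3 |>.mul_const (A * J)
      simpa using this
    rw [tendsto_zero_iff_abs_tendsto_zero]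
    refine squeeze_zero' (Eventually.of_forall fun c => abs_nonneg _) ?_ h6
    filter_upwards [eventually_gt_atTop 0] with c hc using hdiff c hc
  have hsum := hnear.add hfar
  rw [add_zero] at hsum
  refine hsum.congr' ?_
  filter_upwards [eventually_gt_atTop 0] with c hc
  have hint2 : Integrable fun y => u y * (c ^ n * peak n (c • (y - x))) := by
    refine ((hu.integral_shiftedKernel (show 0 < c⁻¹ ^ 2 by positivity) x).2.1.const_mul
      ((c⁻¹ ^ 2) ^ 3)).congr (Eventually.of_forall fun y => ?_)
    simp only [pow_mul_peak_smul hc]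
    ring
  have hint3 : Integrable fun y => g y * (c ^ n * peak n (c • (y - x))) := by
    have : (fun y => g y * (c ^ n * peak n (c • (y - x)))) =
        B.indicator fun y => u y * (c ^ n * peak n (c • (y - x))) := by
      ext y
      by_cases hyB : y ∈ B
      · simp [hg, hyB]
      · simp [hg, hyB]
    rw [this]
    exact hint2.indicator hBm
  rw [← integral_add hint3]
  · congr 1
    ext y
    ring
  · refine (hint2.sub hint3).congr (Eventually.of_forall fun y => ?_)
    simp only [Pi.sub_apply]
    ring

theorem tendsto_shiftedKernel (hn : 7 ≤ n) {x y : Pt n} (hxy : y ≠ x) :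
    Tendsto (fun k : ℕ => shiftedKernel (((k : ℝ) + 1)⁻¹ ^ 2) x y) atTop
      (𝓝 (‖y - x‖ ^ (n - 6))⁻¹) := by
  have hp : 0 < ‖y - x‖ := norm_pos_iff.2 (sub_ne_zero.2 hxy)
  have h1 : Tendsto (fun k : ℕ => ((k : ℝ) + 1)⁻¹ ^ 2) atTop (𝓝 0) := by
    have := (tendsto_inv_atTop_zero.comp (tendsto_atTop_add_const_right atTop (1 : ℝ)
      tendsto_natCast_atTop_atTop)).pow 2
    simpa using this
  have h2 := (h1.const_add (‖y - x‖ ^ 2)).rpow_const (p := -decayExp n)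
    (Or.inl (by rw [add_zero]; positivity))
  have h3 : (‖y - x‖ ^ 2 + 0) ^ (-decayExp n) = (‖y - x‖ ^ (n - 6))⁻¹ := by
    rw [rpow_sub_six hn hp, add_zero, ← rpow_natCast ‖y - x‖ 2, ← rpow_mul hp.le]
    congr 1
    push_cast
    ring
  rw [h3] at h2
  exact h2

theorem monotone_shiftedKernel (hn : 7 ≤ n) (x y : Pt n) :
    Monotone fun k : ℕ => shiftedKernel (((k : ℝ) + 1)⁻¹ ^ 2) x y := by
  intro i j hij
  refine rpow_le_rpow_of_nonpos (by positivity) ?_ (by linarith [decayExp_pos hn])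
  gcongr

/-- A positive solution is a constant multiple of the Riesz potential of its nonlinearity. -/
theorem IsPositiveSolution.exists_representation {u : Pt n → ℝ} (hu : IsPositiveSolution u) :
    ∃ C : ℝ, 0 < C ∧ ∀ x, x ≠ 0 →
      (Integrable fun y => u y ^ critExp n * (‖y - x‖ ^ (n - 6))⁻¹) ∧
      u x = C * ∫ y, u y ^ critExp n * (‖y - x‖ ^ (n - 6))⁻¹ := by
  have hn := hu.le_dim
  have hn0 : 0 < n := by omega
  have hc := cN_pos hn
  have hK := kernelConst_pos hn
  have hκ := integral_peak_pos (n := n)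
  refine ⟨cN n / (kernelConst n * ∫ y, peak n y), by positivity, fun x hx => ?_⟩
  have hk0 : ∀ k : ℕ, 0 < ((k : ℝ) + 1)⁻¹ ^ 2 := fun k => by positivity
  have hupos : ∀ᵐ y, 0 < u y ^ critExp n :=
    (ae_ne hn0 0).mono fun y hy => rpow_pos_of_pos (hu.pos y hy) _
  have hlim : Tendsto (fun k : ℕ => ∫ y, u y ^ critExp n * shiftedKernel (((k : ℝ) + 1)⁻¹ ^ 2) x y)
      atTop (𝓝 (kernelConst n * ((∫ y, peak n y) * u x) / cN n)) := by
    have ht : Tendsto (fun k : ℕ => (k : ℝ) + 1) atTop atTop :=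
      tendsto_atTop_add_const_right _ _ tendsto_natCast_atTop_atTop
    have h1 := (((hu.tendsto_integral_peak hx).comp ht).const_mul (kernelConst n)).div_const (cN n)
    refine h1.congr fun k => ?_
    have h2 := (hu.integral_shiftedKernel (hk0 k) x).2.2
    have h3 : ∀ y, u y * (((k : ℝ) + 1) ^ n * peak n (((k : ℝ) + 1) • (y - x))) =
        (((k : ℝ) + 1)⁻¹ ^ 2) ^ 3 *
          (u y * regPow n (((k : ℝ) + 1)⁻¹ ^ 2) (-(((n : ℝ) + 6) / 2)) (y - x)) := fun y => by
      rw [pow_mul_peak_smul (show 0 < (k : ℝ) + 1 by positivity)]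
      ring
    simp only [Function.comp_apply, h3]
    rw [div_eq_iff hc.ne', integral_const_mul]
    linarith
  have hnn : ∀ k : ℕ, 0 ≤ᵐ[volume] fun y =>
      u y ^ critExp n * shiftedKernel (((k : ℝ) + 1)⁻¹ ^ 2) x y := fun k =>
    hupos.mono fun y hy => (mul_pos hy (shiftedKernel_pos (hk0 k) x y)).le
  have hmeas : AEStronglyMeasurable (fun y => u y ^ critExp n * (‖y - x‖ ^ (n - 6))⁻¹) volume := by
    refine (aestronglyMeasurable_of_continuousOn_compl hn0 hu.continuousOn_rpow).mul
      (aestronglyMeasurable_of_continuousOn_compl hn0 (x := x) ?_)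
    exact ContinuousOn.inv₀ (by fun_prop) fun y hy => pow_ne_zero _
      (norm_ne_zero_iff.2 (sub_ne_zero.2 hy))
  have hnn' : 0 ≤ᵐ[volume] fun y => u y ^ critExp n * (‖y - x‖ ^ (n - 6))⁻¹ :=
    hupos.mono fun y hy => mul_nonneg hy.le (by positivity)
  have hlint := lintegral_tendsto_of_tendsto_of_monotone (μ := (volume : Measure (Pt n)))
    (f := fun k y => ENNReal.ofReal (u y ^ critExp n * shiftedKernel (((k : ℝ) + 1)⁻¹ ^ 2) x y))
    (F := fun y => ENNReal.ofReal (u y ^ critExp n * (‖y - x‖ ^ (n - 6))⁻¹))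
    (fun k => (hu.integral_shiftedKernel (hk0 k) x).1.aestronglyMeasurable.aemeasurable.ennreal_ofReal)
    (by
      filter_upwards [hupos] with y hy i j hij
      exact ENNReal.ofReal_le_ofReal
        (mul_le_mul_of_nonneg_left (monotone_shiftedKernel hn x y hij) hy.le))
    (by
      filter_upwards [ae_ne hn0 x] with y hy
      exact (ENNReal.continuous_ofReal.tendsto _).comp ((tendsto_shiftedKernel hn hy).const_mul _))
  have heq := tendsto_nhds_unique hlint (((ENNReal.continuous_ofReal.tendsto _).comp hlim).congr
    fun k => ofReal_integral_eq_lintegral_ofReal (hu.integral_shiftedKernel (hk0 k) x).1 (hnn k))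
  have hint : Integrable fun y => u y ^ critExp n * (‖y - x‖ ^ (n - 6))⁻¹ := by
    refine ⟨hmeas, ?_⟩
    rw [hasFiniteIntegral_iff_ofReal hnn', heq]
    exact ENNReal.ofReal_lt_top
  refine ⟨hint, ?_⟩
  have hux := hu.pos x hx
  rw [integral_eq_lintegral_of_nonneg_ae hnn' hmeas, heq,
    ENNReal.toReal_ofReal (by positivity)]
  field_simp

end Representation

section KelvinTransform
variable {n : ℕ}

open EuclideanGeometry

theorem abs_det_fderiv_inversion (c x : Pt n) (R : ℝ) :
    |(((R / dist x c) ^ 2 • ((ℝ ∙ (x - c))ᗮ.reflection : Pt n →L[ℝ] Pt n)) : Pt n →L[ℝ] Pt n).det| =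
      (R / dist x c) ^ (2 * n) := by
  have h : (((R / dist x c) ^ 2 • ((ℝ ∙ (x - c))ᗮ.reflection : Pt n →L[ℝ] Pt n)) :
      Pt n →L[ℝ] Pt n).det =
      ((R / dist x c) ^ 2) ^ n * LinearMap.det (ℝ ∙ (x - c))ᗮ.reflection.toLinearMap := by
    have := LinearMap.det_smul ((R / dist x c) ^ 2) (ℝ ∙ (x - c))ᗮ.reflection.toLinearMap
    rw [finrank_euclideanSpace_fin] at this
    exact this
  rw [h, Submodule.det_reflection, abs_mul, abs_pow (-1), abs_neg, abs_one, one_pow, mul_one,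
    ← pow_mul, abs_of_nonneg]
  rw [pow_mul]
  positivity

theorem inversion_image_ball {c : Pt n} {R : ℝ} (hR : 0 < R) :
    inversion c R '' (Metric.ball c R \ {c}) = (Metric.closedBall c R)ᶜ := by
  ext y
  constructor
  · rintro ⟨x, ⟨hx, hxc⟩, rfl⟩
    rw [Metric.mem_ball] at hx
    have h0 : 0 < dist x c := dist_pos.2 hxc
    rw [Set.mem_compl_iff, Metric.mem_closedBall, dist_inversion_center, not_le, lt_div_iff₀ h0]
    nlinarith
  · intro hy
    rw [Set.mem_compl_iff, Metric.mem_closedBall, not_le] at hy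
    refine ⟨inversion c R y, ⟨?_, ?_⟩, inversion_inversion c hR.ne' y⟩
    · rw [Metric.mem_ball, dist_inversion_center, div_lt_iff₀ (hR.trans hy)]
      nlinarith
    · rw [Set.mem_singleton_iff, inversion_eq_center hR.ne']
      rintro rfl
      rw [dist_self] at hy
      linarith

/-- Integrals over the whole space, folded into a ball by inversion. -/
theorem integral_eq_add_inversion (hn : 0 < n) {c : Pt n} {R : ℝ} (hR : 0 < R) {g : Pt n → ℝ}
    (hg : Integrable g) :
    IntegrableOn (fun w => (R / dist w c) ^ (2 * n) * g (inversion c R w)) (Metric.ball c R) ∧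
    ∫ y, g y = (∫ w in Metric.ball c R, g w) +
      ∫ w in Metric.ball c R, (R / dist w c) ^ (2 * n) * g (inversion c R w) := by
  have : Nonempty (Fin n) := ⟨⟨0, hn⟩⟩
  have hs : MeasurableSet (Metric.ball c R \ {c}) :=
    Metric.isOpen_ball.measurableSet.diff (measurableSet_singleton c)
  have hd : ∀ x ∈ Metric.ball c R \ {c}, HasFDerivWithinAt (inversion c R)
      ((R / dist x c) ^ 2 • ((ℝ ∙ (x - c))ᗮ.reflection : Pt n →L[ℝ] Pt n))
      (Metric.ball c R \ {c}) x := fun x hx => (hasFDerivAt_inversion hx.2).hasFDerivWithinAt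
  have hi : Set.InjOn (inversion c R) (Metric.ball c R \ {c}) :=
    (inversion_injective c hR.ne').injOn
  have h1 := integral_image_eq_integral_abs_det_fderiv_smul volume hs hd hi g
  have h2 := integrableOn_image_iff_integrableOn_abs_det_fderiv_smul volume hs hd hi g
  simp only [abs_det_fderiv_inversion, smul_eq_mul, inversion_image_ball hR] at h1 h2
  have hae : (Metric.ball c R \ {c} : Set (Pt n)) =ᵐ[volume] Metric.ball c R :=
    sdiff_null_ae_eq_self (by simp)
  have hcb : ((Metric.closedBall c R)ᶜ : Set (Pt n)) =ᵐ[volume] (Metric.ball c R)ᶜ := by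
    refine Filter.EventuallyEq.compl ?_
    refine (ae_eq_of_subset_of_measure_ge Metric.ball_subset_closedBall ?_
      Metric.isOpen_ball.measurableSet.nullMeasurableSet measure_closedBall_lt_top.ne).symm
    rw [Measure.addHaar_closedBall_eq_addHaar_ball]
  refine ⟨(h2.1 hg.integrableOn).congr_set_ae hae.symm, ?_⟩
  have h3 : ∫ x in (Metric.closedBall c R)ᶜ, g x = ∫ x in (Metric.ball c R)ᶜ, g x :=
    setIntegral_congr_set hcb
  have h4 := integral_add_compl (Metric.isOpen_ball (x := c) (ε := R)).measurableSet hg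
  rw [← h3, h1, setIntegral_congr_set hae] at h4
  exact h4.symm

/-- The Kelvin transform of `u` with respect to the sphere of centre `c` and radius `R`. -/
def kelvin (c : Pt n) (R : ℝ) (u : Pt n → ℝ) (z : Pt n) : ℝ :=
  (R / dist z c) ^ (n - 6) * u (inversion c R z)

/-- The difference of Riesz kernels appearing in the comparison with the Kelvin transform. -/
def sphereKernel (c : Pt n) (R : ℝ) (z w : Pt n) : ℝ :=
  (dist w z ^ (n - 6))⁻¹ - (R / dist z c) ^ (n - 6) * (dist w (inversion c R z) ^ (n - 6))⁻¹

theorem natCast_sub_six_mul_critExp (hn : 7 ≤ n) :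
    ((n - 6 : ℕ) : ℝ) * critExp n = ((n + 6 : ℕ) : ℝ) := by
  have := one_le_sub_six hn
  rw [Nat.cast_sub (by omega)]
  unfold critExp
  push_cast
  field_simp

theorem IsPositiveSolution.kelvin_rpow {u : Pt n → ℝ} (hu : IsPositiveSolution u) {c w : Pt n}
    {R : ℝ} (hR : 0 < R) (hI : inversion c R w ≠ 0) :
    kelvin c R u w ^ critExp n = (R / dist w c) ^ (n + 6) * u (inversion c R w) ^ critExp n := by
  have h0 : 0 ≤ R / dist w c := by positivity
  unfold kelvin
  rw [mul_rpow (by positivity) (hu.pos _ hI).le, ← rpow_natCast (R / dist w c) (n - 6),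
    ← rpow_mul h0, natCast_sub_six_mul_critExp hu.le_dim, rpow_natCast]

theorem IsPositiveSolution.kelvin_pos {u : Pt n → ℝ} (hu : IsPositiveSolution u) {c z : Pt n}
    {R : ℝ} (hR : 0 < R) (hzc : z ≠ c) (hI : inversion c R z ≠ 0) : 0 < kelvin c R u z := by
  have h1 := hu.pos _ hI
  have h2 := dist_pos.2 hzc
  unfold kelvin
  positivity

/-- Riesz representation of a function by a power of another one. -/
def HasRieszRepresentation (C : ℝ) (u : Pt n → ℝ) : Prop := ∀ x, x ≠ 0 →
  (Integrable fun y => u y ^ critExp n * (dist y x ^ (n - 6))⁻¹) ∧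
    u x = C * ∫ y, u y ^ critExp n * (dist y x ^ (n - 6))⁻¹

theorem IsPositiveSolution.kelvin_sub {u : Pt n → ℝ} (hu : IsPositiveSolution u) {C : ℝ}
    (hC : HasRieszRepresentation C u) {c z : Pt n} {R : ℝ} (hR : 0 < R) (hz : z ≠ 0) (hzc : z ≠ c)
    (hI : inversion c R z ≠ 0) :
    IntegrableOn (fun w => (kelvin c R u w ^ critExp n - u w ^ critExp n) * sphereKernel c R z w)
      (Metric.ball c R) ∧
    kelvin c R u z - u z = C * ∫ w in Metric.ball c R,
      (kelvin c R u w ^ critExp n - u w ^ critExp n) * sphereKernel c R z w := by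
  have hn := hu.le_dim
  have hn0 : 0 < n := by omega
  obtain ⟨hA1, h1⟩ := hC z hz
  obtain ⟨hA2, h2⟩ := hC _ hI
  obtain ⟨hB1, h1'⟩ := integral_eq_add_inversion hn0 (c := c) hR hA1
  obtain ⟨hB2, h2'⟩ := integral_eq_add_inversion hn0 (c := c) hR hA2
  set S := Metric.ball c R with hS
  have hzd : 0 < dist z c := dist_pos.2 hzc
  have hgen : ∀ᵐ w ∂(volume.restrict S), w ≠ c ∧ inversion c R w ≠ 0 := by
    refine ae_restrict_of_ae ?_
    filter_upwards [ae_ne hn0 c, ae_ne hn0 (inversion c R 0)] with w hw hw'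
    refine ⟨hw, fun h => hw' ?_⟩
    rw [← h, inversion_inversion c hR.ne']
  have hpow : ∀ d : ℝ, 0 < d → (R / d) ^ (2 * n) * (d ^ (n - 6)) = (R / d) ^ (n + 6) * R ^ (n - 6) := by
    intro d hd
    rw [show 2 * n = (n + 6) + (n - 6) by omega, pow_add, mul_assoc, ← mul_pow, div_mul_cancel₀ _ hd.ne']
  have e1 : ∀ᵐ w ∂(volume.restrict S), (R / dist w c) ^ (2 * n) *
      (u (inversion c R w) ^ critExp n * (dist (inversion c R w) z ^ (n - 6))⁻¹) =
      kelvin c R u w ^ critExp n * ((R / dist z c) ^ (n - 6) *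
        (dist w (inversion c R z) ^ (n - 6))⁻¹) := by
    filter_upwards [hgen] with w ⟨hw, hw'⟩
    have hwd : 0 < dist w c := dist_pos.2 hw
    have h3 : dist (inversion c R w) z = dist w (inversion c R z) * dist z c / dist w c := by
      rw [eq_div_iff hwd.ne']
      exact dist_inversion_mul_dist_center_eq hw hzc
    have h4 := hpow _ hwd
    have h5 : ((dist w (inversion c R z) * dist z c / dist w c) ^ (n - 6))⁻¹ =
        dist w c ^ (n - 6) * ((dist w (inversion c R z) ^ (n - 6))⁻¹ * (dist z c ^ (n - 6))⁻¹) := by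
      rw [div_pow, mul_pow, inv_div, div_eq_mul_inv, mul_inv]
    rw [hu.kelvin_rpow hR hw', h3, h5, div_pow R (dist z c)]
    calc _ = ((R / dist w c) ^ (2 * n) * dist w c ^ (n - 6)) * (u (inversion c R w) ^ critExp n *
            ((dist w (inversion c R z) ^ (n - 6))⁻¹ * (dist z c ^ (n - 6))⁻¹)) := by ring
      _ = _ := by
        rw [h4]
        ring
  have e2 : ∀ᵐ w ∂(volume.restrict S), (R / dist w c) ^ (2 * n) *
      (u (inversion c R w) ^ critExp n * (dist (inversion c R w) (inversion c R z) ^ (n - 6))⁻¹) *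
        (R / dist z c) ^ (n - 6) = kelvin c R u w ^ critExp n * (dist w z ^ (n - 6))⁻¹ := by
    filter_upwards [hgen] with w ⟨hw, hw'⟩
    have hwd : 0 < dist w c := dist_pos.2 hw
    have h4 := hpow _ hwd
    have hRm : R ^ (n - 6) ≠ 0 := by positivity
    have h5 : ((R ^ 2 / (dist w c * dist z c) * dist w z) ^ (n - 6))⁻¹ * (R / dist z c) ^ (n - 6) =
        dist w c ^ (n - 6) * ((R ^ (n - 6))⁻¹ * (dist w z ^ (n - 6))⁻¹) := by
      rw [← inv_pow, ← inv_pow, ← inv_pow, ← mul_pow, ← mul_pow, ← mul_pow]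
      congr 1
      rw [mul_inv, inv_div]
      field_simp
    rw [hu.kelvin_rpow hR hw', dist_inversion_inversion hw hzc, mul_assoc, mul_assoc (_ ^ critExp n),
      h5]
    calc _ = ((R / dist w c) ^ (2 * n) * dist w c ^ (n - 6)) * (u (inversion c R w) ^ critExp n *
            ((R ^ (n - 6))⁻¹ * (dist w z ^ (n - 6))⁻¹)) := by ring
      _ = _ := by
        rw [h4]
        field_simp
  have i1 := hA1.integrableOn (s := S)
  have i2 := (hA2.integrableOn (s := S)).mul_const ((R / dist z c) ^ (n - 6))
  have j1 := hB1.congr e1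
  have j2 := (hB2.mul_const ((R / dist z c) ^ (n - 6))).congr e2
  have hfun : ∀ w, (kelvin c R u w ^ critExp n - u w ^ critExp n) * sphereKernel c R z w =
      (kelvin c R u w ^ critExp n * (dist w z ^ (n - 6))⁻¹ +
        u w ^ critExp n * (dist w (inversion c R z) ^ (n - 6))⁻¹ * (R / dist z c) ^ (n - 6)) -
      (u w ^ critExp n * (dist w z ^ (n - 6))⁻¹ + kelvin c R u w ^ critExp n *
        ((R / dist z c) ^ (n - 6) * (dist w (inversion c R z) ^ (n - 6))⁻¹)) := fun w => by
    unfold sphereKernel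
    ring
  have k1 : ∫ y, u y ^ critExp n * (dist y z ^ (n - 6))⁻¹ =
      ∫ w in S, (u w ^ critExp n * (dist w z ^ (n - 6))⁻¹ + kelvin c R u w ^ critExp n *
        ((R / dist z c) ^ (n - 6) * (dist w (inversion c R z) ^ (n - 6))⁻¹)) := by
    rw [integral_add i1 j1, h1', integral_congr_ae e1]
  have k2 : (∫ y, u y ^ critExp n * (dist y (inversion c R z) ^ (n - 6))⁻¹) *
      (R / dist z c) ^ (n - 6) = ∫ w in S, (kelvin c R u w ^ critExp n * (dist w z ^ (n - 6))⁻¹ +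
        u w ^ critExp n * (dist w (inversion c R z) ^ (n - 6))⁻¹ * (R / dist z c) ^ (n - 6)) := by
    rw [integral_add j2 i2, h2', ← integral_congr_ae e2, integral_mul_const, integral_mul_const]
    ring
  simp only [hfun]
  refine ⟨(j2.add i2).sub (i1.add j1), ?_⟩
  have k3 := integral_sub (j2.add i2) (i1.add j1)
  simp only [Pi.add_apply] at k3
  rw [k3, ← k1, ← k2]
  unfold kelvin
  rw [h1, h2]
  ring

theorem mul_dist_inversion_sq_sub {c z w : Pt n} {R : ℝ} (hR : 0 < R) (hz : z ≠ c) :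
    (dist w (inversion c R z) * dist z c) ^ 2 - (R * dist w z) ^ 2 =
      (R ^ 2 - dist z c ^ 2) * (R ^ 2 - dist w c ^ 2) := by
  have hd : 0 < dist z c := dist_pos.2 hz
  have h1 : w - inversion c R z = (w - c) - (R / dist z c) ^ 2 • (z - c) := by
    have := inversion_vsub_center c R z
    simp only [vsub_eq_sub] at this
    rw [← this]
    abel
  have h2 : w - z = (w - c) - (z - c) := by abel
  rw [dist_eq_norm w, dist_eq_norm w z, dist_eq_norm w c, h1, h2]
  have h3 : ‖z - c‖ = dist z c := (dist_eq_norm z c).symm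
  generalize w - c = x at *
  generalize z - c = y at *
  rw [mul_pow, mul_pow, norm_sub_sq_real, norm_sub_sq_real, norm_smul, inner_smul_right,
    Real.norm_of_nonneg (by positivity), h3]
  field_simp
  ring

theorem sphereKernel_bounds (hn : 7 ≤ n) {c z w : Pt n} {R : ℝ} (hR : 0 < R) (hz : z ≠ c)
    (hzR : z ∈ Metric.ball c R) (hwR : w ∈ Metric.ball c R) (hwz : w ≠ z) :
    0 < sphereKernel c R z w ∧ sphereKernel c R z w ≤ (dist w z ^ (n - 6))⁻¹ := by
  rw [Metric.mem_ball] at hzR hwR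
  have hd : 0 < dist z c := dist_pos.2 hz
  have hwzd : 0 < dist w z := dist_pos.2 hwz
  have h1 := mul_dist_inversion_sq_sub (w := w) hR hz
  have h2 : 0 < (R ^ 2 - dist z c ^ 2) * (R ^ 2 - dist w c ^ 2) := by
    apply mul_pos <;> nlinarith [dist_nonneg (x := w) (y := c)]
  have h3 : R * dist w z < dist w (inversion c R z) * dist z c :=
    lt_of_pow_lt_pow_left₀ 2 (by positivity) (by linarith)
  have hI : 0 < dist w (inversion c R z) := by
    have : 0 < dist w (inversion c R z) * dist z c := lt_trans (by positivity) h3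
    exact pos_of_mul_pos_left this hd.le
  unfold sphereKernel
  refine ⟨?_, sub_le_self _ (by positivity)⟩
  rw [sub_pos, ← inv_pow, ← mul_pow, ← inv_pow]
  refine pow_lt_pow_left₀ ?_ (by positivity) (by omega)
  rw [← div_eq_mul_inv, div_div, div_lt_iff₀ (by positivity), inv_mul_eq_div, lt_div_iff₀ hwzd]
  linarith

end KelvinTransform

section MovingSphere
variable {n : ℕ}

open EuclideanGeometry

theorem integrable_indicator_riesz (hn : 7 ≤ n) (r : ℝ) :
    Integrable ((Metric.ball (0 : Pt n) r).indicator fun w => (‖w‖ ^ (n - 6))⁻¹) := by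
  have : Nonempty (Fin n) := ⟨⟨0, by omega⟩⟩
  have h1 : ((Metric.ball (0 : Pt n) r).indicator fun w => (‖w‖ ^ (n - 6))⁻¹) =
      fun w => (Set.Iio r).indicator (fun s : ℝ => (s ^ (n - 6))⁻¹) ‖w‖ := by
    ext w
    by_cases hw : ‖w‖ < r
    · rw [Set.indicator_of_mem (by simpa using hw), Set.indicator_of_mem (by simpa using hw)]
    · rw [Set.indicator_of_notMem (by simpa using hw), Set.indicator_of_notMem (by simpa using hw)]
  rw [h1, integrable_fun_norm_addHaar, finrank_euclideanSpace_fin]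
  have h2 : IntegrableOn (fun s : ℝ => s ^ 5) (Set.Ioo 0 r) :=
    ((continuous_pow 5).integrableOn_Icc (a := 0) (b := r)).mono_set Set.Ioo_subset_Icc_self
  have h3 : IntegrableOn ((Set.Iio r).indicator fun s : ℝ => s ^ 5) (Set.Ioi 0) := by
    rw [IntegrableOn, integrable_indicator_iff measurableSet_Iio, IntegrableOn,
      Measure.restrict_restrict measurableSet_Iio, Set.inter_comm, Set.Ioi_inter_Iio]
    exact h2
  refine h3.congr_fun (fun s (hs : 0 < s) => ?_) measurableSet_Ioi
  by_cases hsr : s ∈ Set.Iio r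
  · simp only [Set.indicator_of_mem hsr, smul_eq_mul]
    rw [show n - 1 = 5 + (n - 6) by omega, pow_add]
    field_simp
  · simp [Set.indicator_of_notMem hsr]

/-- Uniform smallness of the Riesz potentials of sets of small volume. -/
theorem exists_setIntegral_riesz_lt (hn : 7 ≤ n) (ρ : ℝ) {η : ℝ} (hη : 0 < η) :
    ∃ δ > 0, ∀ c : Pt n, ∀ s, MeasurableSet s → s ⊆ Metric.ball c ρ → volume s < δ →
      ∀ z ∈ Metric.ball c ρ, IntegrableOn (fun w => (dist w z ^ (n - 6))⁻¹) s ∧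
        ∫ w in s, (dist w z ^ (n - 6))⁻¹ < η := by
  set F := (Metric.ball (0 : Pt n) (2 * ρ)).indicator fun w => (‖w‖ ^ (n - 6))⁻¹ with hF
  have hFi : Integrable F := integrable_indicator_riesz hn _
  have h1 := hFi.tendsto_setIntegral_nhds_zero
    (l := comap (fun s : Set (Pt n) => volume s) (𝓝 0)) (s := id) tendsto_comap
  have h2 := h1.eventually_lt_const hη
  rw [eventually_comap] at h2
  obtain ⟨δ, hδ, h3⟩ := ENNReal.nhds_zero_basis.eventually_iff.1 h2
  refine ⟨δ, hδ, fun c s hs hsB hvol z hz => ?_⟩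
  have heq : Set.EqOn (fun w => F (w - z)) (fun w => (dist w z ^ (n - 6))⁻¹) s := by
    intro w hw
    have h4 := Metric.mem_ball.1 (hsB hw)
    have h5 := Metric.mem_ball.1 hz
    have h6 : dist w z < 2 * ρ := by
      have := dist_triangle_right w z c
      linarith
    simp only [hF]
    rw [Set.indicator_of_mem (by rwa [mem_ball_zero_iff, ← dist_eq_norm]), ← dist_eq_norm]
  have hint : IntegrableOn (fun w => F (w - z)) s := (hFi.comp_sub_right z).integrableOn
  refine ⟨hint.congr_fun heq hs, ?_⟩
  rw [← setIntegral_congr_fun hs heq]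
  set t : Set (Pt n) := (fun w => w + z) ⁻¹' s with ht
  have hvt : volume t < δ := by rwa [ht, measure_preimage_add_right]
  have h7 : ∫ w in s, F (w - z) = ∫ w in t, F w := by
    rw [← integral_indicator hs, ← integral_indicator (by exact (measurable_add_const z) hs),
      ← integral_add_right_eq_self _ z]
    congr 1
    ext w
    by_cases hw : w + z ∈ s
    · rw [Set.indicator_of_mem hw, Set.indicator_of_mem (by exact hw), add_sub_cancel_right]
    · rw [Set.indicator_of_notMem hw, Set.indicator_of_notMem (by exact hw)]
  rw [h7]
  exact h3 hvt t rfl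

theorem rpow_sub_rpow_le {a b p : ℝ} (hb : 0 ≤ b) (ha : 0 < a) (hp : 1 ≤ p) :
    a ^ p - b ^ p ≤ p * a ^ (p - 1) * (a - b) := by
  have h1 := one_add_mul_self_le_rpow_one_add (s := b / a - 1)
    (by have : 0 ≤ b / a := by positivity
        linarith) hp
  rw [add_sub_cancel, div_rpow hb ha.le, le_div_iff₀ (by positivity)] at h1
  have h2 : a ^ p = a ^ (p - 1) * a := by
    rw [rpow_sub_one ha.ne', div_mul_cancel₀ _ ha.ne']
  have h3 : (1 + p * (b / a - 1)) * a ^ p = a ^ p - p * a ^ (p - 1) * (a - b) := by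
    rw [h2]
    field_simp
    ring
  linarith

/-- The set where the comparison with the Kelvin transform fails. -/
def badSet (c : Pt n) (R : ℝ) (u : Pt n → ℝ) : Set (Pt n) :=
  {z | z ∈ Metric.ball c R ∧ z ≠ c ∧ inversion c R z ≠ 0 ∧ kelvin c R u z < u z}

theorem ne_zero_of_mem_ball {c z : Pt n} {R : ℝ} (hR : R ≤ ‖c‖) (hz : z ∈ Metric.ball c R) :
    z ≠ 0 := by
  rintro rfl
  rw [Metric.mem_ball, dist_zero_left] at hz
  linarith

theorem IsPositiveSolution.continuousAt {u : Pt n → ℝ} (hu : IsPositiveSolution u) {z : Pt n}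
    (hz : z ≠ 0) : ContinuousAt u z :=
  hu.continuousOn.continuousAt (isOpen_compl_singleton.mem_nhds hz)

theorem continuousAt_inversion_uncurry {c z : Pt n} {R : ℝ} (hzc : z ≠ c) :
    ContinuousAt (fun q : ℝ × Pt n => inversion c q.1 q.2) (R, z) :=
  continuousAt_const.inversion continuousAt_fst continuousAt_snd hzc

theorem IsPositiveSolution.continuousAt_kelvin {u : Pt n → ℝ} (hu : IsPositiveSolution u)
    {c z : Pt n} {R : ℝ} (hzc : z ≠ c) (hI : inversion c R z ≠ 0) :
    ContinuousAt (fun q : ℝ × Pt n => kelvin c q.1 u q.2) (R, z) := by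
  have h1 : ContinuousAt (fun q : ℝ × Pt n => u (inversion c q.1 q.2)) (R, z) :=
    ContinuousAt.comp (f := fun q : ℝ × Pt n => inversion c q.1 q.2) (x := (R, z))
      (hu.continuousAt hI) (continuousAt_inversion_uncurry hzc)
  have h2 : ContinuousAt (fun q : ℝ × Pt n => q.1 / dist q.2 c) (R, z) :=
    continuousAt_fst.div (continuousAt_snd.dist continuousAt_const) (dist_ne_zero.2 hzc)
  exact (h2.pow _).mul h1

theorem IsPositiveSolution.eventually_mem_badSet {u : Pt n → ℝ} (hu : IsPositiveSolution u)
    {c z : Pt n} {R : ℝ} (hRc : R ≤ ‖c‖) (hz : z ∈ badSet c R u) :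
    ∀ᶠ q : ℝ × Pt n in 𝓝 (R, z), q.2 ∈ badSet c q.1 u := by
  obtain ⟨h1, h2, h3, h4⟩ := hz
  have hz0 := ne_zero_of_mem_ball hRc h1
  have hc1 : ContinuousAt (fun q : ℝ × Pt n => u q.2) (R, z) :=
    ContinuousAt.comp (f := fun q : ℝ × Pt n => q.2) (x := (R, z)) (hu.continuousAt hz0)
      continuousAt_snd
  filter_upwards [ContinuousAt.eventually_lt (f := fun q : ℝ × Pt n => dist q.2 c)
      (g := fun q => q.1) (by fun_prop) continuousAt_fst h1,
    continuousAt_snd.eventually_ne h2,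
    (continuousAt_inversion_uncurry h2).eventually_ne h3,
    (hu.continuousAt_kelvin h2 h3).eventually_lt hc1 h4] with q e1 e2 e3 e4
  exact ⟨e1, e2, e3, e4⟩

theorem IsPositiveSolution.isOpen_badSet {u : Pt n → ℝ} (hu : IsPositiveSolution u)
    {c : Pt n} {R : ℝ} (hRc : R ≤ ‖c‖) : IsOpen (badSet c R u) := by
  rw [isOpen_iff_mem_nhds]
  intro z hz
  exact (Continuous.prodMk_right R).continuousAt.eventually (hu.eventually_mem_badSet hRc hz)

theorem IsPositiveSolution.exists_le_closedBall {u : Pt n → ℝ} (hu : IsPositiveSolution u)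
    {c : Pt n} {ρ : ℝ} (hρ : ρ < ‖c‖) : ∃ M, 0 < M ∧ ∀ z ∈ Metric.closedBall c ρ, u z ≤ M := by
  have hs : Metric.closedBall c ρ ⊆ {0}ᶜ := by
    intro z hz h0
    rw [Set.mem_singleton_iff] at h0
    subst h0
    rw [Metric.mem_closedBall, dist_zero_left] at hz
    linarith
  obtain ⟨M, hM⟩ := (isCompact_closedBall c ρ).bddAbove_image (hu.continuousOn.mono hs)
  exact ⟨max M 1, by positivity, fun z hz => (hM ⟨z, hz, rfl⟩).trans (le_max_left _ _)⟩

theorem IsPositiveSolution.exists_badSet_eq_empty {u : Pt n → ℝ} (hu : IsPositiveSolution u)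
    {C : ℝ} (hC0 : 0 < C) (hC : HasRieszRepresentation C u) {c : Pt n} {ρ : ℝ} (hρ : ρ < ‖c‖) :
    ∃ δ > 0, ∀ R, 0 < R → R ≤ ρ → volume (badSet c R u) < δ → badSet c R u = ∅ := by
  have hn := hu.le_dim
  have hp : 1 < critExp n := one_lt_critExp hn
  obtain ⟨M, hM0, hM⟩ := hu.exists_le_closedBall hρ
  set A := critExp n * M ^ (critExp n - 1) with hA
  have hA0 : 0 < A := by positivity
  obtain ⟨δ, hδ, h1⟩ := exists_setIntegral_riesz_lt hn ρ (show 0 < (2 * (C * A))⁻¹ by positivity)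
  refine ⟨δ, hδ, fun R hR hRρ hvol => ?_⟩
  by_contra hne
  have hne := Set.nonempty_iff_ne_empty.2 hne
  have hRc : R ≤ ‖c‖ := by linarith
  set D := badSet c R u with hD
  have hDm : MeasurableSet D := (hu.isOpen_badSet hRc).measurableSet
  have hDB : D ⊆ Metric.ball c R := fun z hz => hz.1
  have hBρ : Metric.ball c R ⊆ Metric.ball c ρ := Metric.ball_subset_ball hRρ
  have hkpos : ∀ z ∈ D, 0 < kelvin c R u z := fun z hz => hu.kelvin_pos hR hz.2.1 hz.2.2.1
  have huM : ∀ z ∈ D, u z ≤ M := fun z hz =>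
    hM z (Metric.ball_subset_closedBall (hBρ (hDB hz)))
  set S := sSup ((fun z => u z - kelvin c R u z) '' D) with hS
  have hbdd : BddAbove ((fun z => u z - kelvin c R u z) '' D) := by
    refine ⟨M, ?_⟩
    rintro _ ⟨z, hz, rfl⟩
    have := hkpos z hz
    have := huM z hz
    simp only
    linarith
  have hle : ∀ z ∈ D, u z - kelvin c R u z ≤ S := fun z hz => le_csSup hbdd ⟨z, hz, rfl⟩
  have hS0 : 0 < S := by
    obtain ⟨z, hz⟩ := hne
    have := hle z hz
    have := hz.2.2.2
    linarith
  have hhalf : S ≤ S / 2 := by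
    refine csSup_le (hne.image _) ?_
    rintro _ ⟨z, hz, rfl⟩
    obtain ⟨hzi, hzlt⟩ := h1 c D hDm (hDB.trans hBρ) hvol z (hBρ (hDB hz))
    obtain ⟨hki, hk⟩ := hu.kelvin_sub hC hR (ne_zero_of_mem_ball hRc (hDB hz)) hz.2.1 hz.2.2.1
    have hmono : ∫ w in Metric.ball c R, -((kelvin c R u w ^ critExp n - u w ^ critExp n)
        * sphereKernel c R z w) ≤
        ∫ w in Metric.ball c R, D.indicator (fun w => A * S * (dist w z ^ (n - 6))⁻¹) w := by
      refine integral_mono_ae hki.neg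
        ((integrable_indicator_iff hDm).2 (hzi.const_mul (A * S))).integrableOn ?_
      have hgen : ∀ᵐ w ∂(volume.restrict (Metric.ball c R)), w ≠ z ∧ w ≠ c ∧
          inversion c R w ≠ 0 := by
        refine ae_restrict_of_ae ?_
        filter_upwards [ae_ne (by omega) z, ae_ne (by omega) c,
          ae_ne (by omega) (inversion c R 0)] with w hw hw' hw''
        refine ⟨hw, hw', fun h => hw'' ?_⟩
        rw [← h, inversion_inversion c hR.ne']
      filter_upwards [hgen, ae_restrict_mem Metric.isOpen_ball.measurableSet] with w ⟨hwz, hwc, hwI⟩ hwB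
      obtain ⟨hK0, hK1⟩ := sphereKernel_bounds hn hR hz.2.1 (hDB hz) hwB hwz
      have hkw := hu.kelvin_pos hR hwc hwI
      have huw := hu.pos w (ne_zero_of_mem_ball hRc hwB)
      by_cases hwD : w ∈ D
      · rw [Set.indicator_of_mem hwD]
        have h5 := rpow_sub_rpow_le hkw.le huw hp.le
        have h6 : u w ^ (critExp n - 1) ≤ M ^ (critExp n - 1) :=
          rpow_le_rpow huw.le (huM w hwD) (by linarith)
        have h7 : 0 < u w - kelvin c R u w := sub_pos.2 hwD.2.2.2
        have h8 : u w ^ critExp n - kelvin c R u w ^ critExp n ≤ A * S := by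
          refine h5.trans ?_
          rw [hA]
          gcongr
          exact hle w hwD
        calc -((kelvin c R u w ^ critExp n - u w ^ critExp n) * sphereKernel c R z w)
            = (u w ^ critExp n - kelvin c R u w ^ critExp n) * sphereKernel c R z w := by ring
          _ ≤ A * S * (dist w z ^ (n - 6))⁻¹ := by gcongr
      · rw [Set.indicator_of_notMem hwD, neg_nonpos]
        refine mul_nonneg (sub_nonneg.2 ?_) hK0.le
        refine rpow_le_rpow huw.le ?_ (by linarith)
        by_contra hlt
        exact hwD ⟨hwB, hwc, hwI, not_le.1 hlt⟩
    rw [integral_neg, setIntegral_indicator hDm, Set.inter_eq_right.2 hDB, integral_const_mul] at hmono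
    have h9 : A * S * ∫ w in D, (dist w z ^ (n - 6))⁻¹ ≤ A * S * (2 * (C * A))⁻¹ := by gcongr
    have h10 : C * (A * S * (2 * (C * A))⁻¹) = S / 2 := by field_simp
    have h11 := mul_le_mul_of_nonneg_left (hmono.trans h9) hC0.le
    simp only
    linarith
  linarith

theorem IsPositiveSolution.lt_kelvin_of_badSet_eq_empty {u : Pt n → ℝ} (hu : IsPositiveSolution u)
    {C : ℝ} (hC0 : 0 < C) (hC : HasRieszRepresentation C u)
    (hsing : ∀ M ε : ℝ, 0 < ε → ∃ x, x ≠ 0 ∧ ‖x‖ < ε ∧ M < u x) {c : Pt n} {R : ℝ}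
    (hR : 0 < R) (hRc : R < ‖c‖) (hD : badSet c R u = ∅) {z : Pt n} (hzB : z ∈ Metric.ball c R)
    (hzc : z ≠ c) (hI : inversion c R z ≠ 0) : u z < kelvin c R u z := by
  have hn := hu.le_dim
  have hn0 : 0 < n := by omega
  have : Nonempty (Fin n) := ⟨⟨0, hn0⟩⟩
  have hp := one_lt_critExp hn
  obtain ⟨hki, hk⟩ := hu.kelvin_sub hC hR (ne_zero_of_mem_ball hRc.le hzB) hzc hI
  have hle : ∀ w ∈ Metric.ball c R, w ≠ c → inversion c R w ≠ 0 → u w ≤ kelvin c R u w := by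
    intro w hw hwc hwI
    by_contra hlt
    have : w ∈ badSet c R u := ⟨hw, hwc, hwI, not_le.1 hlt⟩
    rw [hD] at this
    exact this
  have hgen : ∀ᵐ w ∂(volume.restrict (Metric.ball c R)), w ≠ z ∧ w ≠ c ∧
      inversion c R w ≠ 0 := by
    refine ae_restrict_of_ae ?_
    filter_upwards [ae_ne hn0 z, ae_ne hn0 c, ae_ne hn0 (inversion c R 0)] with w hw hw' hw''
    refine ⟨hw, hw', fun h => hw'' ?_⟩
    rw [← h, inversion_inversion c hR.ne']
  have hnn : 0 ≤ᵐ[volume.restrict (Metric.ball c R)] fun w =>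
      (kelvin c R u w ^ critExp n - u w ^ critExp n) * sphereKernel c R z w := by
    filter_upwards [hgen, ae_restrict_mem Metric.isOpen_ball.measurableSet] with w ⟨hwz, hwc, hwI⟩ hwB
    refine mul_nonneg (sub_nonneg.2 ?_) (sphereKernel_bounds hn hR hzc hzB hwB hwz).1.le
    exact rpow_le_rpow (hu.pos w (ne_zero_of_mem_ball hRc.le hwB)).le (hle w hwB hwc hwI)
      (by linarith)
  set V : Set (Pt n) := {w | w ∈ Metric.ball c R ∧ w ≠ c ∧ inversion c R w ≠ 0 ∧
    u w < kelvin c R u w} with hV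
  have hVo : IsOpen V := by
    rw [isOpen_iff_mem_nhds]
    rintro w ⟨h1, h2, h3, h4⟩
    have hq : ContinuousAt (fun w : Pt n => (R, w)) w := (Continuous.prodMk_right R).continuousAt
    filter_upwards [Metric.isOpen_ball.mem_nhds h1, isOpen_compl_singleton.mem_nhds h2,
      (ContinuousAt.comp (f := fun w : Pt n => (R, w)) (x := w)
        (continuousAt_inversion_uncurry h2) hq).eventually_ne h3,
      (hu.continuousAt (ne_zero_of_mem_ball hRc.le h1)).eventually_lt
        (ContinuousAt.comp (f := fun w : Pt n => (R, w)) (x := w)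
          (hu.continuousAt_kelvin h2 h3) hq) h4] with y e1 e2 e3 e4
    exact ⟨e1, e2, e3, e4⟩
  have hVn : V.Nonempty := by
    obtain ⟨M, hM0, hM⟩ := hu.exists_le_closedBall hRc
    obtain ⟨y, hy0, hyn, hyM⟩ := hsing M (‖c‖ - R) (by linarith)
    have hyR : R < dist y c := by
      have := norm_sub_norm_le c y
      rw [dist_eq_norm, norm_sub_rev]
      linarith
    have hyc : y ≠ c := by
      rintro rfl
      rw [dist_self] at hyR
      linarith
    have hIB : inversion c R y ∈ Metric.ball c R := by
      rw [Metric.mem_ball, dist_inversion_center, div_lt_iff₀ (by linarith)]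
      nlinarith
    refine ⟨inversion c R y, hIB, ?_, ?_, ?_⟩
    · rwa [Ne, inversion_eq_center hR.ne']
    · rwa [inversion_inversion c hR.ne']
    · unfold kelvin
      rw [inversion_inversion c hR.ne', dist_inversion_center]
      have h5 : 1 ≤ R / (R ^ 2 / dist y c) := by
        rw [div_div_eq_mul_div, one_le_div (by positivity)]
        nlinarith
      have h6 : 1 ≤ (R / (R ^ 2 / dist y c)) ^ (n - 6) := one_le_pow₀ h5
      have h7 := hM _ (Metric.ball_subset_closedBall hIB)
      nlinarith
  have hpos : 0 < ∫ w in Metric.ball c R,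
      (kelvin c R u w ^ critExp n - u w ^ critExp n) * sphereKernel c R z w := by
    rw [setIntegral_pos_iff_support_of_nonneg_ae hnn hki]
    have h8 : 0 < volume (V \ {z}) := by
      rw [measure_sdiff_null (by simp)]
      exact hVo.measure_pos volume hVn
    refine h8.trans_le (measure_mono ?_)
    rintro w ⟨⟨h1, h2, h3, h4⟩, h5⟩
    refine ⟨?_, h1⟩
    have h6 := rpow_lt_rpow (hu.pos w (ne_zero_of_mem_ball hRc.le h1)).le h4
      (show 0 < critExp n by linarith)
    exact (mul_pos (sub_pos.2 h6) (sphereKernel_bounds hn hR hzc hzB h1 h5).1).ne'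
  have := mul_pos hC0 hpos
  linarith

/-- The method of moving spheres: all spheres not enclosing the singularity are admissible. -/
theorem IsPositiveSolution.badSet_eq_empty {u : Pt n → ℝ} (hu : IsPositiveSolution u)
    {C : ℝ} (hC0 : 0 < C) (hC : HasRieszRepresentation C u)
    (hsing : ∀ M ε : ℝ, 0 < ε → ∃ x, x ≠ 0 ∧ ‖x‖ < ε ∧ M < u x) {c : Pt n} {ρ : ℝ}
    (hρ0 : 0 < ρ) (hρ : ρ < ‖c‖) : badSet c ρ u = ∅ := by
  have hn := hu.le_dim
  have hn0 : 0 < n := by omega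
  have : Nonempty (Fin n) := ⟨⟨0, hn0⟩⟩
  obtain ⟨δ, hδ, hsmall⟩ := hu.exists_badSet_eq_empty hC0 hC hρ
  obtain ⟨a, ha0, haρ, hva⟩ : ∃ a, 0 < a ∧ a ≤ ρ ∧ volume (Metric.ball c a) < δ := by
    have h1 : Tendsto (fun a : ℝ => ENNReal.ofReal (a ^ n) * volume (Metric.ball (0 : Pt n) 1))
        (𝓝[>] 0) (𝓝 0) := by
      have h2 : Tendsto (fun a : ℝ => ENNReal.ofReal (a ^ n)) (𝓝 0) (𝓝 0) := by
        have : Continuous fun a : ℝ => ENNReal.ofReal (a ^ n) :=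
          ENNReal.continuous_ofReal.comp (continuous_pow n)
        simpa [hn0.ne'] using this.tendsto 0
      have h3 := ENNReal.Tendsto.mul_const h2 (Or.inr (measure_ball_lt_top
        (μ := (volume : Measure (Pt n))) (x := 0) (r := 1)).ne)
      rw [zero_mul] at h3
      exact h3.mono_left nhdsWithin_le_nhds
    obtain ⟨a, h4, h5, h6⟩ := ((h1.eventually_lt_const hδ).and
      ((Ioc_mem_nhdsGT hρ0 : Set.Ioc 0 ρ ∈ 𝓝[>] (0 : ℝ)))).exists
    refine ⟨a, h5, h6, ?_⟩
    rw [Measure.addHaar_ball _ _ h5.le, finrank_euclideanSpace_fin]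
    exact h4
  have hkey : Set.Icc a ρ ⊆ {R | badSet c R u = ∅} := by
    refine IsClosed.Icc_subset_of_forall_exists_gt ?_ ?_ ?_
    · have ho : IsOpen {R | R < ‖c‖ ∧ (badSet c R u).Nonempty} := by
        rw [isOpen_iff_mem_nhds]
        rintro R ⟨hR, z, hz⟩
        have h1 := (Continuous.prodMk_left z).continuousAt.eventually
          (hu.eventually_mem_badSet hR.le hz)
        filter_upwards [h1, Iio_mem_nhds hR] with R' h2 h3
        exact ⟨h3, z, h2⟩
      have heq : {R | badSet c R u = ∅} ∩ Set.Icc a ρ =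
          Set.Icc a ρ ∩ {R | R < ‖c‖ ∧ (badSet c R u).Nonempty}ᶜ := by
        ext R
        constructor
        · rintro ⟨h1, h2⟩
          exact ⟨h2, fun h3 => h3.2.ne_empty h1⟩
        · rintro ⟨h1, h2⟩
          refine ⟨?_, h1⟩
          by_contra h3
          exact h2 ⟨h1.2.trans_lt hρ, Set.nonempty_iff_ne_empty.2 h3⟩
      rw [heq]
      exact isClosed_Icc.inter ho.isClosed_compl
    · exact hsmall a ha0 haρ ((measure_mono fun z hz => hz.1).trans_lt hva)
    · rintro R ⟨hRD, hRa, hRρ⟩ y hy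
      have hR0 : 0 < R := by linarith
      have hRc : R < ‖c‖ := by linarith
      have hlim : Tendsto (fun R' => volume (badSet c (min R' ρ) u)) (𝓝[>] R) (𝓝 0) := by
        have h0 : volume (∅ : Set (Pt n)) = 0 := measure_empty
        rw [← h0]
        refine tendsto_measure_of_ae_tendsto_indicator (𝓝[>] R) MeasurableSet.empty (fun R' => ?_)
          (B := Metric.ball c ρ) Metric.isOpen_ball.measurableSet measure_ball_lt_top.ne
          (Eventually.of_forall fun R' z hz =>
            Metric.ball_subset_ball (min_le_right _ _) hz.1) ?_
        · exact (hu.isOpen_badSet ((min_le_right _ _).trans hρ.le)).measurableSet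
        · have hsph : ∀ᵐ z : Pt n, z ∉ Metric.sphere c R :=
            measure_eq_zero_iff_ae_notMem.1
              (Measure.addHaar_sphere (volume : Measure (Pt n)) c R)
          have hmin : Tendsto (fun R' => min R' ρ) (𝓝[>] R) (𝓝 R) := by
            have h1 : Continuous fun R' : ℝ => min R' ρ := by fun_prop
            have h2 := h1.tendsto R
            rw [min_eq_left hRρ.le] at h2
            exact h2.mono_left nhdsWithin_le_nhds
          filter_upwards [hsph, ae_ne hn0 c, ae_ne hn0 (inversion c R 0)] with z hz hzc hzI
          have hI : inversion c R z ≠ 0 := by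
            intro h
            rw [← h, inversion_inversion c hR0.ne'] at hzI
            exact hzI rfl
          rcases lt_or_gt_of_ne (show dist z c ≠ R from hz) with h3 | h3
          · have h4 := hu.lt_kelvin_of_badSet_eq_empty hC0 hC hsing hR0 hRc hRD h3 hzc hI
            have hq : Tendsto (fun R' => (min R' ρ, z)) (𝓝[>] R) (𝓝 (R, z)) :=
              hmin.prodMk_nhds tendsto_const_nhds
            have h5 := ((hu.continuousAt_kelvin hzc hI).tendsto.comp hq).eventually_const_lt h4
            filter_upwards [h5] with R' h6
            simp only [Set.mem_empty_iff_false, iff_false]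
            rintro ⟨-, -, -, h7⟩
            exact lt_asymm h6 h7
          · filter_upwards [hmin.eventually_lt_const h3] with R' h4
            simp only [Set.mem_empty_iff_false, iff_false]
            rintro ⟨h5, -⟩
            rw [Metric.mem_ball] at h5
            linarith
      obtain ⟨R', h1, h2, h3⟩ := ((hlim.eventually_lt_const hδ).and
        ((Ioc_mem_nhdsGT (lt_min hRρ hy) : Set.Ioc R (min ρ y) ∈ 𝓝[>] R))).exists
      have h4 : R' ≤ ρ := h3.trans (min_le_left _ _)
      rw [min_eq_left h4] at h1
      exact ⟨R', hsmall R' (hR0.trans h2) h4 h1, h2, h3.trans (min_le_right _ _)⟩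
  exact hkey ⟨haρ, le_rfl⟩

end MovingSphere

section Radial
variable {n : ℕ}

open EuclideanGeometry

/-- A positive solution that is unbounded near the origin. -/
structure IsSingularSolution (u : Pt n → ℝ) : Prop extends IsPositiveSolution u where
  singular : ∀ M ε : ℝ, 0 < ε → ∃ x, x ≠ 0 ∧ ‖x‖ < ε ∧ M < u x

namespace IsSingularSolution

variable {u : Pt n → ℝ}

theorem le_kelvin (hu : IsSingularSolution u) {c z : Pt n} {R : ℝ} (hR : 0 < R) (hRc : R < ‖c‖)
    (hz : z ∈ Metric.ball c R) (hzc : z ≠ c) (hI : inversion c R z ≠ 0) :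
    u z ≤ kelvin c R u z := by
  obtain ⟨C, hC0, hC⟩ := hu.exists_representation
  have hrep : HasRieszRepresentation C u := fun x hx => by
    simpa only [dist_eq_norm] using hC x hx
  by_contra! h
  have : z ∈ badSet c R u := ⟨hz, hzc, hI, h⟩
  rw [hu.badSet_eq_empty hC0 hrep hu.singular hR hRc] at this
  exact this

/-- Comparison of the values at two points by the sphere, centred on their line, that exchanges
them. -/
theorem le_sqrt_pow_mul (hu : IsSingularSolution u) {x y : Pt n} (hy : y ≠ 0)
    (hxy : x ≠ y) {s : ℝ} (hs : 0 < s) (h : 0 < ‖x‖ ^ 2 + s * (‖x‖ ^ 2 - ‖y‖ ^ 2)) :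
    u x ≤ √((1 + s) / s) ^ (n - 6) * u y := by
  set d := dist x y with hd
  have hd0 : 0 < d := dist_pos.2 hxy
  set c := x + s • (x - y) with hc
  set R := √(s * (1 + s)) * d with hR
  have hR0 : 0 < R := by positivity
  have hR2 : R ^ 2 = s * (1 + s) * d ^ 2 := by
    rw [hR, mul_pow, sq_sqrt (by positivity)]
  have hxc : dist x c = s * d := by
    rw [dist_eq_norm, hc, sub_add_cancel_left, norm_neg, norm_smul, Real.norm_of_nonneg hs.le, hd,
      dist_eq_norm]
  have hRc : R < ‖c‖ := by
    refine lt_of_pow_lt_pow_left₀ 2 (norm_nonneg _) ?_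
    have h1 := norm_add_sq_real x (s • (x - y))
    have h2 := norm_sub_sq_real x (x - y)
    rw [inner_smul_right, norm_smul, Real.norm_of_nonneg hs.le, ← dist_eq_norm, ← hd, ← hc] at h1
    rw [sub_sub_cancel, ← dist_eq_norm, ← hd] at h2
    rw [hR2, h1]
    nlinarith
  have hsd : s * d < R := by
    refine lt_of_pow_lt_pow_left₀ 2 hR0.le ?_
    rw [hR2]
    have : 0 < s * d ^ 2 := by positivity
    nlinarith
  have hI : inversion c R x = y := by
    rw [inversion, hxc, div_pow, hR2, hc, vsub_eq_sub, vadd_eq_add, sub_add_cancel_left, smul_neg,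
      smul_smul, show s * (1 + s) * d ^ 2 / (s * d) ^ 2 * s = 1 + s by field_simp]
    module
  have h1 := hu.le_kelvin hR0 hRc (z := x) (by rwa [Metric.mem_ball, hxc])
    (dist_pos.1 (by rw [hxc]; positivity)) (by rwa [hI])
  have h2 : R / (s * d) = √((1 + s) / s) := by
    rw [eq_comm, sqrt_eq_iff_mul_self_eq_of_pos (by positivity), ← sq, div_pow, hR2]
    field_simp
  rwa [kelvin, hI, hxc, h2] at h1

theorem le_of_norm_le (hu : IsSingularSolution u) {x y : Pt n} (hy : y ≠ 0) (h : ‖y‖ ≤ ‖x‖) :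
    u x ≤ u y := by
  rcases eq_or_ne x y with rfl | hxy
  · exact le_rfl
  have hx : 0 < ‖x‖ := (norm_pos_iff.2 hy).trans_le h
  have h1 : Tendsto (fun s : ℝ => √((1 + s) / s) ^ (n - 6) * u y) atTop (𝓝 (u y)) := by
    have h2 : Tendsto (fun s : ℝ => (1 + s) / s) atTop (𝓝 1) := by
      have h3 : Tendsto (fun s : ℝ => s⁻¹ + 1) atTop (𝓝 (0 + 1)) :=
        tendsto_inv_atTop_zero.add_const 1
      rw [zero_add] at h3
      refine h3.congr' ?_
      filter_upwards [eventually_gt_atTop 0] with s hs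
      field_simp
    simpa using ((h2.sqrt).pow (n - 6)).mul_const (u y)
  refine ge_of_tendsto h1 ?_
  filter_upwards [eventually_gt_atTop 0] with s hs
  refine hu.le_sqrt_pow_mul hy hxy hs ?_
  have h3 : 0 ≤ ‖x‖ ^ 2 - ‖y‖ ^ 2 := by
    have := pow_le_pow_left₀ (norm_nonneg y) h 2
    linarith
  have := mul_nonneg hs.le h3
  positivity

theorem le_pow_mul_of_norm_lt (hu : IsSingularSolution u) {x y : Pt n} (hx : x ≠ 0)
    (h : ‖x‖ < ‖y‖) : u x ≤ (‖y‖ / ‖x‖) ^ (n - 6) * u y := by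
  have hx0 := norm_pos_iff.2 hx
  have hy0 := hx0.trans h
  have hD : 0 < ‖y‖ ^ 2 - ‖x‖ ^ 2 := by nlinarith
  set s₀ := ‖x‖ ^ 2 / (‖y‖ ^ 2 - ‖x‖ ^ 2) with hs₀
  have hs₀0 : 0 < s₀ := by positivity
  have h1 : ContinuousAt (fun s : ℝ => √((1 + s) / s) ^ (n - 6) * u y) s₀ :=
    ((((continuousAt_const.add continuousAt_id).div continuousAt_id hs₀0.ne').sqrt).pow _).mul
      continuousAt_const
  have h2 : √((1 + s₀) / s₀) = ‖y‖ / ‖x‖ := by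
    rw [sqrt_eq_iff_mul_self_eq_of_pos (by positivity), hs₀]
    field_simp
    ring
  have h3 := h1.tendsto
  simp only [h2] at h3
  refine ge_of_tendsto (h3.mono_left (nhdsWithin_le_nhds (s := Set.Iio s₀))) ?_
  filter_upwards [Ioo_mem_nhdsLT hs₀0] with s hs
  refine hu.le_sqrt_pow_mul (norm_pos_iff.1 hy0) (fun h' => by rw [h'] at h; exact lt_irrefl _ h)
    hs.1 ?_
  have := (lt_div_iff₀ hD).1 hs.2
  linarith

theorem eq_of_norm_eq (hu : IsSingularSolution u) {x y : Pt n} (hx : x ≠ 0) (h : ‖x‖ = ‖y‖) :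
    u x = u y := by
  have hy : y ≠ 0 := norm_pos_iff.1 (h ▸ norm_pos_iff.2 hx)
  exact le_antisymm (hu.le_of_norm_le hy h.ge) (hu.le_of_norm_le hx h.le)

theorem laplacian_const (k : ℝ) : laplacian (fun _ : Pt n => k) = fun _ => 0 := by
  funext x
  simp [laplacian_eq_sum_fderiv_fderiv]

theorem smul_lt (hu : IsSingularSolution u) {x : Pt n} (hx : x ≠ 0) {c : ℝ} (hc : 1 < c) :
    u (c • x) < u x := by
  have hx0 := norm_pos_iff.2 hx
  have hc0 : 0 < c := by linarith
  have hcx : ‖c • x‖ = c * ‖x‖ := by rw [norm_smul, Real.norm_of_nonneg hc0.le]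
  refine (hu.le_of_norm_le hx (by rw [hcx]; nlinarith)).lt_of_ne fun h => ?_
  set y := ((1 + c) / 2) • x with hy
  have hyn : ‖y‖ = (1 + c) / 2 * ‖x‖ := by
    rw [norm_smul, Real.norm_of_nonneg (by linarith)]
  have hy0 : y ≠ 0 := smul_ne_zero (by linarith) hx
  have hev : u =ᶠ[𝓝 y] fun _ => u x := by
    filter_upwards [continuous_norm.continuousAt.eventually (Ioo_mem_nhds
      (show ‖x‖ < ‖y‖ by rw [hyn]; nlinarith) (show ‖y‖ < c * ‖x‖ by rw [hyn]; nlinarith))]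
      with z hz
    refine le_antisymm (hu.le_of_norm_le hx hz.1.le) ?_
    rw [← h]
    exact hu.le_of_norm_le (norm_pos_iff.1 (hx0.trans hz.1)) (by rw [hcx]; exact hz.2.le)
  have h1 := triLaplacian_congr hev
  rw [hu.pde y hy0, triLaplacian, laplacian_const, laplacian_const, laplacian_const] at h1
  have := mul_pos (cN_pos hu.le_dim) (rpow_pos_of_pos (hu.pos y hy0) (critExp n))
  linarith

/-- The growth bound at the critical rate. -/
theorem exists_rpow_mul_le (hu : IsSingularSolution u) :
    ∃ M, ∀ x, x ≠ 0 → ‖x‖ ^ decayExp n * u x ≤ M := by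
  have hn := hu.le_dim
  obtain ⟨C, hC0, hC⟩ := exists_unit_annulus_bound hn
  have hn0 : 0 < n := by omega
  set e : Pt n := EuclideanSpace.single ⟨0, hn0⟩ 1 with he
  have hen : ‖e‖ = 1 := by simp [he]
  set V := volume.real (annulus n 1) with hV
  have hV0 : 0 < V := by
    refine ENNReal.toReal_pos (ne_of_gt ?_) (isCompact_annulus 1).measure_ne_top
    have hsub : Metric.ball ((3 / 2 : ℝ) • e) (1 / 2) ⊆ annulus n 1 := by
      intro z hz
      have h1 : ‖z - (3 / 2 : ℝ) • e‖ < 1 / 2 := by simpa [dist_eq_norm] using hz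
      have h2 : ‖(3 / 2 : ℝ) • e‖ = 3 / 2 := by
        rw [norm_smul, hen]
        norm_num
      have h3 := norm_sub_norm_le z ((3 / 2 : ℝ) • e)
      have h4 := norm_sub_norm_le ((3 / 2 : ℝ) • e) z
      rw [norm_sub_rev] at h4
      constructor <;> linarith
    exact (Metric.measure_ball_pos volume _ (by norm_num)).trans_le (measure_mono hsub)
  refine ⟨2 ^ decayExp n * (C / V + 1), fun x hx => ?_⟩
  set R := ‖x‖ / 2 with hR
  have hx0 := norm_pos_iff.2 hx
  have hR0 : 0 < R := by positivity
  have hp := one_lt_critExp hn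
  have hs0 : 0 < R ^ decayExp n * u x := mul_pos (rpow_pos_of_pos hR0 _) (hu.pos x hx)
  have h1 := hC _ (hu.toIsPositiveSolution.scale hR0)
  have h2 : V * (R ^ decayExp n * u x) ^ critExp n ≤
      ∫ y in annulus n 1, (R ^ decayExp n * u (R • y)) ^ critExp n := by
    have h3 : ∫ _ in annulus n 1, (R ^ decayExp n * u x) ^ critExp n =
        V * (R ^ decayExp n * u x) ^ critExp n := by
      rw [setIntegral_const, smul_eq_mul]
    rw [← h3]
    refine setIntegral_mono_on (integrableOn_const (isCompact_annulus 1).measure_ne_top)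
      (((hu.toIsPositiveSolution.scale hR0).continuousOn_rpow.mono
        (annulus_subset_compl one_pos)).integrableOn_compact (isCompact_annulus 1))
      (isCompact_annulus 1).measurableSet fun y hy => ?_
    have hy0 : y ≠ 0 := annulus_subset_compl one_pos hy
    refine rpow_le_rpow hs0.le (mul_le_mul_of_nonneg_left
      (hu.le_of_norm_le (smul_ne_zero hR0.ne' hy0) ?_) (rpow_nonneg hR0.le _)) (by linarith)
    rw [norm_smul, Real.norm_of_nonneg hR0.le, hR]
    have := hy.2
    nlinarith
  have h3 : R ^ decayExp n * u x ≤ C / V + 1 := by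
    have h5 : (R ^ decayExp n * u x) ^ critExp n ≤ C / V := by
      rw [le_div_iff₀ hV0, mul_comm]
      linarith
    have h6 : 0 ≤ (R ^ decayExp n * u x) ^ critExp n := by positivity
    rcases le_total (R ^ decayExp n * u x) 1 with h | h
    · linarith
    · have := rpow_le_rpow_of_exponent_le h hp.le
      rw [rpow_one] at this
      linarith
  have h4 : ‖x‖ = 2 * R := by rw [hR]; ring
  rw [h4, mul_rpow two_pos.le hR0.le, mul_assoc]
  exact mul_le_mul_of_nonneg_left h3 (by positivity)

end IsSingularSolution

end Radial

section Polar
variable {n : ℕ}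

/-- The radial function with profile `f` in logarithmic coordinates and homogeneity `b`. -/
def polar (n : ℕ) (b : ℝ) (f : ℝ → ℝ) (x : Pt n) : ℝ := ‖x‖ ^ b * f (-log ‖x‖)

theorem hasDerivAt_rpow_mul_comp_log {f : ℝ → ℝ} {f' q : ℝ} (b : ℝ) (hq : 0 < q)
    (hf : HasDerivAt f f' (-(log q / 2))) :
    HasDerivAt (fun q => q ^ b * f (-(log q / 2)))
      (q ^ (b - 1) * (b * f (-(log q / 2)) - f' / 2)) q := by
  have h1 := (hasDerivAt_rpow_const (p := b) (Or.inl hq.ne'))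
  have h2 := hf.comp q ((hasDerivAt_log hq.ne').div_const 2).neg
  refine (h1.mul h2).congr_deriv ?_
  have h3 : q ^ b = q ^ (b - 1) * q := by
    rw [← rpow_add_one hq.ne', sub_add_cancel]
  simp only [Function.comp, Pi.neg_apply]
  rw [h3]
  field_simp
  ring

theorem laplacian_polar {f f' f'' : ℝ → ℝ} (b : ℝ) (hf : ∀ t, HasDerivAt f (f' t) t)
    (hf' : ∀ t, HasDerivAt f' (f'' t) t) {x : Pt n} (hx : x ≠ 0) :
    laplacian (polar n b f) x =
      polar n (b - 2) (fun t => f'' t - (2 * b + n - 2) * f' t + b * (b + n - 2) * f t) x := by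
  have hx0 := norm_pos_iff.2 hx
  have hq : 0 < ‖x‖ ^ 2 := by positivity
  have h1 : polar n b f = fun y => (fun q => q ^ (b / 2) * f (-(log q / 2))) (‖y‖ ^ 2) := by
    funext y
    simp only [polar]
    rw [← rpow_natCast_mul (norm_nonneg y), log_pow]
    congr 2 <;> push_cast <;> ring
  have hH : ∀ᶠ r in 𝓝 (‖x‖ ^ 2), HasDerivAt (fun q => q ^ (b / 2) * f (-(log q / 2)))
      (r ^ (b / 2 - 1) * (b / 2 * f (-(log r / 2)) - f' (-(log r / 2)) / 2)) r := by
    filter_upwards [lt_mem_nhds hq] with r hr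
    exact hasDerivAt_rpow_mul_comp_log _ hr (hf _)
  have hH' := hasDerivAt_rpow_mul_comp_log (b / 2 - 1) hq
    (((hf (-(log (‖x‖ ^ 2) / 2))).const_mul (b / 2)).sub ((hf' _).div_const 2))
  rw [h1, laplacian_radial (H' := fun r =>
    r ^ (b / 2 - 1) * (b / 2 * f (-(log r / 2)) - f' (-(log r / 2)) / 2)) hH hH']
  have h2 : (‖x‖ ^ 2) ^ (b / 2 - 1) = ‖x‖ ^ (b - 2) := by
    rw [← rpow_natCast_mul (norm_nonneg x)]
    congr 1
    push_cast
    ring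
  have h3 : ‖x‖ ^ 2 * (‖x‖ ^ 2) ^ (b / 2 - 1 - 1) = ‖x‖ ^ (b - 2) := by
    rw [mul_comm, ← rpow_add_one hq.ne', sub_add_cancel, h2]
  have h4 : -(log (‖x‖ ^ 2) / 2) = -log ‖x‖ := by
    rw [log_pow]
    push_cast
    ring
  simp only [polar, h4, h2, Pi.sub_apply]
  linear_combination 4 * ((b / 2 - 1) * (b / 2 * f (-log ‖x‖) - f' (-log ‖x‖) / 2)
    - (b / 2 * f' (-log ‖x‖) - f'' (-log ‖x‖) / 2) / 2) * h3

/-- The action of the Laplacian on profiles, in terms of the sequence of derivatives. -/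
def polarOp (n : ℕ) (b : ℝ) (V : ℕ → ℝ → ℝ) (i : ℕ) (t : ℝ) : ℝ :=
  V (i + 2) t - (2 * b + n - 2) * V (i + 1) t + b * (b + n - 2) * V i t

theorem hasDerivAt_polarOp {m : ℕ} {V : ℕ → ℝ → ℝ} (b : ℝ)
    (hV : ∀ i < m + 2, ∀ t, HasDerivAt (V i) (V (i + 1) t) t) :
    ∀ i < m, ∀ t, HasDerivAt (polarOp n b V i) (polarOp n b V (i + 1) t) t := fun i hi t =>
  ((hV (i + 2) (by omega) t).sub ((hV (i + 1) (by omega) t).const_mul _)).add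
    ((hV i (by omega) t).const_mul _)

theorem triLaplacian_polar {V : ℕ → ℝ → ℝ} (b : ℝ)
    (hV : ∀ i < 6, ∀ t, HasDerivAt (V i) (V (i + 1) t) t) {x : Pt n} (hx : x ≠ 0) :
    triLaplacian (polar n b (V 0)) x =
      polar n (b - 6) (polarOp n (b - 4) (polarOp n (b - 2) (polarOp n b V)) 0) x := by
  have h1 := hasDerivAt_polarOp (n := n) (m := 4) b hV
  have h2 := hasDerivAt_polarOp (n := n) (m := 2) (b - 2) h1
  have hev : ∀ᶠ y in 𝓝 x, y ≠ 0 := isOpen_compl_singleton.mem_nhds hx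
  have e1 : laplacian (polar n b (V 0)) =ᶠ[𝓝 x] polar n (b - 2) (polarOp n b V 0) := by
    filter_upwards [hev] with y hy
    exact laplacian_polar b (hV 0 (by norm_num)) (hV 1 (by norm_num)) hy
  have e2 : laplacian (polar n (b - 2) (polarOp n b V 0)) =ᶠ[𝓝 x]
      polar n (b - 4) (polarOp n (b - 2) (polarOp n b V) 0) := by
    filter_upwards [hev] with y hy
    have := laplacian_polar (b - 2) (h1 0 (by norm_num)) (h1 1 (by norm_num)) hy
    rw [show b - 2 - 2 = b - 4 by ring] at this
    exact this
  have e3 := laplacian_polar (b - 4) (h2 0 (by norm_num)) (h2 1 (by norm_num)) hx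
  rw [show b - 4 - 2 = b - 6 by ring] at e3
  rw [triLaplacian, ((laplacian_congr e1).trans e2 |> laplacian_congr).eq_of_nhds, e3]
  rfl

end Polar

section EmdenFowler
variable {n : ℕ}

/-- The profile of a function along the ray spanned by `e`, in logarithmic coordinates. -/
def profile (e : Pt n) (u : Pt n → ℝ) (t : ℝ) : ℝ :=
  exp (-(decayExp n * t)) * u (exp (-t) • e)

namespace IsSingularSolution

variable {u : Pt n → ℝ} {e : Pt n}

theorem exp_smul_ne_zero (he : ‖e‖ = 1) (t : ℝ) : exp t • e ≠ 0 :=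
  smul_ne_zero (exp_ne_zero t) (norm_ne_zero_iff.1 (by rw [he]; norm_num))

theorem norm_exp_smul (he : ‖e‖ = 1) (t : ℝ) : ‖exp t • e‖ = exp t := by
  rw [norm_smul, he, mul_one, Real.norm_of_nonneg (exp_pos t).le]

theorem profile_pos (hu : IsSingularSolution u) (he : ‖e‖ = 1) (t : ℝ) : 0 < profile e u t :=
  mul_pos (exp_pos _) (hu.pos _ (exp_smul_ne_zero he _))

theorem contDiff_profile (hu : IsSingularSolution u) (he : ‖e‖ = 1) :
    ContDiff ℝ 6 (profile e u) := by
  have h1 : ContDiff ℝ 6 fun t : ℝ => exp (-t) • e := by fun_prop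
  have h2 : ContDiff ℝ 6 fun t : ℝ => exp (-(decayExp n * t)) := by fun_prop
  exact h2.mul (hu.contDiffOn.comp_contDiff h1 fun t => exp_smul_ne_zero he _)

theorem eq_polar (hu : IsSingularSolution u) (he : ‖e‖ = 1) {x : Pt n} (hx : x ≠ 0) :
    u x = polar n (-decayExp n) (profile e u) x := by
  have hx0 := norm_pos_iff.2 hx
  rw [polar, profile, neg_neg, exp_log hx0, rpow_def_of_pos hx0, ← mul_assoc, ← exp_add,
    show log ‖x‖ * -decayExp n + -(decayExp n * -log ‖x‖) = 0 by ring, exp_zero, one_mul]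
  exact hu.eq_of_norm_eq hx (by rw [norm_smul, he, norm_norm, mul_one])

theorem profile_le (hu : IsSingularSolution u) (he : ‖e‖ = 1) : ∃ M, ∀ t, profile e u t ≤ M := by
  obtain ⟨M, hM⟩ := hu.exists_rpow_mul_le
  refine ⟨M, fun t => ?_⟩
  have h1 := hM _ (exp_smul_ne_zero he (-t))
  rw [norm_exp_smul he, ← exp_mul] at h1
  rwa [profile, show -(decayExp n * t) = -t * decayExp n by ring]

theorem exp_mul_profile (u : Pt n → ℝ) (t : ℝ) :
    exp (decayExp n * t) * profile e u t = u (exp (-t) • e) := by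
  rw [profile, ← mul_assoc, ← exp_add, add_neg_cancel, exp_zero, one_mul]

theorem monotone_exp_mul_profile (hu : IsSingularSolution u) (he : ‖e‖ = 1) :
    Monotone fun t => exp (decayExp n * t) * profile e u t := fun s t hst => by
  simp only [exp_mul_profile]
  refine hu.le_of_norm_le (exp_smul_ne_zero he _) ?_
  rw [norm_exp_smul he, norm_exp_smul he]
  exact exp_le_exp.2 (neg_le_neg hst)

theorem antitone_exp_neg_mul_profile (hu : IsSingularSolution u) (he : ‖e‖ = 1) :
    Antitone fun t => exp (-(decayExp n * t)) * profile e u t := fun s t hst => by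
  rcases hst.eq_or_lt with rfl | hst
  · exact le_rfl
  have hn := hu.le_dim
  have h1 := hu.le_pow_mul_of_norm_lt (exp_smul_ne_zero he (-t)) (y := exp (-s) • e)
    (by rw [norm_exp_smul he, norm_exp_smul he]; exact exp_lt_exp.2 (by linarith))
  rw [norm_exp_smul he, norm_exp_smul he, ← exp_sub, ← exp_nat_mul, Nat.cast_sub (by omega)] at h1
  simp only [profile, ← mul_assoc, ← exp_add]
  calc _ ≤ exp (-(decayExp n * t) + -(decayExp n * t)) *
        (exp (((n : ℝ) - (6 : ℕ)) * (-s - -t)) * u (exp (-s) • e)) :=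
        mul_le_mul_of_nonneg_left h1 (exp_pos _).le
    _ = _ := by
      rw [← mul_assoc, ← exp_add]
      congr 2
      unfold decayExp
      push_cast
      ring

theorem not_bounded_exp_mul_profile (hu : IsSingularSolution u) (he : ‖e‖ = 1) :
    ¬ ∃ M, ∀ t, exp (decayExp n * t) * profile e u t ≤ M := by
  rintro ⟨M, hM⟩
  obtain ⟨x, hx, -, hlt⟩ := hu.singular M 1 one_pos
  have h1 := hM (-log ‖x‖)
  rw [exp_mul_profile, neg_neg, exp_log (norm_pos_iff.2 hx)] at h1
  have h2 := hu.eq_of_norm_eq hx (y := ‖x‖ • e) (by rw [norm_smul, he, norm_norm, mul_one])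
  linarith

theorem isEmdenFowler (hu : IsSingularSolution u) (he : ‖e‖ = 1) :
    IsEmdenFowler (decayExp n) fun i => iteratedDeriv i (profile e u) where
  deriv i hi t := by
    rw [iteratedDeriv_succ]
    refine DifferentiableAt.hasDerivAt ?_
    exact (hu.contDiff_profile he).differentiable_iteratedDeriv i (by exact_mod_cast hi) t
  pos t := by
    rw [iteratedDeriv_zero]
    exact hu.profile_pos he t
  ode t := by
    have hn := hu.le_dim
    have hder : ∀ i < 6, ∀ t, HasDerivAt (iteratedDeriv i (profile e u))
        (iteratedDeriv (i + 1) (profile e u) t) t := fun i hi t => by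
      rw [iteratedDeriv_succ]
      exact ((hu.contDiff_profile he).differentiable_iteratedDeriv i
        (by exact_mod_cast hi) t).hasDerivAt
    set x := exp (-t) • e with hx
    have hx0 : x ≠ 0 := exp_smul_ne_zero he _
    have hxn : ‖x‖ = exp (-t) := norm_exp_smul he _
    have h1 : u =ᶠ[𝓝 x] polar n (-decayExp n) (profile e u) := by
      filter_upwards [isOpen_compl_singleton.mem_nhds hx0] with y hy
      exact hu.eq_polar he hy
    have h2 := triLaplacian_polar (n := n) (V := fun i => iteratedDeriv i (profile e u))
      (-decayExp n) hder hx0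
    simp only [iteratedDeriv_zero] at h2 ⊢
    rw [← triLaplacian_congr h1, hu.pde x hx0, hu.eq_polar he hx0] at h2
    have hp : 0 < ‖x‖ ^ (-decayExp n) := rpow_pos_of_pos (norm_pos_iff.2 hx0) _
    have hdn : decayExp n * critExp n = decayExp n + 6 := decayExp_mul_critExp hn
    simp only [polar] at h2
    rw [hxn, log_exp, neg_neg, mul_rpow (rpow_nonneg (exp_pos _).le _) (hu.profile_pos he t).le,
      ← rpow_mul (exp_pos _).le, neg_mul, hdn, show -(decayExp n + 6) = -decayExp n - 6 by ring]
      at h2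
    have h3 : 0 < exp (-t) ^ (-decayExp n - 6) := rpow_pos_of_pos (exp_pos _) _
    have h4 := mul_left_cancel₀ h3.ne' (b := -(cN n * profile e u t ^ critExp n))
      (by rw [← h2]; ring)
    have h5 : (n : ℝ) = 2 * decayExp n + 6 := by
      unfold decayExp
      ring
    have h6 : 1 + 6 / decayExp n = critExp n := by
      have := one_le_sub_six hn
      rw [critExp_eq hn, decayExp]
      field_simp
      ring
    rw [h6]
    have h7 : cN n = decayExp n * (decayExp n + 1) * (decayExp n + 2) * (decayExp n + 3)
        * (decayExp n + 4) * (decayExp n + 5) := by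
      rw [cN, h5]
      ring
    rw [← h7]
    simp only [polarOp, zero_add, Nat.reduceAdd, iteratedDeriv_zero] at h4
    rw [h5] at h4
    generalize decayExp n = a at h4 ⊢
    linear_combination h4

end IsSingularSolution

end EmdenFowler

end

theorem classification_of_singular_solutions
    (n : ℕ) (hn : 7 ≤ n)
    (u : EuclideanSpace ℝ (Fin n) → ℝ)
    (hpos : ∀ x : EuclideanSpace ℝ (Fin n), x ≠ 0 → 0 < u x)
    (hreg : ContDiffOn ℝ 6 u {x : EuclideanSpace ℝ (Fin n) | x ≠ 0})
    (hpde : ∀ x : EuclideanSpace ℝ (Fin n), x ≠ 0 →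
      -(laplacian (laplacian (laplacian u)) x) = cN n * u x ^ (((n : ℝ) + 6) / ((n : ℝ) - 6)))
    (hsing : ∀ M : ℝ, ∀ ε : ℝ, 0 < ε → ∃ x : EuclideanSpace ℝ (Fin n),
      x ≠ 0 ∧ ‖x‖ < ε ∧ M < u x) :
    (∀ x y : EuclideanSpace ℝ (Fin n), x ≠ 0 → y ≠ 0 → ‖x‖ = ‖y‖ → u x = u y) ∧
    (∀ x : EuclideanSpace ℝ (Fin n), x ≠ 0 → ∀ c : ℝ, 1 < c → u (c • x) < u x) ∧
    (∃ v : ℝ → ℝ, ContDiff ℝ 6 v ∧ (∀ t : ℝ, 0 < v t) ∧ (∃ M : ℝ, ∀ t : ℝ, |v t| ≤ M) ∧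
      (∀ t : ℝ, iteratedDeriv 6 v t - K4 n * iteratedDeriv 4 v t + K2 n * iteratedDeriv 2 v t
        - K0 n * v t + cN n * |v t| ^ (12 / ((n : ℝ) - 6)) * v t = 0) ∧
      ((v = fun _ => aStar n) ∨ (∃ p : ℝ, 0 < p ∧ ∀ t : ℝ, v (t + p) = v t)) ∧
      (∀ x : EuclideanSpace ℝ (Fin n), x ≠ 0 →
        u x = ‖x‖ ^ ((6 - (n : ℝ)) / 2) * v (-Real.log ‖x‖))) := by
  have hu : IsSingularSolution u :=
    { le_dim := hn
      pos := hpos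
      contDiffOn := hreg
      pde := fun x hx => by
        have := hpde x hx
        rw [triLaplacian, critExp]
        linarith
      singular := hsing }
  obtain ⟨e, he⟩ : ∃ e : Pt n, ‖e‖ = 1 := ⟨EuclideanSpace.single ⟨0, by omega⟩ 1, by simp⟩
  have h6 := one_le_sub_six hn
  have hV := hu.isEmdenFowler he
  obtain ⟨M, hM⟩ := hu.profile_le he
  refine ⟨fun x y hx _ h => hu.eq_of_norm_eq hx h, fun x hx c hc => hu.smul_lt hx hc,
    profile e u, hu.contDiff_profile he, hu.profile_pos he,
    ⟨M, fun t => (abs_of_pos (hu.profile_pos he t)).trans_le (hM t)⟩, fun t => ?_, Or.inr ?_,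
    fun x hx => ?_⟩
  · have h1 := hV.ode t
    have h0 := hu.profile_pos he t
    have h5 : (n : ℝ) = 2 * decayExp n + 6 := by
      unfold decayExp
      ring
    have h7 : 12 / ((n : ℝ) - 6) = 6 / decayExp n := by
      unfold decayExp
      field_simp
      norm_num
    simp only [iteratedDeriv_zero] at h1
    rw [rpow_add h0, rpow_one] at h1
    rw [abs_of_pos h0, h7, K0, K2, K4, cN, h5]
    linear_combination -h1
  · obtain ⟨p, hp, hper⟩ := hV.exists_periodic (by unfold decayExp; linarith)
      ⟨M, fun t => by simpa using hM t⟩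
      (by simpa using hu.monotone_exp_mul_profile he)
      (by simpa using hu.antitone_exp_neg_mul_profile he)
      (by simpa using hu.not_bounded_exp_mul_profile he)
    rw [iteratedDeriv_zero] at hper
    exact ⟨p, hp, hper⟩
  · rw [hu.eq_polar he hx, polar, decayExp]
    congr 2
    ring
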